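/- arXiv:2109.13106 — 3 statements merged into one kernel-verified Lean document; each statement's English description precedes it below -/
import Mathlib

section
/- Let d be a positive odd integer and let μ₀, μ₁, …, μ_d be d+1 finite measures on ℝ^d × ℝ^d, each absolutely continuous with respect to the Lebesgue measure on ℝ^{2d}. For t ∈ ℝ let μ_{i,t} denote the pushforward of μᵢ under the map (p, w) ↦ p + t·w. Then at least one of the following holds: (a) there exist a unit vector v ∈ ℝ^d and a real number m such that for every i = 0, 1, …, d, μᵢ{(p, w) : ⟨w, v⟩ ≤ m} = μᵢ{(p, w) : ⟨w, v⟩ ≥ m} (all measures share a median speed in direction v); or (b) there exist t ∈ ℝ, a unit vector v ∈ ℝ^d, and c ∈ ℝ such that for every i = 0, 1, …, d, μ_{i,t}({x : ⟨x, v⟩ ≥ c}) = μ_{i,t}({x : ⟨x, v⟩ ≤ c}); that is, at time t a single hyperplane simultaneously bisects all d+1 measures. -/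
open MeasureTheory
open scoped RealInnerProductSpace

namespace DynamicHamSandwich

open Finset Function

section Coboundary

variable {β γ : Type*}

/-- The coboundary, mod 2, of a cochain on lists: the sum of its values on all the lists obtained
by omitting one entry. -/
def coboundary : (List β → ZMod 2) → List β → ZMod 2
  | _, [] => 0
  | F, a :: l => F l + coboundary (fun m => F (a :: m)) l

lemma coboundary_congr {F G : List β → ZMod 2} {l : List β}
    (h : ∀ m, m.Sublist l → F m = G m) : coboundary F l = coboundary G l := by
  induction l generalizing F G with
  | nil => rfl
  | cons a l ih =>
    simp only [coboundary]
    rw [h l (List.sublist_cons_self a l), ih fun m hm => h _ (hm.cons_cons a)]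

lemma coboundary_map (g : β → γ) (F : List γ → ZMod 2) (l : List β) :
    coboundary (fun m => F (m.map g)) l = coboundary F (l.map g) := by
  induction l generalizing F with
  | nil => rfl
  | cons a l ih =>
    simp only [coboundary, List.map_cons]
    rw [ih fun m => F (g a :: m)]

lemma coboundary_zero (l : List β) : coboundary (fun _ => 0) l = 0 := by
  induction l with
  | nil => rfl
  | cons a l ih => simp [coboundary, ih]

lemma coboundary_perm {F : List β → ZMod 2} (hF : ∀ l m, l.Perm m → F l = F m)
    {l m : List β} (h : l.Perm m) : coboundary F l = coboundary F m := by
  induction h generalizing F with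
  | nil => rfl
  | cons a h ih =>
    simp only [coboundary]
    rw [hF _ _ h, ih fun l m hlm => hF _ _ (hlm.cons a)]
  | swap a b l =>
    simp only [coboundary]
    have : (fun m => F (b :: a :: m)) = fun m => F (a :: b :: m) :=
      funext fun m => hF _ _ (List.Perm.swap a b m)
    rw [this]
    ring
  | trans _ _ ih₁ ih₂ => rw [ih₁ hF, ih₂ hF]

end Coboundary

section Fan

/-- A list of signs alternates, starting with the given sign. -/
def Alternates : Bool → List Bool → Prop
  | _, [] => True
  | b, s :: l => s = b ∧ Alternates (!b) l

open Classical in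
/-- The indicator of alternating sign lists. -/
noncomputable def altIndicator (b : Bool) (l : List Bool) : ZMod 2 :=
  if Alternates b l then 1 else 0

lemma coboundary_altIndicator (b : Bool) {l : List Bool} (hl : l ≠ []) :
    coboundary (altIndicator b) l = altIndicator b l + altIndicator (!b) l := by
  induction l generalizing b with
  | nil => exact absurd rfl hl
  | cons s l ih =>
    have hcons : ∀ b' m, altIndicator b' (s :: m) = if s = b' then altIndicator (!b') m else 0 := by
      intro b' m
      by_cases h : s = b'
      · have : Alternates b' (s :: m) ↔ Alternates (!b') m := by simp [Alternates, h]
        rw [if_pos h]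
        classical exact if_congr this rfl rfl
      · have : ¬ Alternates b' (s :: m) := fun ha => h ha.1
        rw [altIndicator, if_neg this, if_neg h]
    simp only [coboundary, hcons]
    rcases eq_or_ne l [] with rfl | hne
    · cases b <;> cases s <;> simp [coboundary, altIndicator, Alternates]
    · by_cases h : s = b
      · subst h
        simp only [if_true, Bool.not_not]
        have e : coboundary (fun m => altIndicator (!s) m) l = _ := ih (!s) hne
        rw [e, Bool.not_not]
        have := CharTwo.add_self_eq_zero (altIndicator s l)
        cases s <;> simp <;> linear_combination this
      · have h' : s = !b := by cases s <;> cases b <;> simp_all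
        subst h'
        cases b <;> simp [coboundary_zero]

variable {κ : Type*} [LinearOrder κ]

open Classical in
/-- The indicator of the lists of signed labels which, once sorted by absolute value, have distinct
absolute values and alternating signs, the first one being `b`. -/
noncomputable def fan (b : Bool) (l : List (κ × Bool)) : ZMod 2 :=
  if ∃ m : List (κ × Bool), m.Perm l ∧ m.Pairwise (fun x y => x.1 < y.1) ∧
      Alternates b (m.map Prod.snd)
  then 1 else 0

/-- Negation of a signed label. -/
def negLabel (x : κ × Bool) : κ × Bool := (x.1, !x.2)

lemma fan_perm (b : Bool) (l m : List (κ × Bool)) (h : l.Perm m) : fan b l = fan b m := by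
  classical
  refine if_congr (exists_congr fun k => and_congr_left' ?_) rfl rfl
  exact ⟨fun hk => hk.trans h, fun hk => hk.trans h.symm⟩

lemma fan_of_pairwise (b : Bool) {l : List (κ × Bool)}
    (h : l.Pairwise fun x y => x.1 < y.1) : fan b l = altIndicator b (l.map Prod.snd) := by
  have : (∃ m : List (κ × Bool), m.Perm l ∧ m.Pairwise (fun x y => x.1 < y.1) ∧
      Alternates b (m.map Prod.snd)) ↔ Alternates b (l.map Prod.snd) := by
    constructor
    · rintro ⟨m, hp, hm, ha⟩
      have : m = l := hp.eq_of_pairwise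
        (fun x y _ _ hxy hyx => absurd (lt_trans hxy hyx) (lt_irrefl _)) hm h
      exact this ▸ ha
    · exact fun ha => ⟨l, List.Perm.refl l, h, ha⟩
  classical exact if_congr this rfl rfl

lemma fan_eq_zero_of_not_nodup (b : Bool) {l : List (κ × Bool)}
    (h : ¬ (l.map Prod.fst).Nodup) : fan b l = 0 := by
  rw [fan, if_neg]
  rintro ⟨m, hp, hm, -⟩
  refine h ((hp.map Prod.fst).nodup_iff.1 ?_)
  rw [List.Nodup, List.pairwise_map]
  exact hm.imp fun hxy => hxy.ne

lemma alternates_map_not (b : Bool) (l : List Bool) :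
    Alternates b (l.map not) ↔ Alternates (!b) l := by
  induction l generalizing b with
  | nil => simp [Alternates]
  | cons s l ih => cases b <;> cases s <;> simp [Alternates, ih]

lemma fan_map_negLabel (b : Bool) (l : List (κ × Bool)) :
    fan b (l.map negLabel) = fan (!b) l := by
  have key : ∀ (b : Bool) (l : List (κ × Bool)),
      (∃ m : List (κ × Bool), m.Perm l ∧ m.Pairwise (fun x y => x.1 < y.1) ∧
        Alternates b (m.map Prod.snd)) →
      ∃ m : List (κ × Bool), m.Perm (l.map negLabel) ∧ m.Pairwise (fun x y => x.1 < y.1) ∧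
        Alternates (!b) (m.map Prod.snd) := by
    rintro b l ⟨m, hp, hm, ha⟩
    refine ⟨m.map negLabel, hp.map _, List.pairwise_map.2 hm, ?_⟩
    have : (m.map negLabel).map Prod.snd = (m.map Prod.snd).map not := by
      simp [negLabel, Function.comp_def]
    rw [this, alternates_map_not, Bool.not_not]
    exact ha
  have hinv : (l.map negLabel).map negLabel = l := by
    simp [negLabel, Function.comp_def]
  have h₁ := key b (l.map negLabel)
  have h₂ := key (!b) l
  rw [hinv] at h₁
  rw [Bool.not_not] at h₂
  classical exact if_congr ⟨h₁, h₂⟩ rfl rfl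

/-- Ky Fan's identity: among the facets of a simplex without complementary edges, the number of
those alternating from `b` is congruent mod 2 to the number of signs with which the simplex
alternates. -/
lemma coboundary_fan (b : Bool) {l : List (κ × Bool)} (hl : l ≠ [])
    (hc : ∀ x ∈ l, ∀ y ∈ l, x.1 = y.1 → x.2 = y.2) :
    coboundary (fan b) l = fan b l + fan (!b) l := by
  by_cases hnd : l.Nodup
  · classical
    let r : κ × Bool → κ × Bool → Prop := fun x y => x.1 ≤ y.1
    have : Std.Total r := ⟨fun x y => le_total x.1 y.1⟩
    have : IsTrans _ r := ⟨fun x y z h h' => le_trans (α := κ) h h'⟩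
    set m := l.insertionSort r with hm
    have hp : m.Perm l := List.perm_insertionSort r l
    have hs : m.Pairwise fun x y => x.1 < y.1 := by
      have h1 : m.Pairwise r := List.pairwise_insertionSort r l
      have h2 : m.Pairwise (· ≠ ·) := hp.nodup_iff.2 hnd
      refine (List.pairwise_and_iff.2 ⟨h1, h2⟩).imp_of_mem ?_
      rintro x y hx hy ⟨hle, hne⟩
      refine lt_of_le_of_ne hle fun h => hne (Prod.ext h ?_)
      exact hc x (hp.mem_iff.1 hx) y (hp.mem_iff.1 hy) h
    rw [← coboundary_perm (fan_perm b) hp, ← fan_perm b _ _ hp, ← fan_perm (!b) _ _ hp,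
      coboundary_congr fun k hk => fan_of_pairwise b (hs.sublist hk),
      coboundary_map Prod.snd (altIndicator b), coboundary_altIndicator, fan_of_pairwise _ hs,
      fan_of_pairwise _ hs]
    intro h
    rw [List.map_eq_nil_iff] at h
    rw [h] at hp
    exact hl hp.nil_eq.symm
  · have hz : ∀ k : List (κ × Bool), ¬ k.Nodup → ∀ b, fan b k = 0 := fun k hk b =>
      fan_eq_zero_of_not_nodup b fun h => hk (List.Nodup.of_map _ h)
    obtain ⟨a, ha⟩ : ∃ a, List.Sublist [a, a] l := by
      by_contra! h
      exact hnd (List.nodup_iff_sublist.2 h)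
    obtain ⟨k, hk⟩ := ha.exists_perm_append
    rw [hz l hnd, hz l hnd, coboundary_perm (fan_perm b) hk]
    have h0 : (fun m => fan b (a :: a :: m)) = fun _ => 0 :=
      funext fun m => hz _ (by simp) b
    simp only [List.cons_append, List.nil_append, coboundary, h0, coboundary_zero]
    rw [add_zero, add_zero, CharTwo.add_self_eq_zero]

end Fan

section Paths

variable {ι α : Type*} [DecidableEq ι]

/-- The sum, over all the orderings of `S`, of the value of a cochain on the path which starts at
`u` and successively moves each coordinate `i ∈ S` to `w i`; `n` is the cardinality of `S`. -/
def pathSum (w : ι → α) : ℕ → Finset ι → (ι → α) → (List (ι → α) → ZMod 2) → ZMod 2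
  | 0, _, u, F => F [u]
  | n + 1, S, u, F =>
    ∑ i ∈ S, pathSum w n (S.erase i) (update u i (w i)) fun l => F (u :: l)

/-- The paths over which `pathSum` sums. -/
inductive IsPath (w : ι → α) : Finset ι → (ι → α) → List (ι → α) → Prop
  | single (u : ι → α) : IsPath w ∅ u [u]
  | step {S : Finset ι} {u : ι → α} {l : List (ι → α)} (i : ι) (hi : i ∈ S)
      (h : IsPath w (S.erase i) (update u i (w i)) l) : IsPath w S u (u :: l)

lemma pathSum_congr {w : ι → α} {n : ℕ} {S : Finset ι} (hn : S.card = n) {u : ι → α}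
    {F G : List (ι → α) → ZMod 2} (h : ∀ l, IsPath w S u l → F l = G l) :
    pathSum w n S u F = pathSum w n S u G := by
  induction n generalizing S u F G with
  | zero =>
    obtain rfl := card_eq_zero.1 hn
    exact h _ (.single u)
  | succ n ih =>
    refine sum_congr rfl fun i hi => ih (by rw [card_erase_of_mem hi, hn]; rfl) fun l hl => ?_
    exact h _ (.step i hi hl)

lemma pathSum_congr_target {w w' : ι → α} {n : ℕ} {S : Finset ι} (h : ∀ i ∈ S, w i = w' i)
    (u : ι → α) (F : List (ι → α) → ZMod 2) : pathSum w n S u F = pathSum w' n S u F := by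
  induction n generalizing S u F with
  | zero => rfl
  | succ n ih =>
    refine sum_congr rfl fun i hi => ?_
    rw [h i hi, ih fun j hj => h j (mem_of_mem_erase hj)]

lemma pathSum_add (w : ι → α) (n : ℕ) (S : Finset ι) (u : ι → α) (F G : List (ι → α) → ZMod 2) :
    pathSum w n S u (fun l => F l + G l) = pathSum w n S u F + pathSum w n S u G := by
  induction n generalizing S u F G with
  | zero => rfl
  | succ n ih => simp only [pathSum, ih, sum_add_distrib]

lemma pathSum_zero (w : ι → α) (n : ℕ) (S : Finset ι) (u : ι → α) :
    pathSum w n S u (fun _ => 0) = 0 := by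
  induction n generalizing S u with
  | zero => rfl
  | succ n ih => simp only [pathSum, ih, sum_const_zero]

lemma pathSum_map {w w' : ι → α} {ρ : ι → α → α} {n : ℕ} {S : Finset ι}
    (h : ∀ i ∈ S, w' i = ρ i (w i)) (u : ι → α) (F : List (ι → α) → ZMod 2) :
    pathSum w n S u (fun l => F (l.map fun v i => ρ i (v i))) =
      pathSum w' n S (fun i => ρ i (u i)) F := by
  induction n generalizing S u F with
  | zero => rfl
  | succ n ih =>
    refine sum_congr rfl fun i hi => ?_
    simp only [List.map_cons]
    rw [ih (fun j hj => h j (mem_of_mem_erase hj)) _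
      fun l => F ((fun i => ρ i (u i)) :: l)]
    congr 1
    funext j
    rcases eq_or_ne j i with rfl | hj
    · simp [h j hi]
    · simp [hj]

lemma sum_sum_erase_comm {M : Type*} [AddCommMonoid M] (S : Finset ι) (h : ι → ι → M) :
    ∑ i ∈ S, ∑ j ∈ S.erase i, h i j = ∑ j ∈ S, ∑ i ∈ S.erase j, h i j := by
  refine sum_comm' fun i j => ?_
  simp only [mem_erase]
  tauto

lemma sum_sum_erase_eq_zero (S : Finset ι) {h : ι → ι → ZMod 2}
    (hs : ∀ i ∈ S, ∀ j ∈ S, i ≠ j → h i j = h j i) : ∑ i ∈ S, ∑ j ∈ S.erase i, h i j = 0 := by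
  rw [sum_sigma']
  refine sum_involution (fun x _ => ⟨x.2, x.1⟩) ?_ ?_ ?_ ?_
  · rintro ⟨i, j⟩ hx
    simp only [mem_sigma, mem_erase] at hx
    rw [hs i hx.1 j hx.2.2 hx.2.1.symm]
    exact CharTwo.add_self_eq_zero _
  · rintro ⟨i, j⟩ hx - he
    simp only [mem_sigma, mem_erase] at hx
    simp only [Sigma.mk.injEq, heq_eq_eq] at he
    exact hx.2.1 he.1
  · rintro ⟨i, j⟩ hx
    simp only [mem_sigma, mem_erase] at hx ⊢
    exact ⟨hx.2.2, hx.2.1.symm, hx.1⟩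
  · rintro ⟨i, j⟩ hx
    rfl

/-- The boundary of the Kuhn triangulation of a cube is the sum of the Kuhn triangulations of its
faces. -/
lemma pathSum_coboundary (w : ι → α) {n : ℕ} {S : Finset ι} (hn : S.card = n + 1) (u : ι → α)
    (F : List (ι → α) → ZMod 2) :
    pathSum w (n + 1) S u (coboundary F) =
      ∑ i ∈ S, (pathSum w n (S.erase i) (update u i (w i)) F + pathSum w n (S.erase i) u F) := by
  induction n generalizing S u F with
  | zero => simp [pathSum, coboundary]
  | succ n ih =>
    have hc : ∀ i ∈ S, (S.erase i).card = n + 1 := fun i hi => by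
      rw [card_erase_of_mem hi, hn]; rfl
    rw [pathSum]
    simp only [coboundary, pathSum_add]
    have e : ∀ i ∈ S, pathSum w (n + 1) (S.erase i) (update u i (w i))
        (fun l => coboundary (fun m => F (u :: m)) l) = _ := fun i hi =>
      ih (hc i hi) (update u i (w i)) fun m => F (u :: m)
    rw [sum_add_distrib, sum_add_distrib, sum_congr rfl e]
    simp only [sum_add_distrib]
    rw [sum_sum_erase_eq_zero, zero_add, sum_sum_erase_comm]
    · congr 1
      refine sum_congr rfl fun j _ => ?_
      rw [pathSum]
      refine sum_congr rfl fun i _ => ?_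
      rw [erase_right_comm]
    · intro i _ j _ hij
      rw [erase_right_comm, update_comm hij]

lemma IsPath.length_eq {w : ι → α} {S : Finset ι} {u : ι → α} {l : List (ι → α)}
    (h : IsPath w S u l) : l.length = S.card + 1 := by
  induction h with
  | single u => rfl
  | step i hi _ ih =>
    rw [List.length_cons, ih, card_erase_of_mem hi, Nat.sub_add_cancel (card_pos.2 ⟨i, hi⟩)]

lemma IsPath.exists_eq_cons {w : ι → α} {S : Finset ι} {u : ι → α} {l : List (ι → α)}
    (h : IsPath w S u l) : ∃ m, l = u :: m := by
  cases h with
  | single => exact ⟨_, rfl⟩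
  | step => exact ⟨_, rfl⟩

lemma IsPath.apply_eq {w : ι → α} {S : Finset ι} {u : ι → α} {l : List (ι → α)}
    (h : IsPath w S u l) {v : ι → α} (hv : v ∈ l) (j : ι) : v j = u j ∨ j ∈ S ∧ v j = w j := by
  induction h with
  | single u =>
    rw [List.mem_singleton] at hv
    exact Or.inl (by rw [hv])
  | @step S u l i hi _ ih =>
    rcases List.mem_cons.1 hv with rfl | hv
    · exact Or.inl rfl
    · rcases ih hv with h | h
      · rcases eq_or_ne j i with rfl | hj
        · exact Or.inr ⟨hi, by simpa using h⟩
        · exact Or.inl (by simpa [hj] using h)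
      · exact Or.inr ⟨mem_of_mem_erase h.1, h.2⟩

/-- If a labelling does not depend on a coordinate, its values along a path moving this coordinate
repeat. -/
lemma IsPath.not_nodup_map {β : Type*} {w : ι → α} {S : Finset ι} {u : ι → α} {l : List (ι → α)}
    (h : IsPath w S u l) {j : ι} (hj : j ∈ S) (f : (ι → α) → β)
    (hf : ∀ v, (∀ i ∉ S, v i = u i) → f (update v j (w j)) = f v) : ¬ (l.map f).Nodup := by
  induction h with
  | single u => simp at hj
  | @step S u l i hi h ih =>
    rcases eq_or_ne j i with rfl | hne
    · obtain ⟨m, rfl⟩ := h.exists_eq_cons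
      simp [hf u fun _ _ => rfl]
    · intro hnd
      rw [List.map_cons, List.nodup_cons] at hnd
      refine ih (mem_erase.2 ⟨hne, hj⟩) (fun v hv => hf v fun k hk => ?_) hnd.2
      have hki : k ≠ i := fun h => hk (h ▸ hi)
      rw [hv k fun h => hk (mem_of_mem_erase h), update_of_ne hki]

end Paths

section Grid

/-- The odd element of `{k, k + 1}`. -/
def oddEnd (k : ℕ) : ℕ := if Even k then k + 1 else k

/-- The even element of `{k, k + 1}`. -/
def evenEnd (k : ℕ) : ℕ := if Even k then k else k + 1

lemma oddEnd_reflect {N k : ℕ} (hN : Even N) (hk : k < N) :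
    oddEnd (N - 1 - k) = N - oddEnd k := by
  simp only [oddEnd, Nat.even_iff] at *
  split_ifs <;> omega

lemma evenEnd_reflect {N k : ℕ} (hN : Even N) (hk : k < N) :
    evenEnd (N - 1 - k) = N - evenEnd k := by
  simp only [evenEnd, Nat.even_iff] at *
  split_ifs <;> omega

lemma sum_range_oddEnd_add_evenEnd (N : ℕ) (H : ℕ → ZMod 2) :
    ∑ k ∈ range N, (H (evenEnd k) + H (oddEnd k)) = H 0 + H N := by
  have h : ∀ k, H (evenEnd k) + H (oddEnd k) = H k + H (k + 1) := fun k => by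
    unfold evenEnd oddEnd
    split_ifs
    · rfl
    · exact add_comm _ _
  simp only [h]
  induction N with
  | zero => simp [CharTwo.add_self_eq_zero]
  | succ n ih =>
    rw [sum_range_succ, ih]
    linear_combination CharTwo.add_self_eq_zero (H n)

variable {ι : Type*} [Fintype ι] [DecidableEq ι]

/-- The cells of the grid of mesh one in the cube of side `N` with directions in `S`. -/
def cells (N : ℕ) (S : Finset ι) : Finset (ι → ℕ) :=
  Fintype.piFinset fun i => if i ∈ S then range N else {0}

lemma mem_cells {N : ℕ} {S : Finset ι} {x : ι → ℕ} :
    x ∈ cells N S ↔ (∀ i ∈ S, x i < N) ∧ ∀ i ∉ S, x i = 0 := by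
  simp only [cells, Fintype.mem_piFinset]
  constructor
  · intro h
    exact ⟨fun i hi => by simpa [hi] using h i, fun i hi => by simpa [hi] using h i⟩
  · intro h i
    by_cases hi : i ∈ S
    · simpa [hi] using h.1 i hi
    · simpa [hi] using h.2 i hi

lemma sum_cells {M : Type*} [AddCommMonoid M] (N : ℕ) {S : Finset ι} {i : ι} (hi : i ∈ S)
    (h : (ι → ℕ) → M) :
    ∑ x ∈ cells N S, h x = ∑ x ∈ cells N (S.erase i), ∑ k ∈ range N, h (update x i k) := by
  rw [← sum_product']
  refine sum_bij' (fun x _ => (update x i 0, x i)) (fun p _ => update p.1 i p.2) ?_ ?_ ?_ ?_ ?_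
  · intro x hx
    rw [mem_cells] at hx
    rw [mem_product, mem_cells, mem_range]
    refine ⟨⟨fun j hj => ?_, fun j hj => ?_⟩, hx.1 i hi⟩
    · rw [mem_erase] at hj
      simpa [hj.1] using hx.1 j hj.2
    · rcases eq_or_ne j i with rfl | hji
      · simp
      · simpa [hji] using hx.2 j fun h => hj (mem_erase.2 ⟨hji, h⟩)
  · rintro ⟨x, k⟩ hx
    rw [mem_product, mem_cells, mem_range] at hx
    rw [mem_cells]
    refine ⟨fun j hj => ?_, fun j hj => ?_⟩
    · rcases eq_or_ne j i with rfl | hji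
      · simpa using hx.2
      · simpa [hji] using hx.1.1 j (mem_erase.2 ⟨hji, hj⟩)
    · have hji : j ≠ i := fun h => hj (h ▸ hi)
      simpa [hji] using hx.1.2 j fun h => hj (mem_of_mem_erase h)
  · intro x _
    simp
  · rintro ⟨x, k⟩ hx
    rw [mem_product, mem_cells] at hx
    have : x i = 0 := hx.1.2 i (notMem_erase i S)
    simp only [update_idem, update_self, Prod.mk.injEq, and_true]
    rw [← this, update_eq_self]
  · intro x _
    simp

/-- The first vertex of the paths in the cell `x` of the cube with directions in `S` through `y`. -/
def cellStart (S : Finset ι) (y x : ι → ℕ) : ι → ℕ := fun i => if i ∈ S then oddEnd (x i) else y i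

/-- The last vertex of the paths in the cell `x`. -/
def cellEnd (x : ι → ℕ) : ι → ℕ := fun i => evenEnd (x i)

/-- The value of a cochain on the triangulated cube of side `N` with directions in `S` through
`y`. Each cell is triangulated by the paths from its odd vertex to its even one, so that the
triangulation is invariant under reflections. -/
def gridSum (N : ℕ) (S : Finset ι) (y : ι → ℕ) (F : List (ι → ℕ) → ZMod 2) : ZMod 2 :=
  ∑ x ∈ cells N S, pathSum (cellEnd x) S.card S (cellStart S y x) F

lemma gridSum_coboundary (N : ℕ) {S : Finset ι} (hS : S.Nonempty) (y : ι → ℕ)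
    (F : List (ι → ℕ) → ZMod 2) :
    gridSum N S y (coboundary F) =
      ∑ i ∈ S, (gridSum N (S.erase i) (update y i 0) F +
        gridSum N (S.erase i) (update y i N) F) := by
  obtain ⟨n, hn⟩ : ∃ n, S.card = n + 1 := ⟨S.card - 1, by have := hS.card_pos; omega⟩
  have hc : ∀ i ∈ S, (S.erase i).card = n := fun i hi => by rw [card_erase_of_mem hi, hn]; rfl
  simp only [gridSum, hn]
  rw [sum_congr rfl fun x _ => pathSum_coboundary _ hn _ _, sum_comm]
  refine sum_congr rfl fun i hi => ?_
  rw [sum_cells N hi, hc i hi, ← sum_add_distrib]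
  refine sum_congr rfl fun x _ => ?_
  rw [← sum_range_oddEnd_add_evenEnd N fun a =>
    pathSum (cellEnd x) n (S.erase i) (cellStart (S.erase i) (update y i a) x) F]
  refine sum_congr rfl fun k _ => ?_
  have hw : ∀ j ∈ S.erase i, cellEnd (update x i k) j = cellEnd x j := fun j hj => by
    simp [cellEnd, (mem_erase.1 hj).1]
  rw [pathSum_congr_target hw, pathSum_congr_target hw]
  congr 2
  · funext j
    rcases eq_or_ne j i with rfl | hji
    · simp [cellStart, cellEnd]
    · simp [cellStart, hji]
  · funext j
    rcases eq_or_ne j i with rfl | hji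
    · simp [cellStart, hi]
    · simp [cellStart, hji]

lemma gridSum_add (N : ℕ) (S : Finset ι) (y : ι → ℕ) (F G : List (ι → ℕ) → ZMod 2) :
    gridSum N S y (fun l => F l + G l) = gridSum N S y F + gridSum N S y G := by
  simp only [gridSum, pathSum_add, sum_add_distrib]

/-- Paths in a cell of the grid. -/
def IsGridPath (N : ℕ) (S : Finset ι) (y : ι → ℕ) (l : List (ι → ℕ)) : Prop :=
  ∃ x ∈ cells N S, IsPath (cellEnd x) S (cellStart S y x) l

lemma gridSum_congr {N : ℕ} {S : Finset ι} {y : ι → ℕ} {F G : List (ι → ℕ) → ZMod 2}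
    (h : ∀ l, IsGridPath N S y l → F l = G l) : gridSum N S y F = gridSum N S y G :=
  sum_congr rfl fun x hx => pathSum_congr rfl fun l hl => h l ⟨x, hx, hl⟩

lemma gridSum_zero (N : ℕ) (S : Finset ι) (y : ι → ℕ) : gridSum N S y (fun _ => 0) = 0 := by
  simp only [gridSum, pathSum_zero, sum_const_zero]

lemma gridSum_empty (N : ℕ) (y : ι → ℕ) (F : List (ι → ℕ) → ZMod 2) :
    gridSum N ∅ y F = F [y] := by
  have : cells N (∅ : Finset ι) = {0} := by
    ext x
    simp [mem_cells, funext_iff]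
  rw [gridSum, this, sum_singleton, card_empty, pathSum,
    show cellStart ∅ y 0 = y from funext fun i => if_neg (notMem_empty i)]

lemma IsGridPath.apply_eq {N : ℕ} {S : Finset ι} {y : ι → ℕ} {l : List (ι → ℕ)}
    (h : IsGridPath N S y l) {v : ι → ℕ} (hv : v ∈ l) {i : ι} (hi : i ∉ S) : v i = y i := by
  obtain ⟨x, -, hl⟩ := h
  rcases hl.apply_eq hv i with h | h
  · rw [h, cellStart, if_neg hi]
  · exact absurd h.1 hi

lemma IsGridPath.apply_le {N : ℕ} {S : Finset ι} {y : ι → ℕ} {l : List (ι → ℕ)}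
    (h : IsGridPath N S y l) {v : ι → ℕ} (hv : v ∈ l) {i : ι} (hi : i ∈ S) : v i ≤ N := by
  obtain ⟨x, hx, hl⟩ := h
  have := (mem_cells.1 hx).1 i hi
  rcases hl.apply_eq hv i with h | h
  · rw [h, cellStart, if_pos hi, oddEnd]
    split_ifs <;> omega
  · rw [h.2, cellEnd, evenEnd]
    split_ifs <;> omega

lemma IsGridPath.apply_le_succ {N : ℕ} {S : Finset ι} {y : ι → ℕ} {l : List (ι → ℕ)}
    (h : IsGridPath N S y l) {v v' : ι → ℕ} (hv : v ∈ l) (hv' : v' ∈ l) (i : ι) :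
    v i ≤ v' i + 1 := by
  by_cases hi : i ∈ S
  · obtain ⟨x, hx, hl⟩ := h
    have key : ∀ v ∈ l, v i = x i ∨ v i = x i + 1 := fun v hv => by
      rcases hl.apply_eq hv i with h | h
      · rw [h, cellStart, if_pos hi, oddEnd]
        split_ifs <;> omega
      · rw [h.2, cellEnd, evenEnd]
        split_ifs <;> omega
    have := key v hv
    have := key v' hv'
    omega
  · rw [h.apply_eq hv hi, h.apply_eq hv' hi]
    exact Nat.le_succ _

/-- Reflection of the coordinates in `R`. -/
def reflect (N : ℕ) (R : Finset ι) (v : ι → ℕ) : ι → ℕ := fun i => if i ∈ R then N - v i else v i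

lemma gridSum_reflect {N : ℕ} (hN : Even N) (R S : Finset ι) (y : ι → ℕ)
    (F : List (ι → ℕ) → ZMod 2) :
    gridSum N S y (fun l => F (l.map (reflect N R))) = gridSum N S (reflect N R y) F := by
  have hmem : ∀ x ∈ cells N S, (fun i => if i ∈ R ∩ S then N - 1 - x i else x i) ∈ cells N S := by
    intro x hx
    rw [mem_cells] at hx ⊢
    refine ⟨fun i hi => ?_, fun i hi => ?_⟩
    · have := hx.1 i hi
      split_ifs <;> omega
    · simpa [hi] using hx.2 i hi
  refine sum_bij' (fun x _ i => if i ∈ R ∩ S then N - 1 - x i else x i)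
    (fun x _ i => if i ∈ R ∩ S then N - 1 - x i else x i) hmem hmem ?_ ?_ ?_
  · intro x hx
    funext i
    rw [mem_cells] at hx
    by_cases hi : i ∈ R ∩ S
    · have := hx.1 i (mem_inter.1 hi).2
      simp only [hi, if_true]
      omega
    · simp only [hi, if_false]
  · intro x hx
    funext i
    rw [mem_cells] at hx
    by_cases hi : i ∈ R ∩ S
    · have := hx.1 i (mem_inter.1 hi).2
      simp only [hi, if_true]
      omega
    · simp only [hi, if_false]
  · intro x hx
    rw [mem_cells] at hx
    have := pathSum_map (w := cellEnd x)
      (w' := cellEnd fun i => if i ∈ R ∩ S then N - 1 - x i else x i)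
      (ρ := fun i a => if i ∈ R then N - a else a) (n := S.card) (S := S)
      (fun i hi => by
        by_cases hR : i ∈ R
        · simp [cellEnd, hi, hR, evenEnd_reflect hN (hx.1 i hi)]
        · simp [cellEnd, hR]) (cellStart S y x) F
    refine this.trans ?_
    congr 1
    funext i
    by_cases hi : i ∈ S
    · by_cases hR : i ∈ R
      · simp [cellStart, hi, hR, oddEnd_reflect hN (hx.1 i hi)]
      · simp [cellStart, hi, hR]
    · simp [cellStart, hi, reflect]

end Grid

section Tucker

lemma gridSum_congr_base {ι : Type*} [Fintype ι] [DecidableEq ι] {N : ℕ} {S : Finset ι}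
    {y y' : ι → ℕ} (h : ∀ i ∉ S, y i = y' i) (F : List (ι → ℕ) → ZMod 2) :
    gridSum N S y F = gridSum N S y' F := by
  refine sum_congr rfl fun x _ => ?_
  congr 1
  funext i
  by_cases hi : i ∈ S
  · simp [cellStart, hi]
  · simp [cellStart, hi, h i hi]

variable {n : ℕ} {κ : Type*} [LinearOrder κ]

/-- A labelling of the grid of even side `N` in the cube of dimension `n + 1` without complementary
edges, with the symmetries of a map from the product of a circle (the coordinate `0`) and a sphere
(the other ones, which are spherical coordinates) which is odd in both variables. -/
structure IsBioddLabelling (N : ℕ) (ℓ : (Fin (n + 1) → ℕ) → κ × Bool) : Prop where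
  even : Even N
  sign_eq : ∀ v v', (∀ i, v i ≤ N) → (∀ i, v' i ≤ N) → (∀ i, v i ≤ v' i + 1 ∧ v' i ≤ v i + 1) →
    (ℓ v).1 = (ℓ v').1 → (ℓ v).2 = (ℓ v').2
  circle : ∀ v, v 0 = N → (∀ i, v i ≤ N) → ℓ v = negLabel (ℓ (reflect N {0} v))
  sphere : ∀ v j, 0 < j → v j = N → (∀ i, v i ≤ N) → ℓ v = negLabel (ℓ (reflect N (Ioc 0 j) v))
  pole : ∀ v i j a, 0 < i → i < j → v i = 0 ∨ v i = N → ℓ (update v j a) = ℓ v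

/-- The number, mod 2, of simplices with alternating labels in the face of the cube with directions
in `S` through the origin. -/
noncomputable def alternatingCount (N : ℕ) (ℓ : (Fin (n + 1) → ℕ) → κ × Bool)
    (S : Finset (Fin (n + 1))) : ZMod 2 :=
  gridSum N S 0 (fun l => fan true (l.map ℓ)) + gridSum N S 0 (fun l => fan false (l.map ℓ))

variable {N : ℕ} {ℓ : (Fin (n + 1) → ℕ) → κ × Bool}

lemma IsGridPath.mem_le {S : Finset (Fin (n + 1))} {y : Fin (n + 1) → ℕ}
    {l : List (Fin (n + 1) → ℕ)} (h : IsGridPath N S y l) (hy : ∀ i, y i ≤ N)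
    {v : Fin (n + 1) → ℕ} (hv : v ∈ l) (i : Fin (n + 1)) : v i ≤ N := by
  by_cases hi : i ∈ S
  · exact h.apply_le hv hi
  · exact (h.apply_eq hv hi).trans_le (hy i)

lemma alternatingCount_eq_sum (h : IsBioddLabelling N ℓ) {S : Finset (Fin (n + 1))}
    (hS : S.Nonempty) :
    alternatingCount N ℓ S = ∑ i ∈ S,
      (gridSum N (S.erase i) 0 (fun l => fan true (l.map ℓ)) +
        gridSum N (S.erase i) (update 0 i N) (fun l => fan true (l.map ℓ))) := by
  have e := gridSum_coboundary N hS 0 fun l => fan true (l.map ℓ)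
  have h0 : ∀ i : Fin (n + 1), update (0 : Fin (n + 1) → ℕ) i 0 = 0 := fun i =>
    update_eq_self i (0 : Fin (n + 1) → ℕ)
  simp only [h0] at e
  rw [← e, alternatingCount, ← gridSum_add]
  refine gridSum_congr fun l hl => ?_
  rw [coboundary_map ℓ (fan true), coboundary_fan true _ _, Bool.not_true]
  · obtain ⟨x, -, hx⟩ := hl
    obtain ⟨m, rfl⟩ := hx.exists_eq_cons
    simp
  · intro a ha b hb
    obtain ⟨v, hv, rfl⟩ := List.mem_map.1 ha
    obtain ⟨v', hv', rfl⟩ := List.mem_map.1 hb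
    exact h.sign_eq v v' (hl.mem_le (fun _ => Nat.zero_le _) hv)
      (hl.mem_le (fun _ => Nat.zero_le _) hv')
      fun i => ⟨hl.apply_le_succ hv hv' i, hl.apply_le_succ hv' hv i⟩

lemma gridSum_face_eq (hN : Even N) {R S : Finset (Fin (n + 1))} {i : Fin (n + 1)} (hi : i ∈ R)
    (hR : R ⊆ S)
    (h : ∀ v, v i = N → (∀ i, v i ≤ N) → ℓ v = negLabel (ℓ (reflect N R v))) :
    gridSum N (S.erase i) 0 (fun l => fan true (l.map ℓ)) +
      gridSum N (S.erase i) (update 0 i N) (fun l => fan true (l.map ℓ)) =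
    alternatingCount N ℓ (S.erase i) := by
  rw [alternatingCount]
  congr 1
  have e : gridSum N (S.erase i) (update 0 i N) (fun l => fan true (l.map ℓ)) =
      gridSum N (S.erase i) (update 0 i N)
        (fun l => fan false ((l.map (reflect N R)).map ℓ)) := by
    refine gridSum_congr fun l hl => ?_
    have : l.map ℓ = ((l.map (reflect N R)).map ℓ).map negLabel := by
      rw [List.map_map, List.map_map]
      refine List.map_congr_left fun v hv => h v ?_ (hl.mem_le (fun k => ?_) hv)
      · rw [hl.apply_eq hv (notMem_erase i S), update_self]
      · rcases eq_or_ne k i with rfl | hk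
        · simp
        · simp [hk]
    rw [this, fan_map_negLabel]
    rfl
  rw [e, gridSum_reflect hN R _ _ fun l => fan false (l.map ℓ)]
  refine gridSum_congr_base (fun k hk => ?_) _
  rcases eq_or_ne k i with rfl | hki
  · simp [reflect, hi]
  · have : k ∉ R := fun hkR => hk (mem_erase.2 ⟨hki, hR hkR⟩)
    simp [reflect, this, hki]

lemma gridSum_pole_eq_zero (h : IsBioddLabelling N ℓ) (b : Bool) {S : Finset (Fin (n + 1))}
    {i j : Fin (n + 1)} (hi0 : 0 < i) (hij : i < j) (hi : i ∉ S) (hj : j ∈ S)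
    {y : Fin (n + 1) → ℕ} (hy : y i = 0 ∨ y i = N) :
    gridSum N S y (fun l => fan b (l.map ℓ)) = 0 := by
  rw [← gridSum_zero N S y]
  refine gridSum_congr fun l hl => fan_eq_zero_of_not_nodup b fun hnd => ?_
  obtain ⟨x, -, hx⟩ := hl
  refine hx.not_nodup_map hj ℓ (fun v hv => h.pole v i j _ hi0 hij ?_) (List.Nodup.of_map _ hnd)
  rw [hv i hi, cellStart, if_neg hi]
  exact hy

lemma sum_faces_Ioc (h : IsBioddLabelling N ℓ) {S : Finset (Fin (n + 1))} {j : Fin (n + 1)}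
    (hj : 0 < j) (hS : Ioc 0 j ⊆ S) :
    ∑ i ∈ Ioc 0 j, (gridSum N (S.erase i) 0 (fun l => fan true (l.map ℓ)) +
        gridSum N (S.erase i) (update 0 i N) (fun l => fan true (l.map ℓ))) =
      alternatingCount N ℓ (S.erase j) := by
  have hjm : j ∈ Ioc 0 j := mem_Ioc.2 ⟨hj, le_rfl⟩
  rw [sum_eq_single_of_mem j hjm]
  · exact gridSum_face_eq h.even hjm hS fun v => h.sphere v j hj
  · intro i hi hij
    rw [mem_Ioc] at hi
    have hlt : i < j := lt_of_le_of_ne hi.2 hij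
    have hjS : j ∈ S.erase i := mem_erase.2 ⟨hij.symm, hS hjm⟩
    rw [gridSum_pole_eq_zero h true hi.1 hlt (notMem_erase i S) hjS (Or.inl rfl),
      gridSum_pole_eq_zero h true hi.1 hlt (notMem_erase i S) hjS (Or.inr (update_self ..)),
      add_zero]

lemma alternatingCount_empty : alternatingCount N ℓ ∅ = 1 := by
  have h : ∀ b (x : κ × Bool), fan b [x] = if x.2 = b then 1 else 0 := fun b x => by
    rw [fan_of_pairwise b (List.pairwise_singleton _ _), altIndicator]
    simp [Alternates]
  rw [alternatingCount, gridSum_empty, gridSum_empty, List.map_singleton, h, h]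
  cases (ℓ 0).2 <;> simp

lemma alternatingCount_Ioc_Iic (h : IsBioddLabelling N ℓ) (k : ℕ) (hk : k < n + 1) :
    alternatingCount N ℓ (Ioc 0 ⟨k, hk⟩) = 1 ∧
      alternatingCount N ℓ (Iic ⟨k, hk⟩) = (k + 1 : ℕ) := by
  have hzero : ∀ j : Fin (n + 1), (Iic j).erase 0 = Ioc 0 j := fun j => by
    ext i
    simp [Fin.pos_iff_ne_zero]
  have hcircle : ∀ j : Fin (n + 1), gridSum N ((Iic j).erase 0) 0 (fun l => fan true (l.map ℓ)) +
      gridSum N ((Iic j).erase 0) (update 0 0 N) (fun l => fan true (l.map ℓ)) =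
      alternatingCount N ℓ (Ioc 0 j) := fun j => by
    rw [gridSum_face_eq h.even (mem_singleton_self 0) (by simp) h.circle, hzero]
  have hIic : ∀ j : Fin (n + 1), Iic j = insert 0 (Ioc 0 j) := fun j => by
    rw [← hzero, insert_erase (by simp)]
  induction k with
  | zero =>
    have e : Ioc (0 : Fin (n + 1)) ⟨0, hk⟩ = ∅ := Ioc_self _
    have e' : Iic (⟨0, hk⟩ : Fin (n + 1)) = {0} := by rw [hIic, e]; rfl
    refine ⟨by rw [e, alternatingCount_empty], ?_⟩
    have := hcircle ⟨0, hk⟩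
    rw [e, alternatingCount_empty, e'] at this
    rw [e', alternatingCount_eq_sum h (singleton_nonempty 0), sum_singleton, this]
    simp
  | succ k ih =>
    obtain ⟨ih₁, ih₂⟩ := ih (by omega)
    set j : Fin (n + 1) := ⟨k + 1, hk⟩ with hj
    have hj0 : 0 < j := Fin.mk_lt_mk.2 k.succ_pos
    have e₁ : (Ioc 0 j).erase j = Ioc 0 ⟨k, by omega⟩ := by
      ext i
      simp only [mem_erase, mem_Ioc, Fin.lt_def, Fin.le_def, Fin.ext_iff, ne_eq, hj]
      omega
    have e₂ : (Iic j).erase j = Iic ⟨k, by omega⟩ := by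
      ext i
      simp only [mem_erase, mem_Iic, Fin.le_def, Fin.ext_iff, ne_eq, hj]
      omega
    have h₁ : alternatingCount N ℓ (Ioc 0 j) = 1 := by
      rw [alternatingCount_eq_sum h ⟨j, mem_Ioc.2 ⟨hj0, le_rfl⟩⟩, sum_faces_Ioc h hj0 subset_rfl,
        e₁, ih₁]
    refine ⟨h₁, ?_⟩
    have hs := alternatingCount_eq_sum h (S := Iic j) ⟨j, mem_Iic.2 le_rfl⟩
    have hsub : Ioc 0 j ⊆ Iic j := Ioc_subset_Iic_self
    have hadd := sum_insert (s := Ioc 0 j) (a := (0 : Fin (n + 1))) (by simp) (f := fun i =>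
      gridSum N ((Iic j).erase i) 0 (fun l => fan true (l.map ℓ)) +
        gridSum N ((Iic j).erase i) (update 0 i N) (fun l => fan true (l.map ℓ)))
    rw [← hIic, ← hs, sum_faces_Ioc h hj0 hsub, e₂, ih₂] at hadd
    rw [hadd, hcircle, h₁]
    push_cast
    ring

/-- A Tucker lemma for the product of a circle and an even-dimensional sphere. -/
lemma not_isBioddLabelling (hn : Odd (n + 1)) (ℓ : (Fin (n + 1) → ℕ) → Fin (n + 1) × Bool) :
    ¬ IsBioddLabelling N ℓ := by
  intro h
  have hlast := (alternatingCount_Ioc_Iic h n n.lt_succ_self).2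
  have hz : ∀ b, gridSum N (Iic (⟨n, n.lt_succ_self⟩ : Fin (n + 1))) 0
      (fun l => fan b (l.map ℓ)) = 0 := fun b => by
    rw [← gridSum_zero N (Iic (⟨n, n.lt_succ_self⟩ : Fin (n + 1))) 0]
    refine gridSum_congr fun l hl => fan_eq_zero_of_not_nodup b fun hnd => ?_
    obtain ⟨x, -, hx⟩ := hl
    have h1 := hnd.length_le_card
    have h2 := hx.length_eq
    simp only [List.length_map, Fintype.card_fin, Fin.card_Iic] at h1 h2
    omega
  rw [alternatingCount, hz, hz, add_zero, ZMod.natCast_eq_one_iff_odd.2 hn] at hlast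
  exact zero_ne_one hlast

end Tucker

section BorsukUlam

variable {n : ℕ}

/-- The label of a vector: a coordinate of absolute value at least `δ`, and its sign. -/
noncomputable def vectorLabel (δ : ℝ) (y : Fin (n + 1) → ℝ) : Fin (n + 1) × Bool :=
  open Classical in
  let idx : (Fin (n + 1) → ℝ) → Fin (n + 1) := fun z =>
    if h : ∃ i, δ ≤ z i then h.choose else 0
  (idx fun i => |y i|, decide (0 < y (idx fun i => |y i|)))

lemma le_abs_vectorLabel {δ : ℝ} {y : Fin (n + 1) → ℝ} (hy : ∃ i, δ ≤ |y i|) :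
    δ ≤ |y (vectorLabel δ y).1| := by
  simp only [vectorLabel, dif_pos hy]
  exact hy.choose_spec

lemma vectorLabel_snd (δ : ℝ) (y : Fin (n + 1) → ℝ) :
    (vectorLabel δ y).2 = true ↔ 0 < y (vectorLabel δ y).1 := by
  simp [vectorLabel]

lemma vectorLabel_neg {δ : ℝ} (hδ : 0 < δ) {y : Fin (n + 1) → ℝ} (hy : ∃ i, δ ≤ |y i|) :
    vectorLabel δ (-y) = negLabel (vectorLabel δ y) := by
  have h1 : (vectorLabel δ (-y)).1 = (vectorLabel δ y).1 := by
    simp only [vectorLabel, Pi.neg_apply, abs_neg]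
  have hne : y (vectorLabel δ y).1 ≠ 0 :=
    abs_pos.1 (hδ.trans_le (le_abs_vectorLabel hy))
  refine Prod.ext h1 ?_
  rw [Bool.eq_iff_iff, vectorLabel_snd, h1, negLabel]
  simp only [Pi.neg_apply, Bool.not_eq_true', ← Bool.not_eq_true, vectorLabel_snd]
  rw [Left.neg_pos_iff, not_lt, lt_iff_le_and_ne]
  exact and_iff_left hne

lemma vectorLabel_sign_eq {δ : ℝ} {y z : Fin (n + 1) → ℝ} (hy : ∃ i, δ ≤ |y i|)
    (hz : ∃ i, δ ≤ |z i|) (hyz : dist y z < δ) (h : (vectorLabel δ y).1 = (vectorLabel δ z).1) :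
    (vectorLabel δ y).2 = (vectorLabel δ z).2 := by
  have h1 := le_abs_vectorLabel hy
  have h2 := le_abs_vectorLabel hz
  rw [Bool.eq_iff_iff, vectorLabel_snd, vectorLabel_snd, h]
  rw [h] at h1
  have h3 : |y (vectorLabel δ z).1 - z (vectorLabel δ z).1| < δ :=
    (dist_le_pi_dist y z _).trans_lt hyz
  rw [abs_lt] at h3
  constructor
  · intro hp
    rw [abs_of_pos hp] at h1
    linarith
  · intro hp
    rw [abs_of_pos hp] at h2
    linarith

/-- Reflection about `π / 2` of the angles in `R`. -/
noncomputable def reflectAngles (R : Finset (Fin (n + 1))) (x : Fin (n + 1) → ℝ) :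
    Fin (n + 1) → ℝ :=
  fun i => if i ∈ R then Real.pi - x i else x i

/-- A continuous map with the symmetries of a map, odd in both variables, from the product of a
circle and an even-dimensional sphere, read in angular coordinates, has a zero. -/
theorem exists_zero_of_angular_symmetry (hn : Odd (n + 1))
    {Φ : (Fin (n + 1) → ℝ) → Fin (n + 1) → ℝ} (hΦ : Continuous Φ)
    (circle : ∀ x, x 0 = Real.pi → Φ x = -Φ (reflectAngles {0} x))
    (sphere : ∀ x j, 0 < j → x j = Real.pi → Φ x = -Φ (reflectAngles (Ioc 0 j) x))
    (pole : ∀ x i j a, 0 < i → i < j → x i = 0 ∨ x i = Real.pi → Φ (update x j a) = Φ x) :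
    ∃ x, Φ x = 0 := by
  by_contra! hne
  set K : Set (Fin (n + 1) → ℝ) := Set.Icc 0 fun _ => Real.pi with hK
  have hKc : IsCompact K := isCompact_Icc
  have hKne : K.Nonempty := ⟨0, Set.left_mem_Icc.2 fun _ => Real.pi_pos.le⟩
  obtain ⟨x₀, -, hx₀⟩ := hKc.exists_isMinOn hKne hΦ.norm.continuousOn
  set δ := ‖Φ x₀‖ with hδdef
  have hδ : 0 < δ := norm_pos_iff.2 (hne x₀)
  have hlarge : ∀ x ∈ K, ∃ i, δ ≤ |Φ x i| := by
    intro x hx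
    by_contra! h
    exact absurd ((pi_norm_lt_iff hδ).2 h) (not_lt.2 (hx₀ hx))
  have huc := hKc.uniformContinuousOn_of_continuous hΦ.continuousOn
  rw [Metric.uniformContinuousOn_iff] at huc
  obtain ⟨η, hη, huc⟩ := huc δ hδ
  obtain ⟨M, hM⟩ := exists_nat_gt (Real.pi / η)
  have hM0 : 0 < (M : ℝ) := (div_pos Real.pi_pos hη).trans hM
  set N := M + M with hN
  have hN0 : 0 < (N : ℝ) := by rw [hN]; push_cast; linarith
  set c : ℝ := Real.pi / N with hc
  have hc0 : 0 < c := div_pos Real.pi_pos hN0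
  have hcη : c < η := by
    rw [hc, div_lt_iff₀ hN0, hN]
    rw [div_lt_iff₀ hη] at hM
    push_cast
    nlinarith
  have hNc : (N : ℝ) * c = Real.pi := mul_div_cancel₀ _ hN0.ne'
  let pt : (Fin (n + 1) → ℕ) → Fin (n + 1) → ℝ := fun v i => v i * c
  have hpt : ∀ v : Fin (n + 1) → ℕ, (∀ i, v i ≤ N) → pt v ∈ K := by
    intro v hv
    refine ⟨fun i => by positivity, fun i => ?_⟩
    change (v i : ℝ) * c ≤ Real.pi
    rw [← hNc]
    exact mul_le_mul_of_nonneg_right (Nat.cast_le.2 (hv i)) hc0.le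
  have hrefl : ∀ (R : Finset (Fin (n + 1))) (v : Fin (n + 1) → ℕ), (∀ i, v i ≤ N) →
      reflectAngles R (pt v) = pt (reflect N R v) := by
    intro R v hv
    funext i
    by_cases hi : i ∈ R
    · simp only [reflectAngles, reflect, pt, hi, if_true]
      rw [Nat.cast_sub (hv i), ← hNc]
      ring
    · simp only [reflectAngles, reflect, pt, hi, if_false]
  have hreflle : ∀ (R : Finset (Fin (n + 1))) (v : Fin (n + 1) → ℕ), (∀ i, v i ≤ N) →
      ∀ i, reflect N R v i ≤ N := by
    intro R v hv i
    unfold reflect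
    split_ifs
    · exact Nat.sub_le _ _
    · exact hv i
  refine not_isBioddLabelling (N := N) hn (fun v => vectorLabel δ (Φ (pt v)))
    ⟨⟨M, hN⟩, ?_, ?_, ?_, ?_⟩
  · intro v v' hv hv' hvv'
    refine vectorLabel_sign_eq (hlarge _ (hpt v hv)) (hlarge _ (hpt v' hv'))
      (huc _ (hpt v hv) _ (hpt v' hv') ?_)
    rw [dist_pi_lt_iff hη]
    intro i
    refine lt_of_le_of_lt ?_ hcη
    have h1 : (v i : ℝ) ≤ v' i + 1 := by exact_mod_cast (hvv' i).1
    have h2 : (v' i : ℝ) ≤ v i + 1 := by exact_mod_cast (hvv' i).2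
    change |(v i : ℝ) * c - v' i * c| ≤ c
    rw [abs_le]
    constructor <;> nlinarith
  · intro v hv0 hv
    rw [← vectorLabel_neg hδ (hlarge _ (hpt _ (hreflle _ v hv))), ← hrefl _ v hv,
      ← circle _ (by simp only [pt, hv0, hNc])]
  · intro v j hj hvj hv
    rw [← vectorLabel_neg hδ (hlarge _ (hpt _ (hreflle _ v hv))), ← hrefl _ v hv,
      ← sphere _ j hj (by simp only [pt, hvj, hNc])]
  · intro v i j a hi hij hvi
    have : pt (update v j a) = update (pt v) j (a * c) := by
      funext k
      rcases eq_or_ne k j with rfl | hk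
      · simp [pt]
      · simp [pt, hk]
    rw [this, pole (pt v) i j _ hi hij]
    rcases hvi with h | h
    · exact Or.inl (by simp [pt, h])
    · exact Or.inr (by simp only [pt, h, hNc])

/-- The angle of index `m`, zero if there is no such angle. -/
def angle (x : Fin (n + 1) → ℝ) (m : ℕ) : ℝ := if h : m < n + 1 then x ⟨m, h⟩ else 0

/-- The coordinates of a point of the sphere with spherical coordinates `x 1, x 2, …`. -/
noncomputable def sphericalCoord (x : Fin (n + 1) → ℝ) (k : ℕ) : ℝ :=
  (∏ i ∈ range k, Real.sin (angle x (i + 1))) * Real.cos (angle x (k + 1))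

/-- The point of the sphere with spherical coordinates `x 1, x 2, …`. -/
noncomputable def sphericalPoint (x : Fin (n + 1) → ℝ) : EuclideanSpace ℝ (Fin (n + 1)) :=
  WithLp.toLp 2 fun k => sphericalCoord x k

lemma norm_sphericalPoint (x : Fin (n + 1) → ℝ) : ‖sphericalPoint x‖ = 1 := by
  have key : ∀ m, ∑ k ∈ range m, sphericalCoord x k ^ 2 =
      1 - ∏ i ∈ range m, Real.sin (angle x (i + 1)) ^ 2 := by
    intro m
    induction m with
    | zero => simp
    | succ m ih =>
      rw [sum_range_succ, ih, prod_range_succ, sphericalCoord, mul_pow, Real.cos_sq',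
        ← prod_pow]
      ring
  rw [EuclideanSpace.norm_eq, Real.sqrt_eq_one]
  simp only [Real.norm_eq_abs, sq_abs, sphericalPoint]
  rw [Fin.sum_univ_eq_sum_range (fun k => sphericalCoord x k ^ 2), key, prod_range_succ]
  simp [angle]

lemma continuous_sphericalPoint : Continuous (sphericalPoint (n := n)) := by
  have hangle : ∀ m, Continuous fun x : Fin (n + 1) → ℝ => angle x m := by
    intro m
    unfold angle
    split_ifs
    · exact continuous_apply _
    · exact continuous_const
  refine (PiLp.continuous_toLp 2 _).comp (continuous_pi fun k => ?_)
  unfold sphericalCoord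
  exact (continuous_finsetProd _ fun i _ => Real.continuous_sin.comp (hangle _)).mul
    (Real.continuous_cos.comp (hangle _))

lemma sphericalCoord_congr {x y : Fin (n + 1) → ℝ} {k : ℕ}
    (h : ∀ m, 0 < m → m ≤ k + 1 → angle x m = angle y m) :
    sphericalCoord x k = sphericalCoord y k := by
  unfold sphericalCoord
  rw [h (k + 1) k.succ_pos le_rfl]
  congr 1
  refine prod_congr rfl fun i hi => ?_
  rw [h (i + 1) i.succ_pos (by have := mem_range.1 hi; omega)]

lemma sphericalCoord_eq_zero {x : Fin (n + 1) → ℝ} {k : ℕ} {j : Fin (n + 1)} (hj : 0 < j)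
    (hjk : (j : ℕ) ≤ k) (hx : Real.sin (x j) = 0) : sphericalCoord x k = 0 := by
  have hj' : 0 < (j : ℕ) := hj
  rw [sphericalCoord, prod_eq_zero (i := (j : ℕ) - 1), zero_mul]
  · rw [mem_range]
    omega
  · rw [Nat.sub_add_cancel hj', angle, dif_pos j.2]
    exact hx

lemma sphericalPoint_reflectAngles_zero (x : Fin (n + 1) → ℝ) :
    sphericalPoint (reflectAngles {0} x) = sphericalPoint x := by
  ext k
  refine sphericalCoord_congr fun m hm _ => ?_
  unfold angle
  split_ifs with h
  · have : (⟨m, h⟩ : Fin (n + 1)) ≠ 0 := fun h0 => hm.ne' (congrArg Fin.val h0)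
    simp [reflectAngles, this]
  · rfl

lemma sphericalPoint_reflectAngles_Ioc {x : Fin (n + 1) → ℝ} {j : Fin (n + 1)} (hj : 0 < j)
    (hx : x j = Real.pi) : sphericalPoint (reflectAngles (Ioc 0 j) x) = -sphericalPoint x := by
  ext k
  change sphericalCoord _ k = -sphericalCoord x k
  rcases le_or_gt (j : ℕ) k with hjk | hkj
  · rw [sphericalCoord_eq_zero hj hjk, sphericalCoord_eq_zero hj hjk, neg_zero]
    · simp [hx]
    · simp [reflectAngles, hj, hx]
  · have hangle : ∀ m, 0 < m → m ≤ (j : ℕ) →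
        angle (reflectAngles (Ioc 0 j) x) m = Real.pi - angle x m := by
      intro m hm hmj
      have hmn : m < n + 1 := lt_of_le_of_lt hmj j.2
      have : (⟨m, hmn⟩ : Fin (n + 1)) ∈ Ioc 0 j := mem_Ioc.2 ⟨hm, hmj⟩
      simp only [angle, dif_pos hmn, reflectAngles, if_pos this]
    unfold sphericalCoord
    rw [hangle _ (Nat.succ_pos _) hkj, Real.cos_pi_sub, mul_neg]
    congr 2
    refine prod_congr rfl fun i hi => ?_
    rw [hangle _ (Nat.succ_pos _) (by have := mem_range.1 hi; omega), Real.sin_pi_sub]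

lemma sphericalPoint_update {x : Fin (n + 1) → ℝ} {i j : Fin (n + 1)} (hi : 0 < i) (hij : i < j)
    (hx : Real.sin (x i) = 0) (a : ℝ) : sphericalPoint (update x j a) = sphericalPoint x := by
  ext k
  change sphericalCoord _ k = sphericalCoord x k
  rcases le_or_gt (i : ℕ) k with hik | hki
  · rw [sphericalCoord_eq_zero hi hik, sphericalCoord_eq_zero hi hik hx]
    rwa [update_of_ne hij.ne]
  · refine sphericalCoord_congr fun m _ hm => ?_
    unfold angle
    split_ifs with h
    · rw [update_of_ne]
      intro h0
      have := congrArg Fin.val h0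
      have : (i : ℕ) < j := hij
      simp only at *
      omega
    · rfl

/-- A Borsuk-Ulam theorem for the product of a circle and an even-dimensional sphere: a continuous
map to `ℝ^d`, `d` odd, which is odd in both variables has a zero. -/
theorem exists_zero_of_biodd (hn : Odd (n + 1))
    {G : ℝ × ℝ → EuclideanSpace ℝ (Fin (n + 1)) → Fin (n + 1) → ℝ}
    (hG : ContinuousOn (uncurry G) {q | q.1.1 ^ 2 + q.1.2 ^ 2 = 1 ∧ ‖q.2‖ = 1})
    (hcircle : ∀ z v, G (-z) v = -G z v) (hsphere : ∀ z v, G z (-v) = -G z v) :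
    ∃ z v, z.1 ^ 2 + z.2 ^ 2 = 1 ∧ ‖v‖ = 1 ∧ G z v = 0 := by
  suffices h : ∃ x : Fin (n + 1) → ℝ,
      G (Real.cos (x 0), Real.sin (x 0)) (sphericalPoint x) = 0 by
    obtain ⟨x, hx⟩ := h
    exact ⟨_, _, Real.cos_sq_add_sin_sq (x 0), norm_sphericalPoint x, hx⟩
  refine exists_zero_of_angular_symmetry hn
    (Φ := fun x => G (Real.cos (x 0), Real.sin (x 0)) (sphericalPoint x)) ?_ ?_ ?_ ?_
  · refine hG.comp_continuous (f := fun x : Fin (n + 1) → ℝ =>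
      (((Real.cos (x 0), Real.sin (x 0)), sphericalPoint x) :
        (ℝ × ℝ) × EuclideanSpace ℝ (Fin (n + 1)))) ?_ ?_
    · have := continuous_sphericalPoint (n := n)
      fun_prop
    · exact fun x => ⟨Real.cos_sq_add_sin_sq (x 0), norm_sphericalPoint x⟩
  · intro x hx
    simp only [sphericalPoint_reflectAngles_zero, ← hcircle]
    simp [reflectAngles, hx]
  · intro x j hj hx
    simp only [sphericalPoint_reflectAngles_Ioc hj hx, hsphere]
    simp [reflectAngles]
  · intro x i j a hi hij hx
    have hs : Real.sin (x i) = 0 := by rcases hx with h | h <;> simp [h]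
    simp only [sphericalPoint_update hi hij hs, update_of_ne (hi.trans hij).ne]

end BorsukUlam

section Imbalance

open Filter Topology

lemma measurable_realSign : Measurable Real.sign :=
  Measurable.ite measurableSet_Iio measurable_const
    (Measurable.ite measurableSet_Ioi measurable_const measurable_const)

lemma continuousAt_realSign {x : ℝ} (hx : x ≠ 0) : ContinuousAt Real.sign x := by
  rcases lt_or_gt_of_ne hx with h | h
  · refine (continuousAt_const (y := (-1 : ℝ))).congr ?_
    filter_upwards [eventually_lt_nhds h] with y hy using (Real.sign_of_neg hy).symm
  · refine (continuousAt_const (y := (1 : ℝ))).congr ?_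
    filter_upwards [eventually_gt_nhds h] with y hy using (Real.sign_of_pos hy).symm

lemma monotone_realSign : Monotone Real.sign := by
  intro x y hxy
  rcases lt_trichotomy x 0 with hx | hx | hx <;> rcases lt_trichotomy y 0 with hy | hy | hy <;>
    simp [Real.sign_of_neg, Real.sign_of_pos, hx, hy] <;> linarith

lemma abs_realSign_le (x : ℝ) : |Real.sign x| ≤ 1 := by
  rcases Real.sign_apply_eq x with h | h | h <;> simp [h]

variable {Ω : Type*} [MeasurableSpace Ω]

/-- The mass of `{f ≥ c}` minus the mass of `{f ≤ c}`. -/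
noncomputable def imbalance (μ : Measure Ω) (f : Ω → ℝ) (c : ℝ) : ℝ :=
  ∫ x, Real.sign (f x - c) ∂μ

section

variable (μ : Measure Ω) [IsFiniteMeasure μ] {f g : Ω → ℝ}

lemma integrable_realSign (hf : Measurable f) : Integrable (fun x => Real.sign (f x)) μ :=
  .of_bound (measurable_realSign.comp hf).aestronglyMeasurable 1
    (.of_forall fun x => abs_realSign_le (f x))

lemma imbalance_eq (hf : Measurable f) (c : ℝ) :
    imbalance μ f c = μ.real {x | f x ≥ c} - μ.real {x | f x ≤ c} := by
  have h1 : MeasurableSet {x | f x ≥ c} := measurableSet_le measurable_const hf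
  have h2 : MeasurableSet {x | f x ≤ c} := measurableSet_le hf measurable_const
  rw [← integral_indicator_one h1, ← integral_indicator_one h2, ← integral_sub
    ((integrable_indicator_iff h1).2 (integrable_const 1).integrableOn)
    ((integrable_indicator_iff h2).2 (integrable_const 1).integrableOn)]
  refine integral_congr_ae (.of_forall fun x => ?_)
  rcases lt_trichotomy (f x) c with h | h | h
  · simp [Real.sign_of_neg (sub_neg.2 h), Set.indicator, h.le, h.not_ge]
  · simp [Set.indicator, h]
  · simp [Real.sign_of_pos (sub_pos.2 h), Set.indicator, h.le, h.not_ge]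

lemma measure_ge_eq_measure_le (hf : Measurable f) {c : ℝ} (h : imbalance μ f c = 0) :
    μ {x | f x ≥ c} = μ {x | f x ≤ c} := by
  rw [imbalance_eq μ hf, sub_eq_zero] at h
  exact (measureReal_eq_measureReal_iff).1 h

lemma imbalance_mono (hf : Measurable f) (hg : Measurable g) {c c' : ℝ}
    (h : ∀ x, f x - c ≤ g x - c') : imbalance μ f c ≤ imbalance μ g c' :=
  integral_mono (integrable_realSign μ (hf.sub_const c)) (integrable_realSign μ (hg.sub_const c'))
    fun x => monotone_realSign (h x)

lemma antitone_imbalance (hf : Measurable f) : Antitone (imbalance μ f) :=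
  fun _ _ h => imbalance_mono μ hf hf fun _ => sub_le_sub_left h _

lemma abs_imbalance_le (c : ℝ) : |imbalance μ f c| ≤ μ.real Set.univ := by
  simpa [imbalance] using norm_integral_le_of_norm_le_const (μ := μ)
    (f := fun x => Real.sign (f x - c)) (C := 1) (.of_forall fun x => abs_realSign_le (f x - c))

lemma tendsto_imbalance_atTop (hf : Measurable f) :
    Tendsto (imbalance μ f) atTop (𝓝 (-μ.real Set.univ)) := by
  have : -μ.real Set.univ = ∫ _, (-1 : ℝ) ∂μ := by simp
  rw [this]
  refine tendsto_integral_filter_of_dominated_convergence (fun _ => 1)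
    (.of_forall fun c => (measurable_realSign.comp (hf.sub_const c)).aestronglyMeasurable)
    (.of_forall fun c => .of_forall fun x => abs_realSign_le (f x - c)) (integrable_const 1)
    (.of_forall fun x => ?_)
  refine tendsto_const_nhds.congr' ?_
  filter_upwards [eventually_gt_atTop (f x)] with c hc
  rw [Real.sign_of_neg (sub_neg.2 hc)]

end

lemma imbalance_neg (μ : Measure Ω) (f : Ω → ℝ) (c : ℝ) :
    imbalance μ (-f) (-c) = -imbalance μ f c := by
  unfold imbalance
  rw [← integral_neg]
  refine integral_congr_ae (.of_forall fun x => ?_)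
  simp only [Pi.neg_apply, ← Real.sign_neg]
  congr 1
  ring

end Imbalance

section Balance

open Filter Topology

variable {U : Type*} [TopologicalSpace U]

/-- The level at which an antitone function, tilted by `ε`, vanishes; `0` if there is none. -/
noncomputable def tiltedZero (F : ℝ → ℝ) (ε : ℝ) : ℝ :=
  open Classical in if h : ∃ c, F c = ε * c then h.choose else 0

lemma tiltedZero_spec {F : ℝ → ℝ} {ε : ℝ} (h : ∃ c, F c = ε * c) :
    F (tiltedZero F ε) = ε * tiltedZero F ε := by
  unfold tiltedZero
  rw [dif_pos h]
  exact h.choose_spec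

lemma eq_of_tilted {F : ℝ → ℝ} (hF : Antitone F) {ε : ℝ} (hε : 0 < ε) {c c' : ℝ}
    (h : F c = ε * c) (h' : F c' = ε * c') : c = c' := by
  rcases lt_trichotomy c c' with hlt | heq | hlt
  · have := hF hlt.le
    nlinarith
  · exact heq
  · have := hF hlt.le
    nlinarith

lemma tiltedZero_neg {F G : ℝ → ℝ} (hF : Antitone F) {ε : ℝ} (hε : 0 < ε)
    (hFG : ∀ c, G (-c) = -F c) : tiltedZero G ε = -tiltedZero F ε := by
  have hG : Antitone G := fun a b hab => by
    have h1 := hFG (-a)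
    have h2 := hFG (-b)
    have h3 := hF (neg_le_neg hab)
    rw [neg_neg] at h1 h2
    linarith
  by_cases h : ∃ c, F c = ε * c
  · have h0 : G (-tiltedZero F ε) = ε * (-tiltedZero F ε) := by
      rw [hFG, tiltedZero_spec h, mul_neg]
    exact eq_of_tilted hG hε (tiltedZero_spec ⟨_, h0⟩) h0
  · have h' : ¬∃ c, G c = ε * c := by
      rintro ⟨c, hc⟩
      refine h ⟨-c, ?_⟩
      have := hFG (-c)
      rw [neg_neg] at this
      linarith
    simp [tiltedZero, h, h']

lemma exists_tilted {F : ℝ → ℝ} (hF : Continuous F) {M : ℝ} (hM : ∀ c, |F c| ≤ M) {ε : ℝ}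
    (hε : 0 < ε) : ∃ c, F c = ε * c := by
  have hM0 : 0 ≤ M := (abs_nonneg _).trans (hM 0)
  have hle : -(M / ε) ≤ M / ε := neg_le_self (by positivity)
  have hcont : ContinuousOn (fun c => F c - ε * c) (Set.Icc (-(M / ε)) (M / ε)) := by fun_prop
  obtain ⟨c, -, hc⟩ := intermediate_value_Icc' hle hcont (show (0 : ℝ) ∈ Set.Icc _ _ from by
    have h1 := abs_le.1 (hM (M / ε))
    have h2 := abs_le.1 (hM (-(M / ε)))
    have h3 : ε * (M / ε) = M := by field_simp
    rw [Set.mem_Icc, mul_neg]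
    constructor <;> linarith)
  exact ⟨c, sub_eq_zero.1 hc⟩

lemma continuousOn_tiltedZero {F : U → ℝ → ℝ} {S : Set U} (hanti : ∀ u, Antitone (F u))
    (hF : ∀ c, ContinuousOn (fun u => F u c) S) {ε : ℝ} (hε : 0 < ε)
    (hex : ∀ u ∈ S, ∃ c, F u c = ε * c) : ContinuousOn (fun u => tiltedZero (F u) ε) S := by
  intro u hu
  have h0 := tiltedZero_spec (hex u hu)
  refine tendsto_order.2 ⟨fun a ha => ?_, fun a ha => ?_⟩
  · have hlt : ε * a < F u a := by
      have := hanti u ha.le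
      nlinarith
    filter_upwards [(hF a u hu).eventually (eventually_gt_nhds hlt), self_mem_nhdsWithin]
      with u' h1 h2
    have h3 := tiltedZero_spec (hex u' h2)
    by_contra! hle
    have := hanti u' hle
    nlinarith
  · have hlt : F u a < ε * a := by
      have := hanti u ha.le
      nlinarith
    filter_upwards [(hF a u hu).eventually (eventually_lt_nhds hlt), self_mem_nhdsWithin]
      with u' h1 h2
    have h3 := tiltedZero_spec (hex u' h2)
    by_contra! hle
    have := hanti u' hle
    nlinarith

end Balance

section Functional

open Filter Topology

variable {d : ℕ}

/-- The linear functional on phase space measuring position and velocity in direction `v` with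
weights given by `z`. -/
noncomputable def phase (z : ℝ × ℝ) (v : EuclideanSpace ℝ (Fin d))
    (pw : EuclideanSpace ℝ (Fin d) × EuclideanSpace ℝ (Fin d)) : ℝ :=
  z.1 * ⟪pw.1, v⟫ + z.2 * ⟪pw.2, v⟫

lemma measurable_phase (z : ℝ × ℝ) (v : EuclideanSpace ℝ (Fin d)) : Measurable (phase z v) := by
  have : Continuous (phase z v) := by unfold phase; fun_prop
  exact this.measurable

lemma phase_neg_left (z : ℝ × ℝ) (v : EuclideanSpace ℝ (Fin d)) : phase (-z) v = -phase z v := by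
  ext pw
  simp only [phase, Prod.fst_neg, Prod.snd_neg, Pi.neg_apply]
  ring

lemma phase_neg_right (z : ℝ × ℝ) (v : EuclideanSpace ℝ (Fin d)) :
    phase z (-v) = -phase z v := by
  ext pw
  simp only [phase, inner_neg_right, Pi.neg_apply]
  ring

lemma phase_le {z : ℝ × ℝ} {v : EuclideanSpace ℝ (Fin d)} (hz : z.1 ^ 2 + z.2 ^ 2 = 1)
    (hv : ‖v‖ = 1) (pw : EuclideanSpace ℝ (Fin d) × EuclideanSpace ℝ (Fin d)) :
    phase z v pw ≤ ‖pw.1‖ + ‖pw.2‖ := by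
  have h1 := abs_real_inner_le_norm pw.1 v
  have h2 := abs_real_inner_le_norm pw.2 v
  rw [hv, mul_one] at h1 h2
  have hz1 : |z.1| ≤ 1 := abs_le_one_iff_mul_self_le_one.2 (by nlinarith)
  have hz2 : |z.2| ≤ 1 := abs_le_one_iff_mul_self_le_one.2 (by nlinarith)
  have key : ∀ a b B : ℝ, |a| ≤ 1 → |b| ≤ B → a * b ≤ B := fun a b B ha hb =>
    (le_abs_self _).trans <| by
      rw [abs_mul]
      exact (mul_le_of_le_one_left (abs_nonneg b) ha).trans hb
  exact add_le_add (key _ _ _ hz1 h1) (key _ _ _ hz2 h2)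

lemma volume_phase_eq {z : ℝ × ℝ} {v : EuclideanSpace ℝ (Fin d)} (hz : z.1 ^ 2 + z.2 ^ 2 = 1)
    (hv : ‖v‖ = 1) (c : ℝ) : volume {pw | phase z v pw = c} = 0 := by
  let L : EuclideanSpace ℝ (Fin d) × EuclideanSpace ℝ (Fin d) →ₗ[ℝ] ℝ :=
    { toFun := phase z v
      map_add' := fun x y => by simp only [phase, Prod.fst_add, Prod.snd_add, inner_add_left]; ring
      map_smul' := fun a x => by
        simp only [phase, Prod.smul_fst, Prod.smul_snd, real_inner_smul_left, smul_eq_mul,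
          RingHom.id_apply]
        ring }
  have hL : ∀ pw, L pw = phase z v pw := fun _ => rfl
  have hone : phase z v (z.1 • v, z.2 • v) = 1 := by
    simp only [phase, real_inner_smul_left, real_inner_self_eq_norm_sq, hv]
    nlinarith
  have : Measure.IsAddHaarMeasure (volume : Measure (EuclideanSpace ℝ (Fin d) ×
    EuclideanSpace ℝ (Fin d))) := Measure.prod.instIsAddHaarMeasure _ _
  have key := Measure.addHaar_affineSubspace
    (volume : Measure (EuclideanSpace ℝ (Fin d) × EuclideanSpace ℝ (Fin d)))
    (AffineSubspace.mk' (c • (z.1 • v, z.2 • v)) (LinearMap.ker L)) ?_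
  · convert key using 2
    ext pw
    simp only [SetLike.mem_coe, AffineSubspace.mem_mk', vsub_eq_sub, LinearMap.mem_ker,
      Set.mem_ofPred_eq]
    rw [map_sub, map_smul, hL, hL, hone, smul_eq_mul, mul_one, sub_eq_zero]
  · intro h
    have hd := congrArg AffineSubspace.direction h
    rw [AffineSubspace.direction_mk', AffineSubspace.direction_top] at hd
    have : ((z.1 • v, z.2 • v) : EuclideanSpace ℝ (Fin d) × EuclideanSpace ℝ (Fin d)) ∈
      LinearMap.ker L := hd ▸ Submodule.mem_top
    rw [LinearMap.mem_ker, hL, hone] at this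
    exact one_ne_zero this

/-- The pairs of unit vectors. -/
def sphereProd (d : ℕ) : Set ((ℝ × ℝ) × EuclideanSpace ℝ (Fin d)) :=
  {q | q.1.1 ^ 2 + q.1.2 ^ 2 = 1 ∧ ‖q.2‖ = 1}

lemma isCompact_sphereProd : IsCompact (sphereProd d) := by
  have hclosed : IsClosed (sphereProd d) := by
    refine IsClosed.and (isClosed_eq ?_ ?_) (isClosed_eq ?_ ?_) <;> fun_prop
  refine Metric.isCompact_of_isClosed_isBounded hclosed
    ((Metric.isBounded_iff_subset_closedBall 0).2 ⟨1, fun q hq => ?_⟩)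
  rw [mem_closedBall_zero_iff, Prod.norm_def, Prod.norm_def, max_le_iff, max_le_iff,
    Real.norm_eq_abs, Real.norm_eq_abs]
  have := hq.1
  exact ⟨⟨abs_le_one_iff_mul_self_le_one.2 (by nlinarith),
    abs_le_one_iff_mul_self_le_one.2 (by nlinarith)⟩, hq.2.le⟩

variable (μ : Measure (EuclideanSpace ℝ (Fin d) × EuclideanSpace ℝ (Fin d))) [IsFiniteMeasure μ]

lemma continuousAt_imbalance_phase (hμ : μ ≪ volume) {z : ℝ × ℝ} {v : EuclideanSpace ℝ (Fin d)}
    (hz : z.1 ^ 2 + z.2 ^ 2 = 1) (hv : ‖v‖ = 1) (c : ℝ) :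
    ContinuousAt (fun q : ((ℝ × ℝ) × EuclideanSpace ℝ (Fin d)) × ℝ =>
      imbalance μ (phase q.1.1 q.1.2) q.2) ((z, v), c) := by
  refine continuousAt_of_dominated (bound := fun _ => 1)
    (.of_forall fun q => (measurable_realSign.comp
      ((measurable_phase _ _).sub_const _)).aestronglyMeasurable)
    (.of_forall fun q => .of_forall fun x => abs_realSign_le _) (integrable_const 1) ?_
  have hae : ∀ᵐ pw ∂μ, phase z v pw ≠ c := by
    rw [ae_iff]
    simpa using hμ (volume_phase_eq hz hv c)
  filter_upwards [hae] with pw hpw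
  refine ContinuousAt.comp (g := Real.sign)
    (f := fun q : ((ℝ × ℝ) × EuclideanSpace ℝ (Fin d)) × ℝ => phase q.1.1 q.1.2 pw - q.2)
    (continuousAt_realSign (sub_ne_zero.2 hpw)) (Continuous.continuousAt ?_)
  unfold phase
  fun_prop

lemma exists_imbalance_phase_neg (hμ : μ ≠ 0) :
    ∃ R, 0 ≤ R ∧ ∀ z v, z.1 ^ 2 + z.2 ^ 2 = 1 → ‖v‖ = 1 → imbalance μ (phase z v) R < 0 := by
  have hf : Measurable fun pw : EuclideanSpace ℝ (Fin d) × EuclideanSpace ℝ (Fin d) =>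
    ‖pw.1‖ + ‖pw.2‖ := by fun_prop
  have hpos : -μ.real Set.univ < 0 := by
    have : NeZero μ := ⟨hμ⟩
    exact neg_neg_of_pos measureReal_univ_pos
  obtain ⟨R, hR, hR0⟩ := (((tendsto_imbalance_atTop μ hf).eventually
    (eventually_lt_nhds hpos)).and (eventually_ge_atTop 0)).exists
  exact ⟨R, hR0, fun z v hz hv => (imbalance_mono μ (measurable_phase z v) hf
    fun x => sub_le_sub_right (phase_le hz hv x) R).trans_lt hR⟩

end Functional

section Simultaneous

open Filter Topology

variable {n : ℕ}
    (μ : Fin (n + 1 + 1) →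
      Measure (EuclideanSpace ℝ (Fin (n + 1)) × EuclideanSpace ℝ (Fin (n + 1))))
    [∀ i, IsFiniteMeasure (μ i)]

lemma exists_tilted_balance (hn : Odd (n + 1)) (hac : ∀ i, μ i ≪ volume) (i₀ : Fin (n + 1 + 1))
    {ε : ℝ} (hε : 0 < ε) :
    ∃ (z : ℝ × ℝ) (v : EuclideanSpace ℝ (Fin (n + 1))) (c : ℝ), z.1 ^ 2 + z.2 ^ 2 = 1 ∧
      ‖v‖ = 1 ∧ imbalance (μ i₀) (phase z v) c = ε * c ∧
      ∀ j, imbalance (μ (i₀.succAbove j)) (phase z v) c = 0 := by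
  have hanti : ∀ z v, Antitone (imbalance (μ i₀) (phase z v)) := fun z v =>
    antitone_imbalance _ (measurable_phase z v)
  have hex : ∀ z v, z.1 ^ 2 + z.2 ^ 2 = 1 → ‖v‖ = 1 →
      ∃ c, imbalance (μ i₀) (phase z v) c = ε * c := fun z v hz hv =>
    exists_tilted (continuous_iff_continuousAt.2 fun c =>
      (continuousAt_imbalance_phase (μ i₀) (hac i₀) hz hv c).comp
        (f := fun c : ℝ => ((z, v), c)) (by fun_prop)) (fun c => abs_imbalance_le _ c) hε
  set C : ℝ × ℝ → EuclideanSpace ℝ (Fin (n + 1)) → ℝ := fun z v =>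
    tiltedZero (imbalance (μ i₀) (phase z v)) ε with hC
  have hCcont : ContinuousOn (uncurry C) (sphereProd (n + 1)) := by
    have hfix : ∀ c, ContinuousOn (fun q : (ℝ × ℝ) × EuclideanSpace ℝ (Fin (n + 1)) =>
        imbalance (μ i₀) (phase q.1 q.2) c) (sphereProd (n + 1)) := by
      rintro c ⟨z, v⟩ hq
      have hc := (continuousAt_imbalance_phase (μ i₀) (hac i₀) hq.1 hq.2 c)
      exact (ContinuousAt.comp (f := fun q : (ℝ × ℝ) × EuclideanSpace ℝ (Fin (n + 1)) => (q, c))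
        (x := (z, v)) hc (by fun_prop)).continuousWithinAt
    have hexq : ∀ q ∈ sphereProd (n + 1), ∃ c, imbalance (μ i₀) (phase q.1 q.2) c = ε * c := by
      rintro ⟨z, v⟩ hq
      exact hex z v hq.1 hq.2
    have key := continuousOn_tiltedZero
      (F := fun (q : (ℝ × ℝ) × EuclideanSpace ℝ (Fin (n + 1))) c =>
        imbalance (μ i₀) (phase q.1 q.2) c)
      (fun q => hanti q.1 q.2) hfix hε hexq
    exact key
  have hCz : ∀ z v, C (-z) v = -C z v := fun z v =>
    tiltedZero_neg (hanti z v) hε fun c => by rw [phase_neg_left, imbalance_neg]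
  have hCv : ∀ z v, C z (-v) = -C z v := fun z v =>
    tiltedZero_neg (hanti z v) hε fun c => by rw [phase_neg_right, imbalance_neg]
  set G : ℝ × ℝ → EuclideanSpace ℝ (Fin (n + 1)) → Fin (n + 1) → ℝ := fun z v j =>
    imbalance (μ (i₀.succAbove j)) (phase z v) (C z v) with hG
  have hGcont : ContinuousOn (uncurry G) (sphereProd (n + 1)) := by
    refine continuousOn_pi.2 fun j => ?_
    rintro ⟨z, v⟩ hq
    have hc := continuousAt_imbalance_phase (μ (i₀.succAbove j)) (hac _) hq.1 hq.2 (C z v)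
    exact ContinuousAt.comp_continuousWithinAt
      (f := fun q : (ℝ × ℝ) × EuclideanSpace ℝ (Fin (n + 1)) => (q, uncurry C q))
      (x := (z, v)) hc (continuousWithinAt_id.prodMk (hCcont _ hq))
  have hGz : ∀ z v, G (-z) v = -G z v := by
    intro z v
    ext j
    simp only [hG, hCz, phase_neg_left, imbalance_neg, Pi.neg_apply]
  have hGv : ∀ z v, G z (-v) = -G z v := by
    intro z v
    ext j
    simp only [hG, hCv, phase_neg_right, imbalance_neg, Pi.neg_apply]
  obtain ⟨z, v, hz, hv, h⟩ := exists_zero_of_biodd hn hGcont hGz hGv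
  exact ⟨z, v, C z v, hz, hv, tiltedZero_spec (hex z v hz hv), fun j => congrFun h j⟩

/-- There is a hyperplane in phase space, with normal a tensor of unit vectors, bisecting all the
measures. -/
theorem exists_balance (hn : Odd (n + 1)) (hac : ∀ i, μ i ≪ volume) :
    ∃ (z : ℝ × ℝ) (v : EuclideanSpace ℝ (Fin (n + 1))) (c : ℝ), z.1 ^ 2 + z.2 ^ 2 = 1 ∧
      ‖v‖ = 1 ∧ ∀ i, imbalance (μ i) (phase z v) c = 0 := by
  by_cases hzero : ∀ i, μ i = 0
  · obtain ⟨z, v, c, hz, hv, -⟩ := exists_tilted_balance μ hn hac 0 one_pos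
    exact ⟨z, v, c, hz, hv, fun i => by simp [hzero i, imbalance]⟩
  push Not at hzero
  obtain ⟨i₀, hi₀⟩ := hzero
  obtain ⟨R, hR0, hR⟩ := exists_imbalance_phase_neg (μ i₀) hi₀
  have upper : ∀ ε > 0, ∀ z v c, z.1 ^ 2 + z.2 ^ 2 = 1 → ‖v‖ = 1 →
      imbalance (μ i₀) (phase z v) c = ε * c → c ≤ R := by
    intro ε hε z v c hz hv h
    by_contra! hc
    have h1 := antitone_imbalance (μ i₀) (measurable_phase z v) hc.le
    have h2 := hR z v hz hv
    have : 0 < ε * c := mul_pos hε (hR0.trans_lt hc)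
    linarith
  have hε : ∀ k : ℕ, (0 : ℝ) < 1 / (k + 1) := fun k => Nat.one_div_pos_of_nat
  choose z v c hz hv hi h using fun k : ℕ => exists_tilted_balance μ hn hac i₀ (hε k)
  have hcR : ∀ k, c k ∈ Set.Icc (-R) R := by
    refine fun k => ⟨?_, upper _ (hε k) _ _ _ (hz k) (hv k) (hi k)⟩
    have := upper _ (hε k) (z k) (-v k) (-c k) (hz k) (by rw [norm_neg, hv k])
      (by rw [phase_neg_right, imbalance_neg, hi k, mul_neg])
    linarith
  obtain ⟨⟨⟨z', v'⟩, c'⟩, hmem, φ, hφ, hlim⟩ :=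
    ((isCompact_sphereProd (d := n + 1)).prod (isCompact_Icc (a := -R) (b := R))).tendsto_subseq
      (x := fun k => ((z k, v k), c k)) fun k => ⟨⟨hz k, hv k⟩, hcR k⟩
  have hz' : z'.1 ^ 2 + z'.2 ^ 2 = 1 := hmem.1.1
  have hv' : ‖v'‖ = 1 := hmem.1.2
  have hlimF : ∀ i, Tendsto (fun k => imbalance (μ i) (phase (z (φ k)) (v (φ k))) (c (φ k))) atTop
      (𝓝 (imbalance (μ i) (phase z' v') c')) := by
    intro i
    have hc := (continuousAt_imbalance_phase (μ i) (hac i) hz' hv' c').tendsto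
    have := hc.comp hlim
    simpa only [Function.comp_def] using this
  refine ⟨z', v', c', hz', hv', (Fin.forall_iff_succAbove i₀).2 ⟨?_, fun j => ?_⟩⟩
  · refine tendsto_nhds_unique (hlimF i₀) ?_
    have h1 : Tendsto (fun k => 1 / (((φ k : ℕ) : ℝ) + 1)) atTop (𝓝 0) :=
      (tendsto_one_div_add_atTop_nhds_zero_nat (𝕜 := ℝ)).comp hφ.tendsto_atTop
    have h2 : Tendsto (fun k => c (φ k)) atTop (𝓝 c') :=
      (continuous_snd.tendsto _).comp hlim
    have := h1.mul h2
    rw [zero_mul] at this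
    exact this.congr fun k => (hi (φ k)).symm
  · refine tendsto_nhds_unique (hlimF _) ?_
    simp only [h]
    exact tendsto_const_nhds

end Simultaneous

end DynamicHamSandwich

/-- **Dynamic ham sandwich theorem** for odd `d`.  A moving measure on `ℝ^d` is a finite
measure on `ℝ^d × ℝ^d` (a pair `(p, w)` is a point starting at `p` with constant velocity
`w`), absolutely continuous with respect to the Lebesgue measure on `ℝ^{2d}`.  Given `d+1`
moving measures, either they all share a median speed in some direction `v` (case (a)),
or at some time `t` a single hyperplane simultaneously bisects all the measures
`μ_{i,t} = (μ i).map (fun (p,w) => p + t • w)` (case (b)). -/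
theorem dynamic_ham_sandwich_odd (d : ℕ) (hd : 1 ≤ d) (hodd : Odd d)
    (μ : Fin (d + 1) → Measure (EuclideanSpace ℝ (Fin d) × EuclideanSpace ℝ (Fin d)))
    [∀ i, IsFiniteMeasure (μ i)]
    (hac : ∀ i, μ i ≪ volume) :
    (∃ v : EuclideanSpace ℝ (Fin d), ‖v‖ = 1 ∧ ∃ m : ℝ, ∀ i,
        μ i {pw | ⟪pw.2, v⟫ ≤ m} = μ i {pw | ⟪pw.2, v⟫ ≥ m}) ∨
    (∃ t : ℝ, ∃ v : EuclideanSpace ℝ (Fin d), ‖v‖ = 1 ∧ ∃ c : ℝ, ∀ i,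
        (μ i).map (fun pw => pw.1 + t • pw.2) {x | ⟪x, v⟫ ≥ c}
          = (μ i).map (fun pw => pw.1 + t • pw.2) {x | ⟪x, v⟫ ≤ c}) := by
  obtain ⟨n, rfl⟩ := Nat.exists_eq_add_of_le' hd
  obtain ⟨z, v, c, hz, hv, h⟩ := DynamicHamSandwich.exists_balance μ hodd hac
  have hs := fun i => DynamicHamSandwich.measure_ge_eq_measure_le (μ i)
    (DynamicHamSandwich.measurable_phase z v) (h i)
  by_cases hz1 : z.1 = 0
  · refine Or.inl ⟨z.2 • v, ?_, c, fun i => ?_⟩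
    · rw [norm_smul, hv, mul_one, Real.norm_eq_abs, abs_eq zero_le_one, ← sq_eq_one_iff]
      simpa [hz1] using hz
    · simpa [DynamicHamSandwich.phase, hz1, real_inner_smul_right] using (hs i).symm
  · refine Or.inr ⟨z.2 / z.1, (SignType.sign z.1 : ℝ) • v, ?_, c / |z.1|, fun i => ?_⟩
    · rcases lt_or_gt_of_ne hz1 with h0 | h0 <;> simp [h0, hv]
    · have hm : Measurable fun
          pw : EuclideanSpace ℝ (Fin (n + 1)) × EuclideanSpace ℝ (Fin (n + 1)) =>
        pw.1 + (z.2 / z.1) • pw.2 := by fun_prop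
      have hpos : 0 < |z.1| := abs_pos.2 hz1
      have hphase : ∀ pw : EuclideanSpace ℝ (Fin (n + 1)) × EuclideanSpace ℝ (Fin (n + 1)),
          ⟪pw.1 + (z.2 / z.1) • pw.2, (SignType.sign z.1 : ℝ) • v⟫ =
            DynamicHamSandwich.phase z v pw / |z.1| := by
        intro pw
        rw [eq_div_iff hpos.ne', real_inner_smul_right, mul_right_comm, sign_mul_abs,
          inner_add_left, real_inner_smul_left, DynamicHamSandwich.phase]
        field_simp
      have hmi : Measurable fun x : EuclideanSpace ℝ (Fin (n + 1)) =>
        ⟪x, (SignType.sign z.1 : ℝ) • v⟫ := by fun_prop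
      rw [Measure.map_apply hm (measurableSet_le measurable_const hmi),
        Measure.map_apply hm (measurableSet_le hmi measurable_const)]
      simpa only [Set.preimage_ofPred_eq, hphase, ge_iff_le, div_le_div_iff_of_pos_right hpos]
        using hs i
end

section
/- Let d ≥ 2. For i = 1, …, d let μᵢ be a finite measure on S^{d-1} × ℝ (a pair (n, c) encodes the affine hyperplane {x ∈ ℝ^d : ⟨n, x⟩ = c}), each absolutely continuous with respect to the product of the uniform (spherical) measure on S^{d-1} and the Lebesgue measure on ℝ. For a unit vector v orthogonal to e_d and a pair (n, c) with ⟨n, e_d⟩ ≠ 0, define the vertical speed m((n,c), v) = −⟨n, v⟩ / ⟨n, e_d⟩. For x ∈ ℝ^d, let ℓ_x = x + ℝe_d denote the vertical line through x, and define the induced measure μᵢ^{ℓ_x} on ℝ by μᵢ^{ℓ_x}(B) = μᵢ{(n, c) : ⟨n, e_d⟩ ≠ 0 and the e_d-coordinate of the unique intersection point of the hyperplane {y : ⟨n,y⟩ = c} with ℓ_x lies in B}. Then at least one of the following holds: (a) there exist a unit vector v ⊥ e_d and a real number m such that for every i, μᵢ{(n,c) : ⟨n,e_d⟩ ≠ 0,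 m((n,c),v) ≤ m} = μᵢ{(n,c) : ⟨n,e_d⟩ ≠ 0, m((n,c),v) ≥ m} (all measures share a median vertical speed in direction v); or (b) there exist x ∈ ℝ^d with ⟨x, e_d⟩ = 0 and h ∈ ℝ such that for every i = 1, …, d, μᵢ^{ℓ_x}([h, ∞)) = μᵢ^{ℓ_x}((−∞, h]); that is, a single point on the translated vertical line ℓ_x splits ℓ_x into two closed half-lines of equal induced measure for all d measures. -/
open MeasureTheory
open scoped RealInnerProductSpace

namespace OrderedChain

/-- Mod `2` chains of ordered simplices, a simplex being the list of its vertices. -/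
abbrev Chain (V : Type*) := List V →₀ ZMod 2

variable {V : Type*}

/-- The cone with apex `v`. -/
noncomputable def cone (v : V) : Chain V →ₗ[ZMod 2] Chain V :=
  Finsupp.lmapDomain _ _ (List.cons v)

/-- The sum of the facets of a simplex. -/
noncomputable def facets : List V → Chain V
  | [] => 0
  | v :: l => Finsupp.single l 1 + cone v (facets l)

/-- The (augmented) boundary operator. -/
noncomputable def boundary : Chain V →ₗ[ZMod 2] Chain V :=
  Finsupp.linearCombination _ facets

/-- The map induced on chains by `v ↦ -v`. -/
noncomputable def antipode [Neg V] : Chain V →ₗ[ZMod 2] Chain V :=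
  Finsupp.lmapDomain _ _ (List.map Neg.neg)

/-- Barycentric subdivision in dimension `k`, with `b` choosing the barycenters. -/
noncomputable def subdivision (b : List V → V) : ℕ → Chain V →ₗ[ZMod 2] Chain V
  | 0 => LinearMap.id
  | k + 1 => Finsupp.linearCombination _ fun σ => cone (b σ) (subdivision b k (facets σ))

@[simp] lemma cone_single (v : V) (σ : List V) :
    cone v (Finsupp.single σ 1) = Finsupp.single (v :: σ) 1 := by
  simp [cone]

@[simp] lemma boundary_single (σ : List V) :
    boundary (Finsupp.single σ 1) = facets σ := by
  simp [boundary]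

@[simp] lemma antipode_single [Neg V] (σ : List V) :
    antipode (Finsupp.single σ 1) = Finsupp.single (σ.map Neg.neg) 1 := by
  simp [antipode]

@[simp] lemma subdivision_succ_single (b : List V → V) (k : ℕ) (σ : List V) :
    subdivision b (k + 1) (Finsupp.single σ 1) = cone (b σ) (subdivision b k (facets σ)) := by
  simp [subdivision]

lemma hom_ext {M : Type*} [AddCommMonoid M] [Module (ZMod 2) M] {F G : Chain V →ₗ[ZMod 2] M}
    (h : ∀ σ, F (Finsupp.single σ 1) = G (Finsupp.single σ 1)) : F = G :=
  Finsupp.lhom_ext' fun σ => LinearMap.ext_ring (by simpa using h σ)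

lemma boundary_cone (v : V) (z : Chain V) : boundary (cone v z) = z + cone v (boundary z) := by
  have : boundary ∘ₗ cone v = LinearMap.id + cone v ∘ₗ boundary (V := V) :=
    hom_ext fun σ => by simp [facets]
  exact LinearMap.congr_fun this z

lemma boundary_facets (σ : List V) : boundary (facets σ) = 0 := by
  induction σ with
  | nil => simp [facets]
  | cons v l ih => simp [facets, boundary_cone, ih, ZModModule.add_self]

lemma boundary_subdivision (b : List V → V) (k : ℕ) (z : Chain V) :
    boundary (subdivision b (k + 1) z) = subdivision b k (boundary z) := by
  induction k generalizing z with
  | zero =>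
    have : boundary ∘ₗ subdivision b 1 = subdivision b 0 ∘ₗ boundary :=
      hom_ext fun σ => by simp [boundary_cone, subdivision, boundary_facets]
    exact LinearMap.congr_fun this z
  | succ k ih =>
    have : boundary ∘ₗ subdivision b (k + 2) = subdivision b (k + 1) ∘ₗ boundary :=
      hom_ext fun σ => by simp [boundary_cone, ih, boundary_facets]
    exact LinearMap.congr_fun this z

section Neg
variable [InvolutiveNeg V]

lemma antipode_cone (v : V) (z : Chain V) : antipode (cone v z) = cone (-v) (antipode z) := by
  have : antipode ∘ₗ cone v = cone (-v) ∘ₗ antipode := hom_ext fun σ => by simp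
  exact LinearMap.congr_fun this z

lemma antipode_antipode (z : Chain V) : antipode (antipode z) = z := by
  have : antipode ∘ₗ antipode (V := V) = LinearMap.id := hom_ext fun σ => by simp
  exact LinearMap.congr_fun this z

lemma antipode_facets (σ : List V) : antipode (facets σ) = facets (σ.map Neg.neg) := by
  induction σ with
  | nil => simp [facets]
  | cons v l ih => simp [facets, antipode_cone, ih]

lemma antipode_boundary (z : Chain V) : antipode (boundary z) = boundary (antipode z) := by
  have : antipode ∘ₗ boundary (V := V) = boundary ∘ₗ antipode :=
    hom_ext fun σ => by simp [antipode_facets]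
  exact LinearMap.congr_fun this z

lemma antipode_subdivision {b : List V → V} (hb : ∀ σ, b (σ.map Neg.neg) = -b σ) (k : ℕ)
    (z : Chain V) : antipode (subdivision b k z) = subdivision b k (antipode z) := by
  induction k generalizing z with
  | zero => rfl
  | succ k ih =>
    have : antipode ∘ₗ subdivision b (k + 1) = subdivision b (k + 1) ∘ₗ antipode :=
      hom_ext fun σ => by simp [antipode_cone, hb, ih, antipode_facets]
    exact LinearMap.congr_fun this z

/-- The `k`-dimensional hemisphere of the octahedral sphere with vertices `± e j`. -/
noncomputable def hemisphere (e : ℕ → V) : ℕ → Chain V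
  | 0 => Finsupp.single [e 0] 1
  | k + 1 => cone (e (k + 1)) (hemisphere e k + antipode (hemisphere e k))

lemma boundary_hemisphere (e : ℕ → V) (k : ℕ) :
    boundary (hemisphere e (k + 1)) = hemisphere e k + antipode (hemisphere e k) := by
  suffices h : boundary (hemisphere e k + antipode (hemisphere e k)) = 0 by
    rw [hemisphere, boundary_cone, h, map_zero, add_zero]
  induction k with
  | zero => simp [hemisphere, facets, ZModModule.add_self]
  | succ k ih =>
    have h : boundary (hemisphere e (k + 1)) = hemisphere e k + antipode (hemisphere e k) := by
      rw [hemisphere, boundary_cone, ih, map_zero, add_zero]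
    rw [map_add, ← antipode_boundary, h, map_add, antipode_antipode, add_comm (antipode _),
      ZModModule.add_self]

lemma boundary_subdivision_hemisphere {b : List V → V} (hb : ∀ σ, b (σ.map Neg.neg) = -b σ)
    (e : ℕ → V) (N k : ℕ) :
    boundary ((subdivision b (k + 1))^[N] (hemisphere e (k + 1))) =
      (subdivision b k)^[N] (hemisphere e k) +
        antipode ((subdivision b k)^[N] (hemisphere e k)) := by
  induction N with
  | zero => exact boundary_hemisphere e k
  | succ N ih =>
    simp only [Function.iterate_succ_apply', boundary_subdivision, ih, map_add,
      antipode_subdivision hb]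

end Neg

section Support

/-- The chains all of whose simplices satisfy `P`. -/
abbrev chainsOn (P : List V → Prop) : Submodule (ZMod 2) (Chain V) :=
  Finsupp.supported (ZMod 2) (ZMod 2) {σ | P σ}

lemma single_mem_chainsOn {P : List V → Prop} {σ : List V} (h : P σ) :
    Finsupp.single σ 1 ∈ chainsOn P :=
  Finsupp.single_mem_supported _ _ h

lemma map_mem_chainsOn {P : List V → Prop} {M : Type*} [AddCommMonoid M] [Module (ZMod 2) M]
    {F : Chain V →ₗ[ZMod 2] M} {S : Submodule (ZMod 2) M}
    (h : ∀ σ, P σ → F (Finsupp.single σ 1) ∈ S) {z : Chain V} (hz : z ∈ chainsOn P) :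
    F z ∈ S := by
  rw [chainsOn, Finsupp.supported_eq_span_single] at hz
  have : Submodule.span (ZMod 2) ((fun σ => Finsupp.single σ (1 : ZMod 2)) '' {σ | P σ}) ≤
      S.comap F := by
    rw [Submodule.span_le]
    rintro _ ⟨σ, hσ, rfl⟩
    exact h σ hσ
  exact this hz

lemma eqOn_chainsOn {P : List V → Prop} {M : Type*} [AddCommMonoid M] [Module (ZMod 2) M]
    {F G : Chain V →ₗ[ZMod 2] M}
    (h : ∀ σ, P σ → F (Finsupp.single σ 1) = G (Finsupp.single σ 1)) {z : Chain V}
    (hz : z ∈ chainsOn P) : F z = G z :=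
  LinearMap.mem_eqLocus.1 (map_mem_chainsOn (F := LinearMap.id) (S := LinearMap.eqLocus F G)
    h hz)

lemma chainsOn_mono {P Q : List V → Prop} (h : ∀ σ, P σ → Q σ) : chainsOn P ≤ chainsOn Q :=
  Finsupp.supported_mono h

lemma cone_mem_chainsOn {P Q : List V → Prop} {v : V} (h : ∀ σ, P σ → Q (v :: σ)) {z : Chain V}
    (hz : z ∈ chainsOn P) : cone v z ∈ chainsOn Q :=
  map_mem_chainsOn (fun σ hσ => by simpa using single_mem_chainsOn (h σ hσ)) hz

lemma facets_mem_chainsOn (σ : List V) :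
    facets σ ∈ chainsOn fun τ => τ.length + 1 = σ.length ∧ τ ⊆ σ := by
  induction σ with
  | nil => exact zero_mem _
  | cons v l ih =>
    refine add_mem (single_mem_chainsOn ⟨rfl, by simp⟩) (cone_mem_chainsOn ?_ ih)
    rintro τ ⟨h₁, h₂⟩
    exact ⟨by simp [h₁], List.cons_subset_cons v h₂⟩

end Support

section Cup

/-- The cup product of the coboundaries of `x (k - 1), …, x 0`. -/
def cup (x : ℕ → V → ZMod 2) : ℕ → List V → ZMod 2
  | 0, _ => 1
  | k + 1, u :: v :: l => (x k u + x k v) * cup x k (v :: l)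
  | _ + 1, _ => 0

/-- `cup x k` as a functional on chains. -/
noncomputable def cupHom (x : ℕ → V → ZMod 2) (k : ℕ) : Chain V →ₗ[ZMod 2] ZMod 2 :=
  Finsupp.linearCombination _ (cup x k)

/-- The cup product of `x k` and `cup x k`, as a functional on chains. -/
noncomputable def leadCupHom (x : ℕ → V → ZMod 2) (k : ℕ) : Chain V →ₗ[ZMod 2] ZMod 2 :=
  Finsupp.linearCombination _ fun σ => σ.head?.elim 0 (x k) * cup x k σ

variable (x : ℕ → V → ZMod 2)

@[simp] lemma cupHom_single (k : ℕ) (σ : List V) :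
    cupHom x k (Finsupp.single σ 1) = cup x k σ := by
  simp [cupHom]

@[simp] lemma leadCupHom_single (k : ℕ) (σ : List V) :
    leadCupHom x k (Finsupp.single σ 1) = σ.head?.elim 0 (x k) * cup x k σ := by
  simp [leadCupHom]

lemma leadCupHom_cone (k : ℕ) (u : V) (z : Chain V) :
    leadCupHom x k (cone u z) = x k u * cupHom x k (cone u z) := by
  have : leadCupHom x k ∘ₗ cone u = x k u • (cupHom x k ∘ₗ cone u) :=
    hom_ext fun σ => by simp
  exact LinearMap.congr_fun this z

lemma leadCupHom_facets_of_cupHom_facets {k : ℕ}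
    (h : ∀ σ : List V, σ.length = k + 2 → cupHom x k (facets σ) = 0) {σ : List V}
    (hσ : σ.length = k + 2) : leadCupHom x k (facets σ) = cup x (k + 1) σ := by
  match σ, hσ with
  | u :: v :: l, hσ =>
    have h₀ := h _ hσ
    rw [facets, map_add, cupHom_single] at h₀
    rw [facets, map_add, leadCupHom_cone, leadCupHom_single, ← CharTwo.add_eq_zero.1 h₀, cup]
    simp only [List.head?_cons, Option.elim_some]
    ring

lemma cupHom_facets (k : ℕ) : ∀ σ : List V, σ.length = k + 2 → cupHom x k (facets σ) = 0 := by
  induction k with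
  | zero =>
    intro σ hσ
    match σ, hσ with
    | [u, v], _ => simp [facets, cup, CharTwo.add_self_eq_zero]
  | succ k ih =>
    intro σ hσ
    have h : cupHom x (k + 1) (facets σ) = (leadCupHom x k ∘ₗ boundary) (facets σ) :=
      eqOn_chainsOn (fun τ hτ => by
        have := leadCupHom_facets_of_cupHom_facets x ih (σ := τ) (by omega)
        simp [this]) (facets_mem_chainsOn σ)
    simp [h, boundary_facets]

lemma leadCupHom_facets {k : ℕ} {σ : List V} (hσ : σ.length = k + 2) :
    leadCupHom x k (facets σ) = cup x (k + 1) σ :=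
  leadCupHom_facets_of_cupHom_facets x (cupHom_facets x k) hσ

lemma cup_map_neg [Neg V] (k : ℕ) {σ : List V} (h : ∀ v ∈ σ, ∀ j, x j (-v) = x j v + 1) :
    cup x k (σ.map Neg.neg) = cup x k σ := by
  induction k generalizing σ with
  | zero => simp [cup]
  | succ k ih =>
    match σ, h with
    | [], _ => simp [cup]
    | [u], _ => simp [cup]
    | u :: v :: l, h =>
      have := ih (σ := v :: l) fun w hw => h w (List.mem_cons_of_mem _ hw)
      simp only [List.map_cons, cup] at this ⊢
      rw [this, h u (by simp), h v (by simp)]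
      congr 1
      linear_combination (CharTwo.two_eq_zero : (2 : ZMod 2) = 0)

lemma leadCupHom_antipode [Neg V] {k : ℕ} {z : Chain V}
    (hz : z ∈ chainsOn fun σ : List V => σ.length = k + 1 ∧ ∀ v ∈ σ, ∀ j, x j (-v) = x j v + 1) :
    leadCupHom x k (antipode z) = leadCupHom x k z + cupHom x k z := by
  refine eqOn_chainsOn (F := leadCupHom x k ∘ₗ antipode) (G := leadCupHom x k + cupHom x k)
    ?_ hz
  rintro σ ⟨hl, hσ⟩
  match σ, hl with
  | v :: l, _ =>
    have := cup_map_neg x k hσ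
    simp only [LinearMap.comp_apply, antipode_single, leadCupHom_single, this,
      LinearMap.add_apply, cupHom_single]
    simp [hσ v (by simp)]
    ring

lemma cupHom_eq_one [Neg V] {c : ℕ → Chain V} {n : ℕ} {v₀ : V} (h₀ : c 0 = Finsupp.single [v₀] 1)
    (hc : ∀ k, boundary (c (k + 1)) = c k + antipode (c k))
    (hs : ∀ k ≤ n, c k ∈ chainsOn
      fun σ : List V => σ.length = k + 1 ∧ ∀ v ∈ σ, ∀ j, x j (-v) = x j v + 1) :
    ∀ k ≤ n, cupHom x k (c k) = 1 := by
  intro k hk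
  induction k with
  | zero => simp [h₀, cup]
  | succ k ih =>
    have h : cupHom x (k + 1) (c (k + 1)) = (leadCupHom x k ∘ₗ boundary) (c (k + 1)) :=
      eqOn_chainsOn (fun τ hτ => by simp [leadCupHom_facets x hτ.1]) (hs _ hk)
    rw [h, LinearMap.comp_apply, hc, map_add, leadCupHom_antipode x (hs k (by omega)),
      ← add_assoc, CharTwo.add_self_eq_zero, zero_add, ih (by omega)]

lemma exists_ne_of_cup_ne_zero {k : ℕ} {σ : List V} (h : cup x k σ ≠ 0) :
    ∀ j < k, ∃ u ∈ σ, ∃ v ∈ σ, x j u ≠ x j v := by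
  induction k generalizing σ with
  | zero => simp
  | succ k ih =>
    match σ, h with
    | [], h => simp [cup] at h
    | [u], h => simp [cup] at h
    | u :: v :: l, h =>
      rw [cup, mul_ne_zero_iff] at h
      intro j hj
      rcases Nat.lt_succ_iff_lt_or_eq.1 hj with hj | rfl
      · obtain ⟨a, ha, b, hb, hab⟩ := ih h.2 j hj
        exact ⟨a, List.mem_cons_of_mem _ ha, b, List.mem_cons_of_mem _ hb, hab⟩
      · exact ⟨u, by simp, v, by simp, fun e => h.1 (CharTwo.add_eq_zero.2 e)⟩

end Cup

section Barycenter

variable {E : Type*} [NormedAddCommGroup E] [NormedSpace ℝ E]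

/-- The barycenter of a list of points. -/
noncomputable def barycenter (σ : List E) : E := (σ.length : ℝ)⁻¹ • σ.sum

lemma barycenter_map_neg (σ : List E) : barycenter (σ.map Neg.neg) = -barycenter σ := by
  have : (σ.map Neg.neg).sum = -σ.sum := by
    induction σ with
    | nil => simp
    | cons v l ih => simp [ih, add_comm]
  simp [barycenter, this]

lemma barycenter_mem_convexHull {σ : List E} (hσ : σ ≠ []) :
    barycenter σ ∈ convexHull ℝ {v | v ∈ σ} := by
  have hl : (σ.length : ℝ) ≠ 0 := by simpa using hσ
  rw [barycenter, ← Fin.sum_univ_getElem, Finset.smul_sum]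
  refine (convex_convexHull ℝ _).sum_mem (fun _ _ => by positivity) ?_ fun i _ =>
    subset_convexHull ℝ _ (List.getElem_mem i.2)
  simp [hl]

lemma dist_barycenter_le {k : ℕ} {D : ℝ} {σ : List E} (hl : σ.length = k + 1)
    (hD : ∀ u ∈ σ, ∀ v ∈ σ, dist u v ≤ D) {p : E} (hp : p ∈ convexHull ℝ {v | v ∈ σ}) :
    dist p (barycenter σ) ≤ k / (k + 1) * D := by
  suffices h : {v | v ∈ σ} ⊆ Metric.closedBall (barycenter σ) (k / (k + 1) * D) from
    convexHull_min h (convex_closedBall _ _) hp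
  intro v hv
  obtain ⟨j, hj, rfl⟩ := List.getElem_of_mem hv
  have hk : (k + 1 : ℝ) ≠ 0 := by positivity
  have key : σ[j] - barycenter σ =
      (k + 1 : ℝ)⁻¹ • ∑ i : Fin σ.length, (σ[j] - σ[i]) := by
    have hsum : ∑ i : Fin σ.length, σ[i] = σ.sum := Fin.sum_univ_getElem σ
    rw [Finset.sum_sub_distrib, hsum, barycenter, smul_sub]
    simp only [Finset.sum_const, Finset.card_univ, Fintype.card_fin, hl,
      ← Nat.cast_smul_eq_nsmul ℝ, smul_smul]
    push_cast
    rw [inv_mul_cancel₀ hk, one_smul]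
  have bound : ∑ i : Fin σ.length, ‖σ[j] - σ[i]‖ ≤ k * D := by
    rw [← Finset.add_sum_erase _ _ (Finset.mem_univ (⟨j, hj⟩ : Fin σ.length))]
    have : ∀ i ∈ Finset.univ.erase (⟨j, hj⟩ : Fin σ.length), ‖σ[j] - σ[i]‖ ≤ D := fun i _ => by
      rw [← dist_eq_norm]
      exact hD _ hv _ (List.getElem_mem i.2)
    refine (add_le_add_right (Finset.sum_le_card_nsmul _ _ _ this) _).trans ?_
    simp [hl]
  rw [Metric.mem_closedBall, dist_eq_norm, key, norm_smul, Real.norm_of_nonneg (by positivity),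
    div_mul_eq_mul_div, inv_mul_eq_div]
  gcongr
  exact (norm_sum_le _ _).trans bound

lemma subdivision_single_mem_chainsOn {n k : ℕ} (hk : k ≤ n) {D : ℝ} {σ : List E}
    (hl : σ.length = k + 1) (hD : ∀ u ∈ σ, ∀ v ∈ σ, dist u v ≤ D) :
    subdivision barycenter k (Finsupp.single σ 1) ∈ chainsOn fun τ : List E =>
      τ.length = k + 1 ∧ (∀ v ∈ τ, v ∈ convexHull ℝ {v | v ∈ σ}) ∧
        ∀ u ∈ τ, ∀ v ∈ τ, dist u v ≤ n / (n + 1) * D := by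
  induction k generalizing σ with
  | zero =>
    match σ, hl with
    | [v], _ =>
      have : 0 ≤ D := by simpa using hD v (by simp) v (by simp)
      refine single_mem_chainsOn ⟨rfl, fun v hv => subset_convexHull ℝ _ hv, ?_⟩
      simp only [List.mem_singleton, forall_eq, dist_self]
      positivity
  | succ k ih =>
    have hσ : σ ≠ [] := by rintro rfl; simp at hl
    have hD₀ : 0 ≤ D := by
      simpa using hD _ (List.head_mem hσ) _ (List.head_mem hσ)
    have hr : ((k + 1 : ℕ) : ℝ) / ((k + 1 : ℕ) + 1) * D ≤ n / (n + 1) * D := by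
      refine mul_le_mul_of_nonneg_right ?_ hD₀
      rw [div_le_div_iff₀ (by positivity) (by positivity)]
      have : ((k + 1 : ℕ) : ℝ) ≤ n := by exact_mod_cast hk
      linarith
    rw [subdivision_succ_single]
    refine cone_mem_chainsOn (P := fun τ : List E =>
      τ.length = k + 1 ∧ (∀ v ∈ τ, v ∈ convexHull ℝ {v | v ∈ σ}) ∧
        ∀ u ∈ τ, ∀ v ∈ τ, dist u v ≤ n / (n + 1) * D) ?_ ?_
    · rintro τ ⟨h₁, h₂, h₃⟩
      have hb : ∀ v ∈ τ, dist v (barycenter σ) ≤ n / (n + 1) * D := fun v hv =>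
        (dist_barycenter_le hl hD (h₂ v hv)).trans hr
      refine ⟨by simp [h₁], ?_, ?_⟩
      · simpa using ⟨barycenter_mem_convexHull hσ, h₂⟩
      · simp only [List.mem_cons, forall_eq_or_imp, dist_self]
        exact ⟨⟨by positivity, fun v hv => dist_comm v _ ▸ hb v hv⟩,
          fun u hu => ⟨hb u hu, h₃ u hu⟩⟩
    · refine map_mem_chainsOn ?_ (facets_mem_chainsOn σ)
      rintro ρ ⟨hρ, hρσ⟩
      refine chainsOn_mono ?_ (ih (by omega) (by omega)
        fun u hu v hv => hD u (hρσ hu) v (hρσ hv))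
      rintro τ ⟨h₁, h₂, h₃⟩
      exact ⟨h₁, fun v hv => convexHull_mono (fun w hw => hρσ hw) (h₂ v hv), h₃⟩

lemma subdivision_iterate_mem_chainsOn {n k : ℕ} (hk : k ≤ n) {D : ℝ} {ι : Type*}
    {A : ι → Set E} (hA : ∀ i, Convex ℝ (A i)) {z : Chain E}
    (hz : z ∈ chainsOn fun σ : List E => σ.length = k + 1 ∧ (∃ i, ∀ v ∈ σ, v ∈ A i) ∧
      ∀ u ∈ σ, ∀ v ∈ σ, dist u v ≤ D) (N : ℕ) :
    (subdivision barycenter k)^[N] z ∈ chainsOn fun σ : List E =>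
      σ.length = k + 1 ∧ (∃ i, ∀ v ∈ σ, v ∈ A i) ∧
        ∀ u ∈ σ, ∀ v ∈ σ, dist u v ≤ (n / (n + 1) : ℝ) ^ N * D := by
  induction N with
  | zero => simpa using hz
  | succ N ih =>
    rw [Function.iterate_succ_apply']
    refine map_mem_chainsOn ?_ ih
    rintro σ ⟨h₁, ⟨i, hi⟩, h₃⟩
    refine chainsOn_mono ?_ (subdivision_single_mem_chainsOn hk h₁ h₃)
    rintro τ ⟨t₁, t₂, t₃⟩
    refine ⟨t₁, ⟨i, fun v hv => convexHull_min hi (hA i) (t₂ v hv)⟩, fun u hu v hv => ?_⟩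
    rw [pow_succ', mul_assoc]
    exact t₃ u hu v hv

end Barycenter

section Octahedron

variable {n : ℕ}

/-- The signed standard basis vectors spanning a facet of the octahedron lie in this convex set. -/
def octant (s : Fin (n + 1) → ℝ) : Set (Fin (n + 1) → ℝ) :=
  {v | ∑ j, s j * v j = 1} ∩ Metric.closedBall 0 1

lemma convex_octant (s : Fin (n + 1) → ℝ) : Convex ℝ (octant s) := by
  refine Convex.inter ?_ (convex_closedBall _ _)
  refine convex_hyperplane (f := fun v : Fin (n + 1) → ℝ => ∑ j, s j * v j) ⟨fun u v => ?_,
    fun c v => ?_⟩ 1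
  · simp [mul_add, Finset.sum_add_distrib]
  · simp [Finset.mul_sum, mul_left_comm]

lemma le_norm_of_mem_octant {s : Fin (n + 1) → ℝ} (hs : ∀ j, |s j| = 1) {v : Fin (n + 1) → ℝ}
    (hv : v ∈ octant s) : (n + 1 : ℝ)⁻¹ ≤ ‖v‖ := by
  have h : (1 : ℝ) ≤ (n + 1) * ‖v‖ := by
    calc (1 : ℝ) = |∑ j, s j * v j| := by rw [hv.1, abs_one]
      _ ≤ ∑ j, |s j * v j| := Finset.abs_sum_le_sum_abs _ _
      _ ≤ ∑ _j : Fin (n + 1), ‖v‖ := Finset.sum_le_sum fun j _ => by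
          rw [abs_mul, hs, one_mul]
          exact norm_le_pi_norm v j
      _ = (n + 1) * ‖v‖ := by simp
  rwa [inv_le_iff_one_le_mul₀' (by positivity)]

lemma hemisphere_mem_chainsOn {k : ℕ} (hk : k ≤ n) :
    hemisphere (fun j (i : Fin (n + 1)) => if i.val = j then (1 : ℝ) else 0) k ∈
      chainsOn fun σ => σ.length = k + 1 ∧
        (∃ s : {s : Fin (n + 1) → ℝ // ∀ j, |s j| = 1}, ∀ v ∈ σ, v ∈ octant s.1) ∧
        ∀ u ∈ σ, ∀ v ∈ σ, dist u v ≤ 2 := by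
  set e : ℕ → Fin (n + 1) → ℝ := fun j i => if i.val = j then (1 : ℝ) else 0 with he
  have h : hemisphere e k ∈ chainsOn fun σ => σ.length = k + 1 ∧
      ∃ s : ℕ → ℝ, (∀ j, |s j| = 1) ∧ ∀ v ∈ σ, ∃ j ≤ k, v = s j • e j := by
    clear hk
    induction k with
    | zero => exact single_mem_chainsOn ⟨rfl, fun _ => 1, by simp, by simp⟩
    | succ k ih =>
      refine cone_mem_chainsOn ?_ (add_mem ih (map_mem_chainsOn ?_ ih))
      · rintro σ ⟨hl, s, hs, hσ⟩
        refine ⟨by simp [hl], Function.update s (k + 1) 1, fun j => ?_, ?_⟩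
        · rcases eq_or_ne j (k + 1) with rfl | hj <;> simp [*]
        · simp only [List.mem_cons, forall_eq_or_imp]
          refine ⟨⟨k + 1, le_rfl, by simp⟩, fun v hv => ?_⟩
          obtain ⟨j, hj, rfl⟩ := hσ v hv
          exact ⟨j, by omega, by rw [Function.update_of_ne (by omega)]⟩
      · rintro σ ⟨hl, s, hs, hσ⟩
        rw [antipode_single]
        refine single_mem_chainsOn ⟨by simp [hl], -s, by simp [hs], fun v hv => ?_⟩
        obtain ⟨u, hu, rfl⟩ := List.mem_map.1 hv
        obtain ⟨j, hj, rfl⟩ := hσ u hu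
        exact ⟨j, hj, by simp⟩
  refine chainsOn_mono ?_ h
  rintro σ ⟨hl, s, hs, hσ⟩
  have hmem : ∀ v ∈ σ, v ∈ octant fun j => s j.val := fun v hv => by
    obtain ⟨j, hj, rfl⟩ := hσ v hv
    have hss : s j * s j = 1 := by rw [← abs_mul_abs_self, hs, one_mul]
    constructor
    · simp only [Set.mem_ofPred_eq, Pi.smul_apply, smul_eq_mul, he]
      rw [Finset.sum_eq_single (⟨j, by omega⟩ : Fin (n + 1))]
      · simpa using hss
      · intro i _ hi
        rw [if_neg fun h => hi (Fin.ext h)]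
        simp
      · simp
    · rw [mem_closedBall_zero_iff, norm_smul, Real.norm_eq_abs, hs, one_mul,
        pi_norm_le_iff_of_nonneg zero_le_one]
      intro i
      simp only [he]
      split_ifs <;> simp
  refine ⟨hl, ⟨⟨fun j => s j.val, fun j => hs j⟩, hmem⟩, fun u hu v hv => ?_⟩
  have h₁ := (hmem u hu).2
  have h₂ := (hmem v hv).2
  rw [Metric.mem_closedBall] at h₁ h₂
  linarith [dist_triangle_right u v 0]

end Octahedron

end OrderedChain

/-- An odd function has an odd `ZMod 2`-valued sign. -/
lemma exists_odd_sign {ι : Type*} [LinearOrder ι] [Finite ι] {g : (ι → ℝ) → ℝ}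
    (hodd : ∀ v ≠ 0, g (-v) = -g v) :
    ∃ x : (ι → ℝ) → ZMod 2, (∀ v ≠ 0, x (-v) = x v + 1) ∧
      ∀ u v, x u ≠ x v → g u ≤ 0 ∧ 0 ≤ g v ∨ g v ≤ 0 ∧ 0 ≤ g u := by
  classical
  refine ⟨fun v => if 0 < g v ∨ g v = 0 ∧ 0 < toLex v then 1 else 0, fun v hv => ?_,
    fun u v huv => ?_⟩
  · have hlex : 0 < toLex (-v) ↔ ¬ 0 < toLex v := by
      rw [toLex_neg, Left.neg_pos_iff]
      exact ⟨fun h => h.not_gt, fun h => lt_of_le_of_ne (not_lt.1 h) hv⟩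
    have h11 : (0 : ZMod 2) = 1 + 1 := rfl
    simp only [hodd v hv, hlex, neg_eq_zero, Left.neg_pos_iff]
    rcases lt_trichotomy (g v) 0 with h | h | h
    · simp [h, h.ne, h.not_gt]
    · by_cases hl : 0 < toLex v <;> simp [h, hl, ← h11]
    · simp [h, h.ne', h.not_gt, ← h11]
  · rcases le_or_gt (g u) 0 with hu | hu <;> rcases le_or_gt (g v) 0 with hv | hv
    · rcases hu.eq_or_lt with h | h
      · exact Or.inr ⟨hv, h.ge⟩
      · rcases hv.eq_or_lt with h' | h'
        · exact Or.inl ⟨hu, h'.ge⟩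
        · simp [h.not_gt, h.ne, h'.not_gt, h'.ne] at huv
    · exact Or.inl ⟨hu, hv.le⟩
    · exact Or.inr ⟨hv, hu.le⟩
    · simp [hu, hv] at huv

open OrderedChain in
/-- **Borsuk–Ulam theorem**. -/
theorem exists_eq_zero_of_odd {n : ℕ} {f : (Fin (n + 1) → ℝ) → Fin n → ℝ}
    (hf : ContinuousOn f {0}ᶜ) (hodd : ∀ v ≠ 0, f (-v) = -f v) : ∃ v ≠ 0, f v = 0 := by
  by_contra! hne
  set K : Set (Fin (n + 1) → ℝ) := Metric.closedBall 0 1 ∩ {v | (n + 1 : ℝ)⁻¹ ≤ ‖v‖} with hK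
  have hKc : IsCompact K := (isCompact_closedBall _ _).inter_right
    (isClosed_le continuous_const continuous_norm)
  have hn : (0 : ℝ) < (n + 1 : ℝ)⁻¹ := by positivity
  have hK₀ : K ⊆ {0}ᶜ := fun v hv => norm_pos_iff.1 (hn.trans_le hv.2)
  have hfK : ContinuousOn f K := hf.mono hK₀
  obtain ⟨ε, hε, hεf⟩ : ∃ ε > 0, ∀ v ∈ K, ε ≤ ‖f v‖ := by
    rcases K.eq_empty_or_nonempty with h | h
    · exact ⟨1, one_pos, by simp [h]⟩
    · obtain ⟨v, hv, hmin⟩ := hKc.exists_isMinOn h hfK.norm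
      exact ⟨‖f v‖, norm_pos_iff.2 (hne v (hK₀ hv)), fun w hw => hmin hw⟩
  obtain ⟨δ, hδ, hδf⟩ := Metric.uniformContinuousOn_iff.1
    (hKc.uniformContinuousOn_of_continuous hfK) ε hε
  obtain ⟨N, hN⟩ : ∃ N : ℕ, (n / (n + 1) : ℝ) ^ N * 2 < δ := by
    obtain ⟨N, hN⟩ := exists_pow_lt_of_lt_one (half_pos hδ)
      (show (n / (n + 1) : ℝ) < 1 by rw [div_lt_one (by positivity)]; linarith)
    exact ⟨N, by linarith⟩
  have hg : ∀ k : ℕ, ∃ x : (Fin (n + 1) → ℝ) → ZMod 2, (∀ v ≠ 0, x (-v) = x v + 1) ∧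
      ∀ u v, x u ≠ x v → ∀ hk : k < n,
        f u ⟨k, hk⟩ ≤ 0 ∧ 0 ≤ f v ⟨k, hk⟩ ∨ f v ⟨k, hk⟩ ≤ 0 ∧ 0 ≤ f u ⟨k, hk⟩ := by
    intro k
    by_cases hk : k < n
    · obtain ⟨x, hx, hx'⟩ := exists_odd_sign (g := fun v => f v ⟨k, hk⟩)
        fun v hv => by simp [hodd v hv]
      exact ⟨x, hx, fun u v huv _ => hx' u v huv⟩
    · obtain ⟨x, hx, -⟩ := exists_odd_sign (ι := Fin (n + 1)) (g := 0) (by simp)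
      exact ⟨x, hx, fun u v _ h => absurd h hk⟩
  choose x hxodd hxsign using hg
  have hx : ∀ v ≠ 0, ∀ j, x j (-v) = x j v + 1 := fun v hv j => hxodd j v hv
  let c : ℕ → Chain (Fin (n + 1) → ℝ) := fun k => (subdivision barycenter k)^[N]
    (hemisphere (fun j (i : Fin (n + 1)) => if i.val = j then (1 : ℝ) else 0) k)
  have hc := fun k (hk : k ≤ n) => subdivision_iterate_mem_chainsOn hk
    (fun s : {s : Fin (n + 1) → ℝ // ∀ j, |s j| = 1} => convex_octant s.1)
    (hemisphere_mem_chainsOn hk) N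
  have hoct : ∀ s : {s : Fin (n + 1) → ℝ // ∀ j, |s j| = 1}, octant s.1 ⊆ K := fun s v hv =>
    ⟨hv.2, le_norm_of_mem_octant s.2 hv⟩
  have h₁ : cupHom x n (c n) = 1 := by
    refine cupHom_eq_one x (c := c) (n := n) (Function.iterate_fixed rfl N)
      (boundary_subdivision_hemisphere barycenter_map_neg _ N) (fun k hk => ?_) n le_rfl
    refine chainsOn_mono ?_ (hc k hk)
    rintro σ ⟨hl, ⟨s, hs⟩, -⟩
    exact ⟨hl, fun v hv => hx v (hK₀ (hoct s (hs v hv)))⟩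
  have h₂ : cupHom x n (c n) = (0 : Chain (Fin (n + 1) → ℝ) →ₗ[ZMod 2] ZMod 2) (c n) := by
    refine eqOn_chainsOn ?_ (hc n le_rfl)
    rintro σ ⟨hl, ⟨s, hs⟩, hd⟩
    rw [cupHom_single, LinearMap.zero_apply]
    by_contra hcup
    obtain ⟨w, hw⟩ : ∃ w, w ∈ σ := List.exists_mem_of_length_pos (by omega)
    refine (hεf w (hoct s (hs w hw))).not_gt ((pi_norm_lt_iff hε).2 fun j => ?_)
    obtain ⟨u, hu, v, hv, huv⟩ := exists_ne_of_cup_ne_zero x hcup j j.2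
    have hclose : ∀ v ∈ σ, |f v j - f w j| < ε := fun v hv => by
      rw [← Real.dist_eq]
      exact (dist_le_pi_dist (f v) (f w) j).trans_lt (hδf v (hoct s (hs v hv)) w
        (hoct s (hs w hw)) ((hd v hv w hw).trans_lt hN))
    have hu' := abs_lt.1 (hclose u hu)
    have hv' := abs_lt.1 (hclose v hv)
    rw [Real.norm_eq_abs, abs_lt]
    rcases hxsign j u v huv j.2 with ⟨h, h'⟩ | ⟨h, h'⟩ <;> constructor <;>
      linarith [h, h', hu'.1, hu'.2, hv'.1, hv'.2]
  simp [h₁] at h₂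

namespace MeasureTheory

lemma toSphere_inner_eq_zero {E : Type*} [NormedAddCommGroup E] [InnerProductSpace ℝ E]
    [FiniteDimensional ℝ E] [MeasurableSpace E] [BorelSpace E] {u : E} (hu : u ≠ 0) :
    (volume : Measure E).toSphere {n | ⟪(n : E), u⟫ = 0} = 0 := by
  have hm : MeasurableSet {n : Metric.sphere (0 : E) 1 | ⟪(n : E), u⟫ = 0} :=
    measurableSet_eq_fun (by fun_prop) measurable_const
  rw [Measure.toSphere_apply' _ hm]
  refine mul_eq_zero_of_right _ (measure_mono_null (t := ((ℝ ∙ u)ᗮ : Submodule ℝ E)) ?_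
    (Measure.addHaar_submodule _ _ ?_))
  · rintro _ ⟨r, -, _, ⟨n, hn, rfl⟩, rfl⟩
    rw [SetLike.mem_coe, Submodule.mem_orthogonal_singleton_iff_inner_left]
    simp only [inner_smul_left]
    exact mul_eq_zero_of_right _ hn
  · rw [Ne, Submodule.orthogonal_eq_top_iff, Submodule.span_singleton_eq_bot]
    exact hu

lemma ae_mul_sub_inner_ne_zero {E : Type*} [NormedAddCommGroup E] [InnerProductSpace ℝ E]
    [FiniteDimensional ℝ E] [MeasurableSpace E] [BorelSpace E] {u : E} {t : ℝ}
    (h : u ≠ 0 ∨ t ≠ 0) :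
    ∀ᵐ nc ∂((volume : Measure E).toSphere).prod (volume : Measure ℝ),
      t * nc.2 - ⟪(nc.1 : E), u⟫ ≠ 0 := by
  have hm : MeasurableSet {nc : Metric.sphere (0 : E) 1 × ℝ | t * nc.2 - ⟪(nc.1 : E), u⟫ = 0} :=
    measurableSet_eq_fun (by fun_prop) measurable_const
  rw [ae_iff]
  simp only [not_not]
  rw [Measure.measure_prod_null hm]
  by_cases ht : t = 0
  · have hu := h.resolve_right (not_not.2 ht)
    have : ∀ᵐ n : Metric.sphere (0 : E) 1 ∂(volume : Measure E).toSphere,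
        ⟪(n : E), u⟫ ≠ 0 := by
      simpa [ae_iff] using toSphere_inner_eq_zero hu
    filter_upwards [this] with n hn
    simp [ht, hn]
  · refine Filter.Eventually.of_forall fun n => measure_mono_null (t := {⟪(n : E), u⟫ / t})
      (fun c hc => ?_) (measure_singleton _)
    rw [Set.mem_singleton_iff, eq_div_iff ht, mul_comm]
    exact sub_eq_zero.1 hc

variable {α : Type*} [MeasurableSpace α] {μ : Measure α} [IsFiniteMeasure μ]

lemma continuousAt_integral_sign {X : Type*} [TopologicalSpace X] [FirstCountableTopology X]
    {Q : X → α → ℝ} (hQ : ∀ w, Measurable (Q w)) (hc : ∀ a, Continuous fun w => Q w a) {w : X}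
    (hw : ∀ᵐ a ∂μ, Q w a ≠ 0) :
    ContinuousAt (fun w => ∫ a, (SignType.sign (Q w a) : ℝ) ∂μ) w := by
  have hcoe : Continuous fun s : SignType => (s : ℝ) := continuous_of_discreteTopology
  refine continuousAt_of_dominated (bound := fun _ => 1) (.of_forall fun v => ?_)
    (.of_forall fun v => .of_forall fun a => ?_) (integrable_const 1) ?_
  · have hmono : Monotone fun r : ℝ => (SignType.sign r : ℝ) := fun r s hrs => by
      have hcast : ∀ x y : SignType, x ≤ y → (x : ℝ) ≤ y := by
        rintro (_ | _ | _) (_ | _ | _) h <;> revert h <;> simp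
      exact hcast _ _ (SignType.sign.monotone hrs)
    exact (hmono.measurable.comp (hQ v)).aestronglyMeasurable
  · cases SignType.sign (Q v a) <;> simp
  · filter_upwards [hw] with a ha
    exact hcoe.continuousAt.comp
      (ContinuousAt.comp (g := SignType.sign) (continuousAt_sign_of_ne_zero ha)
        (hc a).continuousAt)

lemma measure_pos_eq_measure_neg_of_integral_sign_eq_zero {Q : α → ℝ} (hQ : Measurable Q)
    (h : ∫ a, (SignType.sign (Q a) : ℝ) ∂μ = 0) : μ {a | 0 < Q a} = μ {a | Q a < 0} := by
  have hp : MeasurableSet {a | 0 < Q a} := measurableSet_lt measurable_const hQ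
  have hn : MeasurableSet {a | Q a < 0} := measurableSet_lt hQ measurable_const
  have hs : ∀ a, (SignType.sign (Q a) : ℝ) =
      {a | 0 < Q a}.indicator 1 a - {a | Q a < 0}.indicator 1 a := fun a => by
    rcases lt_trichotomy (Q a) 0 with h | h | h <;>
      simp [Set.indicator, h, h.not_gt]
  simp_rw [hs] at h
  have hi : ∀ s : Set α, MeasurableSet s → Integrable (s.indicator (1 : α → ℝ)) μ :=
    fun s => (integrable_const (1 : ℝ)).indicator
  rw [integral_sub (hi _ hp) (hi _ hn), integral_indicator_one hp,
    integral_indicator_one hn, sub_eq_zero] at h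
  exact (measureReal_eq_measureReal_iff).1 h

/-- **Ham sandwich theorem** for zero sets of a linear family of functions. -/
lemma exists_ne_zero_forall_measure_pos_eq_measure_neg {n : ℕ} {μ : Fin n → Measure α}
    [∀ i, IsFiniteMeasure (μ i)] {Q : (Fin (n + 1) → ℝ) → α → ℝ} (hQ : ∀ w, Measurable (Q w))
    (hc : ∀ a, Continuous fun w => Q w a) (hneg : ∀ w a, Q (-w) a = -Q w a)
    (hae : ∀ w ≠ 0, ∀ i, ∀ᵐ a ∂μ i, Q w a ≠ 0) :
    ∃ w ≠ 0, ∀ i, μ i {a | 0 < Q w a} = μ i {a | Q w a < 0} := by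
  obtain ⟨w, hw, h⟩ := exists_eq_zero_of_odd
    (f := fun w i => ∫ a, (SignType.sign (Q w a) : ℝ) ∂μ i)
    (continuousOn_pi.2 fun i w hw =>
      (continuousAt_integral_sign hQ hc (hae w hw i)).continuousWithinAt)
    fun w _ => by
      ext i
      simp [hneg, Left.sign_neg, integral_neg]
  exact ⟨w, hw, fun i => measure_pos_eq_measure_neg_of_integral_sign_eq_zero (hQ w)
    (congrFun h i)⟩

end MeasureTheory

lemma exists_equiv_orthogonal_prod {d : ℕ} {ed : EuclideanSpace ℝ (Fin d)} (hd : 1 ≤ d)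
    (hed : ed ≠ 0) : Nonempty ((Fin (d + 1) → ℝ) ≃L[ℝ] (ℝ ∙ ed)ᗮ × ℝ × ℝ) := by
  refine ⟨ContinuousLinearEquiv.ofFinrankEq ?_⟩
  have : Fact (Module.finrank ℝ (EuclideanSpace ℝ (Fin d)) = (d - 1) + 1) := ⟨by simp; omega⟩
  rw [Module.finrank_prod, Submodule.finrank_orthogonal_span_singleton (n := d - 1) hed]
  simp
  omega

/-- Halving `d` mass assignments induced by measures on hyperplanes on a translate of a fixed
vertical line.  An affine hyperplane of `ℝ^d` is encoded as a pair
`(n, c) ∈ S^{d-1} × ℝ`, meaning `{y : ⟪n, y⟫ = c}`; each of the `d` given finite measures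
on this space of hyperplanes is absolutely continuous with respect to the product of the
spherical measure and the Lebesgue measure.  Either all measures share a median vertical
speed `m((n,c),v) = -⟪n,v⟫/⟪n,e_d⟫` in some horizontal direction `v` (case (a)), or there
are a horizontal translate `ℓ_x = x + ℝe_d` (with `⟪x, e_d⟫ = 0`) of the vertical line and a
height `h` such that the point of `ℓ_x` at height `h` splits `ℓ_x` into two closed
half-lines of equal induced measure for every measure (case (b)).  The `e_d`-coordinate of
the intersection point of the hyperplane `(n, c)` with `ℓ_x` is
`⟪x, e_d⟫ + (c - ⟪n, x⟫)/⟪n, e_d⟫`. -/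
theorem point_on_translated_line_bisects_hyperplanes (d : ℕ) (hd : 2 ≤ d)
    (ed : EuclideanSpace ℝ (Fin d))
    (hed : ed = EuclideanSpace.single (⟨d - 1, by omega⟩ : Fin d) (1 : ℝ))
    (μ : Fin d → Measure (Metric.sphere (0 : EuclideanSpace ℝ (Fin d)) 1 × ℝ))
    [∀ i, IsFiniteMeasure (μ i)]
    (hac : ∀ i, μ i ≪
      ((volume : Measure (EuclideanSpace ℝ (Fin d))).toSphere).prod (volume : Measure ℝ)) :
    (∃ v : EuclideanSpace ℝ (Fin d), ‖v‖ = 1 ∧ ⟪v, ed⟫ = 0 ∧ ∃ m : ℝ, ∀ i,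
        μ i {nc | ⟪(nc.1 : EuclideanSpace ℝ (Fin d)), ed⟫ ≠ 0 ∧
            -⟪(nc.1 : EuclideanSpace ℝ (Fin d)), v⟫ /
              ⟪(nc.1 : EuclideanSpace ℝ (Fin d)), ed⟫ ≤ m}
          = μ i {nc | ⟪(nc.1 : EuclideanSpace ℝ (Fin d)), ed⟫ ≠ 0 ∧
            -⟪(nc.1 : EuclideanSpace ℝ (Fin d)), v⟫ /
              ⟪(nc.1 : EuclideanSpace ℝ (Fin d)), ed⟫ ≥ m}) ∨
    (∃ x : EuclideanSpace ℝ (Fin d), ⟪x, ed⟫ = 0 ∧ ∃ h : ℝ, ∀ i,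
        μ i {nc | ⟪(nc.1 : EuclideanSpace ℝ (Fin d)), ed⟫ ≠ 0 ∧
            ⟪x, ed⟫ + (nc.2 - ⟪(nc.1 : EuclideanSpace ℝ (Fin d)), x⟫) /
              ⟪(nc.1 : EuclideanSpace ℝ (Fin d)), ed⟫ ≥ h}
          = μ i {nc | ⟪(nc.1 : EuclideanSpace ℝ (Fin d)), ed⟫ ≠ 0 ∧
            ⟪x, ed⟫ + (nc.2 - ⟪(nc.1 : EuclideanSpace ℝ (Fin d)), x⟫) /
              ⟪(nc.1 : EuclideanSpace ℝ (Fin d)), ed⟫ ≤ h}) := by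
  have hd₁ : ‖ed‖ = 1 := by simp [hed]
  have hed₀ : ed ≠ 0 := norm_ne_zero_iff.1 (by simp [hd₁])
  have hedd : ⟪ed, ed⟫ = 1 := by simp [hd₁]
  obtain ⟨e⟩ := exists_equiv_orthogonal_prod (by omega) hed₀
  have horth : ∀ w, ⟪((e w).1 : EuclideanSpace ℝ (Fin d)), ed⟫ = 0 := fun w =>
    Submodule.mem_orthogonal_singleton_iff_inner_left.1 (e w).1.2
  let G : (Fin (d + 1) → ℝ) → Metric.sphere (0 : EuclideanSpace ℝ (Fin d)) 1 × ℝ → ℝ :=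
    fun w nc => (e w).2.1 * nc.2 -
      ⟪(nc.1 : EuclideanSpace ℝ (Fin d)), (e w).1 + (e w).2.2 • ed⟫
  have hvert : ∀ i, ∀ᵐ nc ∂μ i, ⟪(nc.1 : EuclideanSpace ℝ (Fin d)), ed⟫ ≠ 0 := fun i =>
    (hac i).ae_le ((ae_mul_sub_inner_ne_zero (t := 0) (Or.inl hed₀)).mono fun nc h => by
      simpa using h)
  have hG : ∀ w ≠ 0, ∀ i, ∀ᵐ nc ∂μ i, G w nc ≠ 0 := by
    refine fun w hw i => (hac i).ae_le (ae_mul_sub_inner_ne_zero ?_)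
    by_contra! h
    have h₂ : (e w).2.2 = 0 := by
      simpa [inner_add_left, horth, inner_smul_left, hd₁] using congrArg (fun u => ⟪u, ed⟫) h.1
    have h₁ : (e w).1 = 0 := by simpa [h₂] using h.1
    exact hw (e.map_eq_zero_iff.1 (Prod.ext h₁ (Prod.ext h.2 h₂)))
  obtain ⟨w, hw, hT, hμ⟩ : ∃ w ≠ 0, 0 ≤ (e w).2.1 ∧ ∀ i,
      μ i {nc | 0 < ⟪(nc.1 : EuclideanSpace ℝ (Fin d)), ed⟫ * G w nc} =
        μ i {nc | ⟪(nc.1 : EuclideanSpace ℝ (Fin d)), ed⟫ * G w nc < 0} := by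
    have hneg : ∀ w nc, ⟪(nc.1 : EuclideanSpace ℝ (Fin d)), ed⟫ * G (-w) nc =
        -(⟪(nc.1 : EuclideanSpace ℝ (Fin d)), ed⟫ * G w nc) := fun w nc => by
      simp only [G, map_neg, Prod.fst_neg, Prod.snd_neg, Submodule.coe_neg, neg_smul,
        ← neg_add, inner_neg_right]
      ring
    obtain ⟨w, hw, h⟩ := exists_ne_zero_forall_measure_pos_eq_measure_neg (μ := μ)
      (Q := fun w nc => ⟪(nc.1 : EuclideanSpace ℝ (Fin d)), ed⟫ * G w nc)
      (fun w => by fun_prop) (fun nc => by fun_prop) hneg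
      (fun w hw i => by
        filter_upwards [hvert i, hG w hw i] with nc h₁ h₂ using mul_ne_zero h₁ h₂)
    rcases le_total 0 (e w).2.1 with hT | hT
    · exact ⟨w, hw, hT, h⟩
    · exact ⟨-w, neg_ne_zero.2 hw, by simpa using hT, fun i => by
        simpa [hneg] using (h i).symm⟩
  obtain ⟨v, hv⟩ : ∃ v : EuclideanSpace ℝ (Fin d), v = (e w).1 := ⟨_, rfl⟩
  obtain ⟨t, ht⟩ : ∃ t, t = (e w).2.1 := ⟨_, rfl⟩
  obtain ⟨h, hh⟩ : ∃ h, h = (e w).2.2 := ⟨_, rfl⟩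
  have hved : ⟪v, ed⟫ = 0 := hv ▸ horth w
  have hGw : ∀ nc, G w nc = t * nc.2 - ⟪(nc.1 : EuclideanSpace ℝ (Fin d)), v⟫ -
      h * ⟪(nc.1 : EuclideanSpace ℝ (Fin d)), ed⟫ := fun nc => by
    simp only [G, ← hv, ← ht, ← hh, inner_add_right, inner_smul_right]
    ring
  -- Conditions on the sign of a positive multiple of `G w nc / ⟪nc.1, ed⟫` have equal measures.
  have key : ∀ (q : Metric.sphere (0 : EuclideanSpace ℝ (Fin d)) 1 × ℝ → ℝ) (m s : ℝ), 0 < s →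
      (∀ nc, ⟪(nc.1 : EuclideanSpace ℝ (Fin d)), ed⟫ ≠ 0 →
        s * (q nc - m) * ⟪(nc.1 : EuclideanSpace ℝ (Fin d)), ed⟫ = G w nc) → ∀ i,
      μ i {nc | ⟪(nc.1 : EuclideanSpace ℝ (Fin d)), ed⟫ ≠ 0 ∧ q nc ≥ m} =
        μ i {nc | ⟪(nc.1 : EuclideanSpace ℝ (Fin d)), ed⟫ ≠ 0 ∧ q nc ≤ m} := by
    intro q m s hs hq i
    have hQ : ∀ᵐ nc ∂μ i, ⟪(nc.1 : EuclideanSpace ℝ (Fin d)), ed⟫ ≠ 0 ∧ q nc ≠ m ∧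
        ∃ r > 0, ⟪(nc.1 : EuclideanSpace ℝ (Fin d)), ed⟫ * G w nc = r * (q nc - m) := by
      filter_upwards [hvert i, hG w hw i] with nc h₁ h₂
      refine ⟨h₁, ?_, s * ⟪(nc.1 : EuclideanSpace ℝ (Fin d)), ed⟫ ^ 2, by positivity, ?_⟩
      · rintro h
        exact h₂ (by rw [← hq nc h₁, h]; ring)
      · rw [← hq nc h₁]
        ring
    calc _ = μ i {nc | 0 < ⟪(nc.1 : EuclideanSpace ℝ (Fin d)), ed⟫ * G w nc} := by
          refine measure_congr ?_
          filter_upwards [hQ] with nc ⟨h₁, h₂, r, hr, h₃⟩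
          apply propext
          change (_ ∧ m ≤ q nc) ↔ 0 < ⟪(nc.1 : EuclideanSpace ℝ (Fin d)), ed⟫ * G w nc
          rw [h₃, mul_pos_iff_of_pos_left hr, sub_pos, and_iff_right h₁]
          exact ⟨fun h => lt_of_le_of_ne h h₂.symm, le_of_lt⟩
      _ = μ i {nc | ⟪(nc.1 : EuclideanSpace ℝ (Fin d)), ed⟫ * G w nc < 0} := hμ i
      _ = _ := by
          refine measure_congr ?_
          filter_upwards [hQ] with nc ⟨h₁, h₂, r, hr, h₃⟩
          apply propext
          change ⟪(nc.1 : EuclideanSpace ℝ (Fin d)), ed⟫ * G w nc < 0 ↔ (_ ∧ q nc ≤ m)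
          rw [h₃, ← smul_eq_mul, smul_neg_iff_of_pos_left hr, sub_neg, and_iff_right h₁]
          exact ⟨le_of_lt, fun h => lt_of_le_of_ne h h₂⟩
  rcases (ht ▸ hT : 0 ≤ t).eq_or_lt with ht₀ | ht₀
  · left
    by_cases hv₀ : v = 0
    · have hh₀ : h ≠ 0 := by
        rintro rfl
        refine hw (e.map_eq_zero_iff.1 (Prod.ext (Subtype.ext ?_) (Prod.ext ?_ hh.symm)))
        · simp [← hv, hv₀]
        · exact (ht₀.trans ht).symm
      have hnull : ∀ i, μ i = 0 := fun i => by
        have hQ : ∀ nc, ⟪(nc.1 : EuclideanSpace ℝ (Fin d)), ed⟫ * G w nc =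
            -h * ⟪(nc.1 : EuclideanSpace ℝ (Fin d)), ed⟫ ^ 2 := fun nc => by
          rw [hGw, ← ht₀, hv₀, inner_zero_right]
          ring
        have hmem : ∀ᵐ nc ∂μ i,
            (0 < -h → 0 < ⟪(nc.1 : EuclideanSpace ℝ (Fin d)), ed⟫ * G w nc) ∧
            (-h < 0 → ⟪(nc.1 : EuclideanSpace ℝ (Fin d)), ed⟫ * G w nc < 0) := by
          filter_upwards [hvert i] with nc hnc
          rw [hQ]
          exact ⟨fun h => by positivity, fun h => mul_neg_of_neg_of_pos h (by positivity)⟩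
        have hempty :
            (0 < -h → μ i {nc | ⟪(nc.1 : EuclideanSpace ℝ (Fin d)), ed⟫ * G w nc < 0} = 0) ∧
            (-h < 0 → μ i {nc | 0 < ⟪(nc.1 : EuclideanSpace ℝ (Fin d)), ed⟫ * G w nc} = 0) := by
          constructor <;> intro h <;> refine measure_eq_zero_iff_ae_notMem.2 ?_ <;>
            filter_upwards [hmem] with nc hnc
          · exact (hnc.1 h).not_gt
          · exact (hnc.2 h).not_gt
        rw [← ae_eq_bot, ← Filter.eventually_false_iff_eq_bot]
        rcases (neg_ne_zero.2 hh₀).lt_or_gt with hlt | hlt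
        · filter_upwards [hmem, measure_eq_zero_iff_ae_notMem.1 ((hμ i).symm.trans (hempty.2 hlt))]
            with nc h₁ h₂ using h₂ (h₁.2 hlt)
        · filter_upwards [hmem, measure_eq_zero_iff_ae_notMem.1 ((hμ i).trans (hempty.1 hlt))]
            with nc h₁ h₂ using h₂ (h₁.1 hlt)
      exact ⟨EuclideanSpace.single ⟨0, by omega⟩ 1, by simp, by
        simp [hed, EuclideanSpace.inner_single_left]; omega, 0, by simp [hnull]⟩
    · have hpos : 0 < ‖v‖ := norm_pos_iff.2 hv₀
      refine ⟨‖v‖⁻¹ • v, by simp [norm_smul, hpos.ne'], by simp [inner_smul_left, hved],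
        h / ‖v‖, fun i => (key _ _ ‖v‖ hpos (fun nc hnc => ?_) i).symm⟩
      rw [hGw, ← ht₀, inner_smul_right]
      field_simp
      ring
  · right
    refine ⟨t⁻¹ • v, by simp [inner_smul_left, hved], h / t, key _ _ t ht₀ fun nc hnc => ?_⟩
    rw [hGw, inner_smul_right, inner_smul_left, hved]
    field_simp
    ring
end

section
/- Let n ≥ 1. Let f, g : S^n → S^n be continuous maps on the unit sphere S^n ⊂ ℝ^{n+1} such that f is even, i.e., f(−x) = f(x) for all x ∈ S^n, and g is odd, i.e., g(−x) = −g(x) for all x ∈ S^n. Then f and g are not homotopic. -/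
/-- Mod 2 chains on tuples of points of `V`, the empty tuple included. -/
abbrev TupleChain (V : Type*) := List V →₀ ZMod 2

namespace TupleChain

variable {V : Type*}

/-- The chains all of whose tuples satisfy `P`. -/
abbrev on (P : List V → Prop) : Submodule (ZMod 2) (TupleChain V) :=
  Finsupp.supported (ZMod 2) (ZMod 2) {l | P l}

theorem single_mem_on {P : List V → Prop} {l : List V} (h : P l) :
    Finsupp.single l (1 : ZMod 2) ∈ on P :=
  Finsupp.single_mem_supported _ _ h

section Linear

variable {M : Type*} [AddCommGroup M] [Module (ZMod 2) M]

theorem eq_of_on {P : List V → Prop} {f g : TupleChain V →ₗ[ZMod 2] M}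
    (h : ∀ l, P l → f (Finsupp.single l 1) = g (Finsupp.single l 1))
    {c : TupleChain V} (hc : c ∈ on P) : f c = g c := by
  rw [on, Finsupp.supported_eq_span_single] at hc
  refine LinearMap.eqOn_span ?_ hc
  rintro _ ⟨l, hl, rfl⟩
  exact h l hl

theorem eq_of_single {f g : TupleChain V →ₗ[ZMod 2] M}
    (h : ∀ l, f (Finsupp.single l 1) = g (Finsupp.single l 1)) (c : TupleChain V) :
    f c = g c :=
  eq_of_on (P := fun _ => True) (fun l _ => h l) (by simp [Finsupp.mem_supported])

theorem map_mem_of_on {P : List V → Prop} {f : TupleChain V →ₗ[ZMod 2] M}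
    {N : Submodule (ZMod 2) M} (h : ∀ l, P l → f (Finsupp.single l 1) ∈ N)
    {c : TupleChain V} (hc : c ∈ on P) : f c ∈ N := by
  rw [on, Finsupp.supported_eq_span_single] at hc
  have : Submodule.span (ZMod 2) ((fun i => Finsupp.single i (1 : ZMod 2)) '' {l | P l}) ≤
      N.comap f := by
    rw [Submodule.span_le]
    rintro _ ⟨l, hl, rfl⟩
    exact h l hl
  exact this hc

/-- The linear extension of a function on tuples. -/
noncomputable abbrev extend (φ : List V → M) : TupleChain V →ₗ[ZMod 2] M :=
  Finsupp.linearCombination (ZMod 2) φ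

theorem extend_single (φ : List V → M) (l : List V) :
    extend φ (Finsupp.single l 1) = φ l := by
  simp [extend]

end Linear

theorem on_mono {P Q : List V → Prop} (h : ∀ l, P l → Q l) : on P ≤ on Q :=
  Finsupp.supported_mono h

/-- The linear extension of `List.cons a`. -/
noncomputable def cons (a : V) : TupleChain V →ₗ[ZMod 2] TupleChain V :=
  Finsupp.lmapDomain _ _ (List.cons a)

@[simp] theorem cons_single (a : V) (l : List V) :
    cons a (Finsupp.single l 1) = Finsupp.single (a :: l) 1 := by
  simp [cons]

/-- The chain map induced by a map of points. -/
noncomputable def map {W : Type*} (f : V → W) : TupleChain V →ₗ[ZMod 2] TupleChain W :=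
  Finsupp.lmapDomain _ _ (List.map f)

@[simp] theorem map_single {W : Type*} (f : V → W) (l : List V) :
    map f (Finsupp.single l 1) = Finsupp.single (l.map f) 1 := by
  simp [map]

theorem map_cons {W : Type*} (f : V → W) (a : V) (c : TupleChain V) :
    map f (cons a c) = cons (f a) (map f c) :=
  eq_of_single (f := map f ∘ₗ cons a) (g := cons (f a) ∘ₗ map f) (fun l => by simp) c

theorem map_map_self {f : V → V} (hf : Function.Involutive f) (c : TupleChain V) :
    map f (map f c) = c :=
  eq_of_single (f := map f ∘ₗ map f) (g := LinearMap.id)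
    (fun l => by simp [hf.comp_self]) c

theorem cons_mem_on {P Q : List V → Prop} {a : V} (h : ∀ l, P l → Q (a :: l))
    {c : TupleChain V} (hc : c ∈ on P) : cons a c ∈ on Q :=
  map_mem_of_on (fun l hl => by rw [cons_single]; exact single_mem_on (h l hl)) hc

theorem map_mem_on {W : Type*} {P : List V → Prop} {Q : List W → Prop} {f : V → W}
    (h : ∀ l, P l → Q (l.map f)) {c : TupleChain V} (hc : c ∈ on P) : map f c ∈ on Q :=
  map_mem_of_on (fun l hl => by rw [map_single]; exact single_mem_on (h l hl)) hc

/-- The sum of the faces of a tuple. -/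
noncomputable def faces : List V → TupleChain V
  | [] => 0
  | a :: l => Finsupp.single l 1 + cons a (faces l)

/-- The augmented simplicial boundary. -/
noncomputable def boundary : TupleChain V →ₗ[ZMod 2] TupleChain V := extend faces

@[simp] theorem boundary_single (l : List V) : boundary (Finsupp.single l 1) = faces l :=
  extend_single _ _

theorem boundary_cons (a : V) (c : TupleChain V) :
    boundary (cons a c) = c + cons a (boundary c) :=
  eq_of_single (f := boundary ∘ₗ cons a) (g := LinearMap.id + cons a ∘ₗ boundary)
    (fun l => by simp [faces]) c

theorem boundary_faces (l : List V) : boundary (faces l) = 0 := by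
  induction l with
  | nil => simp [faces]
  | cons a l ih => simp [faces, boundary_cons, ih, ZModModule.add_self]

theorem boundary_map {W : Type*} (f : V → W) (c : TupleChain V) :
    boundary (map f c) = map f (boundary c) := by
  refine eq_of_single (f := boundary ∘ₗ map f) (g := map f ∘ₗ boundary) (fun l => ?_) c
  induction l with
  | nil => simp [faces]
  | cons a l ih =>
    simp only [LinearMap.comp_apply, map_single, boundary_single] at ih
    simp [faces, map_cons, ih]

theorem faces_mem_on (l : List V) :
    faces l ∈ on (fun l' => l'.length + 1 = l.length ∧ ∀ x ∈ l', x ∈ l) := by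
  induction l with
  | nil => exact zero_mem _
  | cons a l ih =>
    refine add_mem (single_mem_on ⟨by simp, fun x hx => by simp [hx]⟩) (cons_mem_on ?_ ih)
    rintro l' ⟨h₁, h₂⟩
    refine ⟨by simp [h₁], fun x hx => ?_⟩
    rcases List.mem_cons.1 hx with rfl | hx
    · simp
    · simp [h₂ x hx]

/-! ### Prisms -/

/-- The prism over a tuple, joining it to its image under `f`. -/
noncomputable def prismTuple (f : V → V) : List V → TupleChain V
  | [] => 0
  | a :: l => Finsupp.single (a :: f a :: l.map f) 1 + cons a (prismTuple f l)

/-- The prism operator: a chain homotopy from the identity to `map f`. -/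
noncomputable def prism (f : V → V) : TupleChain V →ₗ[ZMod 2] TupleChain V :=
  extend (prismTuple f)

@[simp] theorem prism_single (f : V → V) (l : List V) :
    prism f (Finsupp.single l 1) = prismTuple f l :=
  extend_single _ _

theorem prism_cons (f : V → V) (a : V) (c : TupleChain V) :
    prism f (cons a c) = cons a (cons (f a) (map f c)) + cons a (prism f c) :=
  eq_of_single (f := prism f ∘ₗ cons a)
    (g := cons a ∘ₗ cons (f a) ∘ₗ map f + cons a ∘ₗ prism f)
    (fun l => by simp [prismTuple]) c

theorem faces_map {W : Type*} (f : V → W) (l : List V) :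
    faces (l.map f) = map f (faces l) := by
  simpa using boundary_map f (Finsupp.single l 1)

theorem boundary_prism (f : V → V) (c : TupleChain V) :
    boundary (prism f c) = c + map f c + prism f (boundary c) := by
  refine eq_of_single (f := boundary ∘ₗ prism f)
    (g := LinearMap.id + map f + prism f ∘ₗ boundary) (fun l => ?_) c
  induction l with
  | nil => simp [prismTuple, faces, ZModModule.add_self]
  | cons a l ih =>
    simp only [LinearMap.comp_apply, LinearMap.add_apply, LinearMap.id_apply, prism_single,
      boundary_single, map_single] at ih ⊢
    simp only [prismTuple, faces, map_add, boundary_single, boundary_cons, ih, prism_single,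
      prism_cons, faces_map, cons_single, List.map_cons]
    have e := ZModModule.add_self (Finsupp.single (a :: List.map f l) (1 : ZMod 2))
    linear_combination (norm := module) e

theorem prismTuple_mem_on (f : V → V) (l : List V) :
    prismTuple f l ∈ on (fun l' => l'.length = l.length + 1 ∧
      ∀ x ∈ l', ∃ y ∈ l, x = y ∨ x = f y) := by
  induction l with
  | nil => exact zero_mem _
  | cons a l ih =>
    refine add_mem (single_mem_on ⟨by simp, fun x hx => ?_⟩) (cons_mem_on ?_ ih)
    · simp only [List.mem_cons, List.mem_map] at hx ⊢
      rcases hx with rfl | rfl | ⟨y, hy, rfl⟩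
      · exact ⟨x, by simp⟩
      · exact ⟨a, by simp⟩
      · exact ⟨y, by simp [hy]⟩
    · rintro l' ⟨h₁, h₂⟩
      refine ⟨by simp [h₁], fun x hx => ?_⟩
      rcases List.mem_cons.1 hx with rfl | hx
      · exact ⟨x, by simp⟩
      · obtain ⟨y, hy, h⟩ := h₂ x hx
        exact ⟨y, by simp [hy], h⟩

/-! ### Sign cochains -/

/-- The cochain `δs_i ⌣ δs_{i+1} ⌣ ⋯ ⌣ s_k`, with value `1` on the empty tuple. -/
def alt (s : ℕ → V → ZMod 2) : ℕ → List V → ZMod 2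
  | _, [] => 1
  | i, [x] => s i x
  | i, x :: y :: l => (s i x + s i y) * alt s (i + 1) (y :: l)

/-- The cochain `δs_i ⌣ δs_{i+1} ⌣ ⋯ ⌣ δs_{k-1}`. -/
def cupDelta (s : ℕ → V → ZMod 2) : ℕ → List V → ZMod 2
  | _, [] => 0
  | _, [_] => 1
  | i, x :: y :: l => (s i x + s i y) * cupDelta s (i + 1) (y :: l)

theorem extend_alt_cons_cons (s : ℕ → V → ZMod 2) (i : ℕ) (x y : V) (c : TupleChain V) :
    extend (alt s i) (cons x (cons y c)) =
      (s i x + s i y) * extend (alt s (i + 1)) (cons y c) :=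
  eq_of_single (f := extend (alt s i) ∘ₗ cons x ∘ₗ cons y)
    (g := (s i x + s i y) • (extend (alt s (i + 1)) ∘ₗ cons y))
    (fun l => by simp [alt]) c

theorem extend_alt_faces (s : ℕ → V → ZMod 2) (i : ℕ) (l : List V) :
    extend (alt s i) (faces l) = cupDelta s i l := by
  induction l generalizing i with
  | nil => simp [faces, cupDelta]
  | cons x l ih =>
    cases l with
    | nil => simp [faces, cupDelta, alt]
    | cons y l =>
      have h := ih (i + 1)
      simp only [faces, map_add, extend_single] at h
      simp only [faces, map_add, extend_single, cons_single, extend_alt_cons_cons, cupDelta, ← h]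
      have key : alt s i (y :: l) + alt s i (x :: l) =
          (s i x + s i y) * alt s (i + 1) l := by
        cases l with
        | nil => simp [alt, add_comm]
        | cons z l =>
          simp only [alt]
          generalize alt s (i + 1) (z :: l) = p
          generalize s i x = a
          generalize s i y = b
          generalize s i z = c
          revert a b c p
          decide
      linear_combination key

theorem extend_alt_boundary (s : ℕ → V → ZMod 2) (i : ℕ) (c : TupleChain V) :
    extend (alt s i) (boundary c) = extend (cupDelta s i) c :=
  eq_of_single (f := extend (alt s i) ∘ₗ boundary) (g := extend (cupDelta s i))
    (fun l => by simp [-Finsupp.linearCombination_single, extend_single, extend_alt_faces]) c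

theorem alt_add_alt_map {s : ℕ → V → ZMod 2} {τ : V → V} (i : ℕ) (l : List V)
    (h : ∀ x ∈ l, ∀ j, s j (τ x) = s j x + 1) :
    alt s i l + alt s i (l.map τ) = cupDelta s i l := by
  induction l generalizing i with
  | nil => simp only [alt, cupDelta, List.map_nil]; decide
  | cons x l ih =>
    cases l with
    | nil =>
      simp only [alt, cupDelta, List.map, h x (by simp)]
      generalize s i x = a
      revert a
      decide
    | cons y l =>
      have ih' := ih (i + 1) fun z hz => h z (by simp [hz])
      simp only [alt, cupDelta, List.map_cons, ← ih', h x (by simp), h y (by simp)]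
      generalize alt s (i + 1) (y :: l) = p
      generalize alt s (i + 1) (τ y :: l.map τ) = q
      generalize s i x = a
      generalize s i y = b
      revert a b p q
      decide

theorem alt_map_of_invariant {s : ℕ → V → ZMod 2} {τ : V → V} (i : ℕ) (l : List V)
    (h : ∀ x ∈ l, ∀ j, s j (τ x) = s j x) :
    alt s i (l.map τ) = alt s i l := by
  induction l generalizing i with
  | nil => simp
  | cons x l ih =>
    cases l with
    | nil => simp [alt, h x]
    | cons y l =>
      have ih' := ih (i + 1) fun z hz => h z (by simp [hz])
      simp only [List.map_cons] at ih'
      simp only [alt, List.map_cons, ih', h x (by simp), h y (by simp)]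

theorem cupDelta_eq_zero {s : ℕ → V → ZMod 2} {j : ℕ} (i : ℕ) (l : List V)
    (hl : j + 2 ≤ l.length) (h : ∀ x ∈ l, ∀ y ∈ l, s (i + j) x = s (i + j) y) :
    cupDelta s i l = 0 := by
  induction l generalizing i j with
  | nil => simp at hl
  | cons x l ih =>
    cases l with
    | nil => simp at hl
    | cons y l =>
      cases j with
      | zero =>
        have hxy : s i x = s i y := h x (by simp) y (by simp)
        simp [cupDelta, hxy, CharTwo.add_self_eq_zero]
      | succ j =>
        rw [cupDelta, ih (j := j) (i + 1) (by simpa using hl), mul_zero]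
        intro z hz w hw
        have := h z (by simp [hz]) w (by simp [hw])
        rwa [show i + 1 + j = i + (j + 1) by ring]

/-! ### Hemispheres -/

/-- The iterated equivariant cones `h₀ = [e₀]`, `h_{k+1} = e_{k+1} * (h_k + τ h_k)`. -/
noncomputable def hemi (e : ℕ → V) (τ : V → V) : ℕ → TupleChain V
  | 0 => Finsupp.single [e 0] 1
  | k + 1 => cons (e (k + 1)) (hemi e τ k + map τ (hemi e τ k))

theorem boundary_hemi_zero (e : ℕ → V) (τ : V → V) :
    boundary (hemi e τ 0) = Finsupp.single [] 1 := by
  simp [hemi, faces]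

theorem boundary_hemi_add {e : ℕ → V} {τ : V → V} (hτ : Function.Involutive τ) (k : ℕ) :
    boundary (hemi e τ k + map τ (hemi e τ k)) = 0 := by
  rw [map_add, boundary_map]
  induction k with
  | zero => simp [boundary_hemi_zero, ZModModule.add_self]
  | succ k ih =>
    have h : boundary (hemi e τ (k + 1)) = hemi e τ k + map τ (hemi e τ k) := by
      rw [hemi, boundary_cons, map_add boundary, boundary_map, ih, map_zero, add_zero]
    rw [h, map_add, map_map_self hτ, add_comm (map τ _), ZModModule.add_self]

theorem boundary_hemi_succ {e : ℕ → V} {τ : V → V} (hτ : Function.Involutive τ) (k : ℕ) :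
    boundary (hemi e τ (k + 1)) = hemi e τ k + map τ (hemi e τ k) := by
  rw [hemi, boundary_cons, boundary_hemi_add hτ, map_zero, add_zero]

/-! ### Barycentric subdivision -/

section Module

variable [AddCommGroup V] [Module ℝ V]

/-- The barycenter of a tuple. -/
noncomputable def bary (l : List V) : V := (l.length : ℝ)⁻¹ • l.sum

theorem bary_map {f : V → V} (hf : IsLinearMap ℝ f) (l : List V) :
    bary (l.map f) = f (bary l) := by
  have h : f l.sum = (l.map f).sum := map_list_sum (hf.mk' f) l
  rw [bary, bary, hf.map_smul, h, List.length_map]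

theorem bary_mem {A : Set V} (hA : Convex ℝ A) {l : List V} (hl : l ≠ [])
    (h : ∀ x ∈ l, x ∈ A) : bary l ∈ A := by
  have hpos : (0 : ℝ) < l.length := by exact_mod_cast List.length_pos_iff.2 hl
  have : bary l = ∑ i : Fin l.length, (l.length : ℝ)⁻¹ • l[i] := by
    rw [← Finset.smul_sum, bary]
    congr 1
    exact (Fin.sum_univ_getElem l).symm
  rw [this]
  refine hA.sum_mem (fun _ _ => by positivity) ?_ (fun i _ => h _ (List.getElem_mem _))
  simp [hpos.ne']

/-- Barycentric subdivision of chains of `k`-tuples. -/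
noncomputable def sd : ℕ → TupleChain V →ₗ[ZMod 2] TupleChain V
  | 0 => LinearMap.id
  | k + 1 => extend fun l => cons (bary l) (sd k (faces l))

theorem sd_zero : (sd 0 : TupleChain V →ₗ[ZMod 2] TupleChain V) = LinearMap.id := rfl

theorem sd_succ_single (k : ℕ) (l : List V) :
    sd (k + 1) (Finsupp.single l 1) = cons (bary l) (sd k (faces l)) :=
  extend_single _ _

theorem sd_map {f : V → V} (hf : IsLinearMap ℝ f) (k : ℕ) (c : TupleChain V) :
    sd k (map f c) = map f (sd k c) := by
  induction k generalizing c with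
  | zero => rfl
  | succ k ih =>
    refine eq_of_single (f := sd (k + 1) ∘ₗ map f) (g := map f ∘ₗ sd (k + 1)) (fun l => ?_) c
    simp only [LinearMap.comp_apply, map_single, sd_succ_single, map_cons, bary_map hf, faces_map, ih]

theorem boundary_sd (k : ℕ) {c : TupleChain V}
    (hc : c ∈ on fun l : List V => l.length = k + 1) :
    boundary (sd (k + 1) c) = sd k (boundary c) := by
  induction k generalizing c with
  | zero =>
    have h (l : List V) : boundary (sd (0 + 1) (Finsupp.single l 1)) = faces l := by
      rw [sd_succ_single, boundary_cons, sd_zero, LinearMap.id_apply, boundary_faces, map_zero,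
        add_zero]
    rw [sd_zero, LinearMap.id_apply]
    generalize (sd (0 + 1) : TupleChain V →ₗ[ZMod 2] TupleChain V) = T at h
    exact eq_of_single (f := boundary ∘ₗ T) (g := boundary) (fun l => by simp [h]) c
  | succ k ih =>
    have h (l : List V) (hl : l.length = k + 1 + 1) :
        boundary (sd (k + 1 + 1) (Finsupp.single l 1)) = sd (k + 1) (faces l) := by
      have hf : faces l ∈ on fun l' : List V => l'.length = k + 1 :=
        on_mono (fun l' h => by have := h.1; omega) (faces_mem_on l)
      rw [sd_succ_single, boundary_cons, ih hf, boundary_faces, map_zero, map_zero, add_zero]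
    generalize (sd (k + 1 + 1) : TupleChain V →ₗ[ZMod 2] TupleChain V) = T at h ⊢
    generalize (sd (k + 1) : TupleChain V →ₗ[ZMod 2] TupleChain V) = U at h ⊢
    exact eq_of_on (f := boundary ∘ₗ T) (g := U ∘ₗ boundary)
      (fun l hl => by simp [h l hl]) hc

theorem sd_mem_on {A : Set V} (hA : Convex ℝ A) (k : ℕ) {c : TupleChain V}
    (hc : c ∈ on fun l => l.length = k ∧ ∀ x ∈ l, x ∈ A) :
    sd k c ∈ on fun l => l.length = k ∧ ∀ x ∈ l, x ∈ A := by
  induction k generalizing c with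
  | zero => exact hc
  | succ k ih =>
    refine map_mem_of_on (fun l hl => ?_) hc
    rw [sd_succ_single]
    have hf : faces l ∈ on fun l' => l'.length = k ∧ ∀ x ∈ l', x ∈ A :=
      on_mono (fun l' h => ⟨by have := h.1; omega, fun x hx => hl.2 x (h.2 x hx)⟩) (faces_mem_on l)
    refine cons_mem_on (fun l' hl' => ⟨by simp [hl'.1], ?_⟩) (ih hf)
    have hl0 : l ≠ [] := by rintro rfl; simp at hl
    simpa using ⟨bary_mem hA hl0 hl.2, hl'.2⟩

theorem sd_iterate_mem_on {ι : Type*} {A : ι → Set V} (hA : ∀ i, Convex ℝ (A i)) (k N : ℕ)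
    {c : TupleChain V} (hc : c ∈ on fun l => l.length = k ∧ ∃ i, ∀ x ∈ l, x ∈ A i) :
    (sd k)^[N] c ∈ on fun l => l.length = k ∧ ∃ i, ∀ x ∈ l, x ∈ A i := by
  induction N with
  | zero => exact hc
  | succ N ih =>
    rw [Function.iterate_succ_apply']
    refine map_mem_of_on (fun l hl => ?_) ih
    obtain ⟨h, i, hi⟩ := hl
    exact on_mono (fun l' h' => ⟨h'.1, i, h'.2⟩) (sd_mem_on (hA i) k (single_mem_on ⟨h, hi⟩))

theorem sd_iterate_map {f : V → V} (hf : IsLinearMap ℝ f) (k N : ℕ) (c : TupleChain V) :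
    (sd k)^[N] (map f c) = map f ((sd k)^[N] c) := by
  induction N with
  | zero => rfl
  | succ N ih => simp only [Function.iterate_succ_apply', ih, sd_map hf]

theorem sd_zero_iterate (N : ℕ) (c : TupleChain V) : (sd 0)^[N] c = c :=
  Function.iterate_fixed rfl N

theorem sd_iterate_add (k N : ℕ) (c d : TupleChain V) :
    (sd k)^[N] (c + d) = (sd k)^[N] c + (sd k)^[N] d := by
  induction N with
  | zero => rfl
  | succ N ih => simp only [Function.iterate_succ_apply', ih, map_add]

theorem boundary_sd_iterate (k N : ℕ) {c : TupleChain V}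
    (hc : c ∈ on fun l : List V => l.length = k + 1) :
    boundary ((sd (k + 1))^[N] c) = (sd k)^[N] (boundary c) := by
  induction N with
  | zero => rfl
  | succ N ih =>
    have h := sd_iterate_mem_on (A := fun _ : Unit => Set.univ) (fun _ => convex_univ) (k + 1) N
      (c := c) (by simpa using hc)
    simp only [Set.mem_univ, implies_true, exists_const, and_true] at h
    rw [Function.iterate_succ_apply', Function.iterate_succ_apply', boundary_sd k h, ih]

end Module

section Mesh

variable [NormedAddCommGroup V] [NormedSpace ℝ V]

theorem norm_list_sum_sub_le {D : ℝ} (v : V) (l : List V) (h : ∀ x ∈ l, dist x v ≤ D) :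
    ‖l.sum - (l.length : ℝ) • v‖ ≤ l.length * D := by
  induction l with
  | nil => simp
  | cons x l ih =>
    have h₁ := ih fun y hy => h y (by simp [hy])
    have h₂ := h x (by simp)
    rw [dist_eq_norm] at h₂
    have e : (x :: l).sum - ((x :: l).length : ℝ) • v =
        (x - v) + (l.sum - (l.length : ℝ) • v) := by
      simp only [List.sum_cons, List.length_cons, Nat.cast_add, Nat.cast_one]
      module
    rw [e]
    refine (norm_add_le _ _).trans ?_
    push_cast [List.length_cons]
    linarith

theorem dist_bary_le {D : ℝ} {M : ℕ} {l : List V} (hM : l.length ≤ M)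
    (h : ∀ x ∈ l, ∀ y ∈ l, dist x y ≤ D) {v : V} (hv : v ∈ l) :
    dist v (bary l) ≤ (1 - (M : ℝ)⁻¹) * D := by
  obtain ⟨l₁, l₂, rfl⟩ := List.append_of_mem hv
  have hD : 0 ≤ D := dist_nonneg.trans (h v hv v hv)
  have key := norm_list_sum_sub_le (D := D) v (l₁ ++ l₂) fun x hx =>
    h x (by simp only [List.mem_append, List.mem_cons] at hx ⊢; tauto) v hv
  set p : ℝ := ((l₁ ++ l₂).length : ℝ) with hp
  have hp0 : 0 ≤ p := by positivity
  have hlen : ((l₁ ++ v :: l₂).length : ℝ) = p + 1 := by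
    simp [hp]; ring
  have hpM : p + 1 ≤ M := by rw [← hlen]; exact_mod_cast hM
  have e : bary (l₁ ++ v :: l₂) - v = (p + 1)⁻¹ • ((l₁ ++ l₂).sum - p • v) := by
    have hs : (l₁ ++ v :: l₂).sum = (l₁ ++ l₂).sum + v := by
      simp only [List.sum_append, List.sum_cons]; abel
    rw [bary, hlen, hs]
    have : (p + 1) ≠ 0 := by positivity
    have h1 : v = (p + 1)⁻¹ • ((p + 1) • v) := by rw [smul_smul, inv_mul_cancel₀ this, one_smul]
    nth_rewrite 2 [h1]
    rw [← smul_sub]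
    congr 1
    module
  rw [dist_comm, dist_eq_norm, e, norm_smul, Real.norm_of_nonneg (by positivity)]
  calc (p + 1)⁻¹ * ‖(l₁ ++ l₂).sum - p • v‖ ≤ (p + 1)⁻¹ * (p * D) := by gcongr
    _ = (1 - (p + 1)⁻¹) * D := by field_simp; ring
    _ ≤ (1 - (M : ℝ)⁻¹) * D := by gcongr

theorem sd_mem_on_dist {D : ℝ} {M : ℕ} {A : Set V} (hA : Convex ℝ A) {k : ℕ} (hk : k ≤ M)
    {c : TupleChain V}
    (hc : c ∈ on fun l => l.length = k ∧ (∀ x ∈ l, x ∈ A) ∧ ∀ x ∈ l, ∀ y ∈ l, dist x y ≤ D) :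
    sd k c ∈ on fun l => l.length = k ∧ (∀ x ∈ l, x ∈ A) ∧
      ∀ x ∈ l, ∀ y ∈ l, dist x y ≤ (1 - (M : ℝ)⁻¹) * D := by
  induction k generalizing c A with
  | zero =>
    refine on_mono (fun l hl => ?_) hc
    simp [List.length_eq_zero_iff.1 hl.1]
  | succ k ih =>
    refine map_mem_of_on (fun l ⟨hl, hlA, hlD⟩ => ?_) hc
    rw [sd_succ_single]
    have hl0 : l ≠ [] := by rintro rfl; simp at hl
    let B : Set V := A ∩ Metric.closedBall (bary l) ((1 - (M : ℝ)⁻¹) * D)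
    have hB : Convex ℝ B := hA.inter (convex_closedBall _ _)
    have hlB : ∀ x ∈ l, x ∈ B := fun x hx =>
      ⟨hlA x hx, dist_bary_le (hl.trans_le hk) hlD hx⟩
    have hf : faces l ∈ on fun l' => l'.length = k ∧ (∀ x ∈ l', x ∈ B) ∧
        ∀ x ∈ l', ∀ y ∈ l', dist x y ≤ D :=
      on_mono (fun l' h => ⟨by have := h.1; omega, fun x hx => hlB x (h.2 x hx),
        fun x hx y hy => hlD x (h.2 x hx) y (h.2 y hy)⟩) (faces_mem_on l)
    refine cons_mem_on (fun l' ⟨h₁, h₂, h₃⟩ => ⟨by simp [h₁], ?_, ?_⟩) (ih hB (by omega) hf)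
    · simpa using ⟨bary_mem hA hl0 hlA, fun x hx => (h₂ x hx).1⟩
    · have hb : dist (bary l) (bary l) ≤ (1 - (M : ℝ)⁻¹) * D := by
        rw [dist_self]
        obtain ⟨x, hx⟩ := List.exists_mem_of_ne_nil l hl0
        exact dist_nonneg.trans (hlB x hx).2
      intro x hx y hy
      rcases List.mem_cons.1 hx with rfl | hx <;> rcases List.mem_cons.1 hy with rfl | hy
      · exact hb
      · rw [dist_comm]; exact (h₂ y hy).2
      · exact (h₂ x hx).2
      · exact h₃ x hx y hy

theorem sd_iterate_mem_on_dist {D : ℝ} {ι : Type*} {A : ι → Set V} (hA : ∀ i, Convex ℝ (A i))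
    (k N : ℕ) {c : TupleChain V}
    (hc : c ∈ on fun l => l.length = k ∧ ∃ i, (∀ x ∈ l, x ∈ A i) ∧
      ∀ x ∈ l, ∀ y ∈ l, dist x y ≤ D) :
    (sd k)^[N] c ∈ on fun l => l.length = k ∧ ∃ i, (∀ x ∈ l, x ∈ A i) ∧
      ∀ x ∈ l, ∀ y ∈ l, dist x y ≤ (1 - (k : ℝ)⁻¹) ^ N * D := by
  induction N with
  | zero => simpa using hc
  | succ N ih =>
    rw [Function.iterate_succ_apply']
    refine map_mem_of_on (fun l ⟨h, i, hi, hD⟩ => ?_) ih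
    refine on_mono (fun l' h' => ⟨h'.1, i, h'.2.1, ?_⟩)
      (sd_mem_on_dist (hA i) le_rfl (single_mem_on ⟨h, hi, hD⟩))
    simpa only [pow_succ', mul_assoc] using h'.2.2

end Mesh

end TupleChain

open TupleChain

section Sphere

variable {n : ℕ}

local notation "𝔼" => EuclideanSpace ℝ (Fin (n + 1))

/-- The sign of the `i`-th coordinate, as an element of `ZMod 2`; when this coordinate vanishes,
the lexicographic sign of the vector. -/
noncomputable def coordSign (i : ℕ) (y : EuclideanSpace ℝ (Fin (n + 1))) : ZMod 2 :=
  open Classical in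
  if 0 < y (Fin.ofNat (n + 1) i) ∨
    (y (Fin.ofNat (n + 1) i) = 0 ∧ 0 < toLex (fun j => y j)) then 1 else 0

open Classical in
theorem coordSign_neg (i : ℕ) {y : 𝔼} (hy : y ≠ 0) : coordSign i (-y) = coordSign i y + 1 := by
  have h0 : toLex (fun j => y j) ≠ 0 := fun h => hy (by ext j; exact congrFun h j)
  have h11 : (0 : ZMod 2) = 1 + 1 := by decide
  have key (a : ℝ) (b : Lex (Fin (n + 1) → ℝ)) (hb : b ≠ 0) :
      (if 0 < -a ∨ (-a = 0 ∧ 0 < -b) then (1 : ZMod 2) else 0) =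
        (if 0 < a ∨ (a = 0 ∧ 0 < b) then 1 else 0) + 1 := by
    rcases lt_trichotomy a 0 with h | rfl | h
    · simp [h, h.not_gt, h.ne]
    · rcases lt_or_gt_of_ne hb with h' | h'
      · have h₁ : b < 0 := h'
        have h₂ : ¬ 0 < b := fun h => lt_asymm h' h
        simp [h₁, h₂]
      · have h₁ : 0 < b := h'
        have h₂ : ¬ b < 0 := fun h => lt_asymm h' h
        simp [h₁, h₂, ← h11]
    · simp [h, h.not_gt, h.ne', ← h11]
  exact key _ _ h0

theorem coordSign_eq_of_abs_sub_lt {i : ℕ} {y z : 𝔼}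
    (h : |z (Fin.ofNat (n + 1) i) - y (Fin.ofNat (n + 1) i)| < |y (Fin.ofNat (n + 1) i)|) :
    coordSign i z = coordSign i y := by
  unfold coordSign
  generalize z (Fin.ofNat (n + 1) i) = a at *
  generalize y (Fin.ofNat (n + 1) i) = b at *
  rw [abs_lt] at h
  rcases lt_trichotomy b 0 with hb | rfl | hb
  · rw [abs_of_neg hb] at h
    have ha : a < 0 := by linarith
    simp [ha.not_gt, ha.ne, hb.not_gt, hb.ne]
  · simp at h; linarith
  · rw [abs_of_pos hb] at h
    have ha : 0 < a := by linarith
    simp [ha, hb]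

theorem exists_le_abs_coord {y : 𝔼} (hy : ‖y‖ = 1) : ∃ i, ((n : ℝ) + 1)⁻¹ ≤ |y i| := by
  by_contra! h
  have h₁ : ‖y‖ ≤ ∑ i, |y i| := by
    have e : y = ∑ i, EuclideanSpace.single i (y i) := by
      ext j; simp [Pi.single_apply]
    calc ‖y‖ = ‖∑ i, EuclideanSpace.single i (y i)‖ := by rw [← e]
      _ ≤ ∑ i, ‖EuclideanSpace.single i (y i)‖ := norm_sum_le _ _
      _ = ∑ i, |y i| := by simp
  have h₂ : ∑ i, |y i| < ∑ _i : Fin (n + 1), ((n : ℝ) + 1)⁻¹ :=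
    Finset.sum_lt_sum_of_nonempty Finset.univ_nonempty fun i _ => h i
  have h₃ : ∑ _i : Fin (n + 1), ((n : ℝ) + 1)⁻¹ = 1 := by
    simp [mul_inv_cancel₀ (show ((n : ℝ) + 1) ≠ 0 by positivity)]
  linarith

/-- The part of the half space `a ≤ ∑ i, s i * x i` inside the ball of radius `b`. -/
def cap (a b : ℝ) (s : Fin (n + 1) → ℝ) : Set (EuclideanSpace ℝ (Fin (n + 1))) :=
  {x | a ≤ ∑ i, s i * x i} ∩ Metric.closedBall 0 b

theorem convex_cap (a b : ℝ) (s : Fin (n + 1) → ℝ) : Convex ℝ (cap a b s) := by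
  refine Convex.inter (convex_halfSpace_ge ⟨fun x y => ?_, fun c x => ?_⟩ a)
    (convex_closedBall _ _)
  · simp [mul_add, Finset.sum_add_distrib]
  · simp [Finset.mul_sum, mul_left_comm]

theorem le_norm_of_mem_cap {a b : ℝ} {s : Fin (n + 1) → ℝ} (hs : ∀ i, |s i| = 1) {x : 𝔼}
    (hx : x ∈ cap a b s) : a ≤ (n + 1) * ‖x‖ := by
  calc a ≤ ∑ i, s i * x i := hx.1
    _ ≤ ∑ _i : Fin (n + 1), ‖x‖ := Finset.sum_le_sum fun i _ => by
        refine (le_abs_self _).trans ?_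
        rw [abs_mul, hs, one_mul]
        exact PiLp.norm_apply_le x i
    _ = (n + 1) * ‖x‖ := by simp

theorem smul_mem_cap {R a b : ℝ} (hR : 0 ≤ R) {s : Fin (n + 1) → ℝ} {x : 𝔼}
    (hx : x ∈ cap a b s) : R • x ∈ cap (R * a) (R * b) s := by
  obtain ⟨h₁, h₂⟩ := hx
  refine ⟨?_, ?_⟩
  · have : ∑ i, s i * (R • x) i = R * ∑ i, s i * x i := by
      simp [Finset.mul_sum, mul_left_comm]
    simp only [Set.mem_ofPred_eq, this] at h₁ ⊢
    gcongr
  · simp only [mem_closedBall_zero_iff, norm_smul, Real.norm_of_nonneg hR] at h₂ ⊢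
    gcongr

theorem cap_subset_cap {a b a' b' : ℝ} (ha : a' ≤ a) (hb : b ≤ b') (s : Fin (n + 1) → ℝ) :
    cap a b s ⊆ cap a' b' s :=
  Set.inter_subset_inter (fun _ hx => ha.trans hx) (Metric.closedBall_subset_closedBall hb)

theorem neg_mem_cap {a b : ℝ} {s : Fin (n + 1) → ℝ} {x : 𝔼} (hx : x ∈ cap a b s) :
    -x ∈ cap a b (-s) := by
  simpa [cap] using hx

/-- Sign vectors. -/
abbrev SignVector (n : ℕ) : Type := {s : Fin (n + 1) → ℝ // ∀ i, |s i| = 1}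

/-- The hemispheres of the boundary of the cross-polytope. -/
noncomputable abbrev crossHemi (n k : ℕ) : TupleChain (EuclideanSpace ℝ (Fin (n + 1))) :=
  hemi (fun i => EuclideanSpace.single (Fin.ofNat (n + 1) i) (1 : ℝ)) (fun x => -x) k

theorem crossHemi_mem_on_vertices {k : ℕ} (hk : k ≤ n) :
    crossHemi n k ∈ on fun l => l.length = k + 1 ∧ ∃ s : SignVector n, ∀ x ∈ l,
      ∃ i : Fin (n + 1), i.val ≤ k ∧ x = EuclideanSpace.single i (s.1 i) := by
  induction k with
  | zero =>
    refine single_mem_on ⟨rfl, ⟨fun _ => 1, by simp⟩, fun x hx => ⟨0, le_rfl, ?_⟩⟩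
    simpa using hx
  | succ k ih =>
    have ih := ih (by omega)
    have hneg : map (fun x => -x) (crossHemi n k) ∈ on fun l => l.length = k + 1 ∧
        ∃ s : SignVector n, ∀ x ∈ l,
          ∃ i : Fin (n + 1), i.val ≤ k ∧ x = EuclideanSpace.single i (s.1 i) := by
      refine map_mem_on ?_ ih
      rintro l ⟨hl, s, hs⟩
      refine ⟨by simpa using hl, ⟨-s.1, by simp [s.2]⟩, ?_⟩
      simp only [List.mem_map, forall_exists_index, and_imp, forall_apply_eq_imp_iff₂]
      intro x hx
      obtain ⟨i, hi, rfl⟩ := hs x hx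
      exact ⟨i, hi, by ext j; by_cases h : j = i <;> simp [h]⟩
    refine cons_mem_on ?_ (add_mem ih hneg)
    rintro l ⟨hl, s, hs⟩
    have hval : (Fin.ofNat (n + 1) (k + 1)).val = k + 1 := Nat.mod_eq_of_lt (by omega)
    refine ⟨by simp [hl], ⟨Function.update s.1 (Fin.ofNat (n + 1) (k + 1)) 1, fun i => ?_⟩, ?_⟩
    · by_cases h : i = Fin.ofNat (n + 1) (k + 1)
      · rw [h, Function.update_self, abs_one]
      · rw [Function.update_of_ne h, s.2]
    · intro x hx
      rcases List.mem_cons.1 hx with rfl | hx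
      · exact ⟨_, hval.le, by simp⟩
      · obtain ⟨i, hi, rfl⟩ := hs x hx
        refine ⟨i, by omega, congrArg _ (Function.update_of_ne ?_ _ _).symm⟩
        rintro rfl
        omega

theorem crossHemi_mem_on {k : ℕ} (hk : k ≤ n) :
    crossHemi n k ∈ on fun l => l.length = k + 1 ∧ ∃ s : SignVector n, ∀ x ∈ l, x ∈ cap 1 1 s.1 := by
  refine on_mono (fun l ⟨hl, s, hs⟩ => ⟨hl, s, fun x hx => ?_⟩) (crossHemi_mem_on_vertices hk)
  obtain ⟨i, -, rfl⟩ := hs x hx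
  refine ⟨?_, by simp [s.2 i]⟩
  have : s.1 i * s.1 i = 1 := by rw [← abs_mul_abs_self, s.2, one_mul]
  simp [this]

theorem sd_iterate_neg (k N : ℕ) (c : TupleChain 𝔼) :
    (sd k)^[N] (map (fun x => -x) c) = map (fun x => -x) ((sd k)^[N] c) :=
  sd_iterate_map IsLinearMap.isLinearMap_neg k N c

theorem extend_alt_sd_smul_crossHemi_add {s : ℕ → 𝔼 → ZMod 2} {R : ℝ} (hR : 0 ≤ R)
    (hs : ∀ x, R ≤ (n + 1) * ‖x‖ → ∀ j, s j (-x) = s j x + 1) {k : ℕ} (hk : k ≤ n) (N : ℕ) :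
    extend (alt s 0) ((sd (k + 1))^[N] (map (fun x => R • x)
      (crossHemi n k + map (fun x => -x) (crossHemi n k)))) = 1 := by
  have hmem (k : ℕ) (hk : k ≤ n) : map (fun x => R • x) (crossHemi n k) ∈
      on fun l => l.length = k + 1 ∧ ∃ s : SignVector n, ∀ x ∈ l, x ∈ cap R R s.1 := by
    refine map_mem_on ?_ (crossHemi_mem_on hk)
    rintro l ⟨hl, σ, hσ⟩
    refine ⟨by simpa using hl, σ, ?_⟩
    simp only [List.mem_map, forall_exists_index, and_imp, forall_apply_eq_imp_iff₂]
    intro x hx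
    simpa using smul_mem_cap hR (hσ x hx)
  have step (k : ℕ) (hk : k ≤ n) : extend (alt s 0) ((sd (k + 1))^[N] (map (fun x => R • x)
      (crossHemi n k + map (fun x => -x) (crossHemi n k)))) =
      extend (alt s 0) ((sd k)^[N] (map (fun x => R • x) (boundary (crossHemi n k)))) := by
    have e : map (fun x : 𝔼 => R • x) (map (fun x => -x) (crossHemi n k)) =
        map (fun x => -x) (map (fun x => R • x) (crossHemi n k)) :=
      eq_of_single (f := map (fun x : 𝔼 => R • x) ∘ₗ map (fun x => -x))
        (g := map (fun x => -x) ∘ₗ map (fun x => R • x))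
        (fun l => by simp [Function.comp_def]) _
    rw [map_add, sd_iterate_add, e, sd_iterate_neg, ← boundary_map,
      ← boundary_sd_iterate k N (on_mono (fun l h => h.1) (hmem k hk)), extend_alt_boundary]
    refine eq_of_on (f := extend (alt s 0) ∘ₗ (LinearMap.id + map fun x => -x))
      (g := extend (cupDelta s 0)) ?_
      (sd_iterate_mem_on (fun σ : SignVector n => convex_cap R R σ.1) (k + 1) N (hmem k hk))
    rintro l ⟨-, σ, hσ⟩
    simp only [LinearMap.comp_apply, LinearMap.add_apply, LinearMap.id_apply, map_add,
      map_single, extend_single]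
    exact alt_add_alt_map 0 l fun x hx => hs x (le_norm_of_mem_cap σ.2 (hσ x hx))
  induction k with
  | zero =>
    rw [step 0 hk, boundary_hemi_zero, map_single, sd_zero_iterate, extend_single]
    rfl
  | succ k ih => rw [step (k + 1) hk, boundary_hemi_succ neg_involutive, ih (by omega)]

theorem extend_alt_sd_crossHemi_add {s : ℕ → 𝔼 → ZMod 2}
    (hs : ∀ x, x ≠ 0 → ‖x‖ ≤ 1 → ∀ j, s j (-x) = s j x) {k : ℕ} (hk : k ≤ n) (N : ℕ) :
    extend (alt s 0) ((sd (k + 1))^[N] (crossHemi n k + map (fun x => -x) (crossHemi n k))) =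
      0 := by
  have h := sd_iterate_mem_on (fun σ : SignVector n => convex_cap 1 1 σ.1) (k + 1) N
    (crossHemi_mem_on hk)
  rw [sd_iterate_add, sd_iterate_neg]
  refine eq_of_on (f := extend (alt s 0) ∘ₗ (LinearMap.id + map fun x => -x)) (g := 0)
    (fun l ⟨_, σ, hσ⟩ => ?_) h
  simp only [LinearMap.comp_apply, LinearMap.add_apply, LinearMap.id_apply, map_add,
    map_single, extend_single, LinearMap.zero_apply]
  rw [alt_map_of_invariant, CharTwo.add_self_eq_zero]
  intro x hx
  refine hs x ?_ (by simpa using (hσ x hx).2)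
  rintro rfl
  have := le_norm_of_mem_cap σ.2 (hσ 0 hx)
  norm_num at this

/-- There is no continuous family of unit vectors on the punctured space which is even near the
origin and odd far from it. -/
theorem not_even_near_zero_and_odd_at_infinity {F : 𝔼 → 𝔼} (hF : ContinuousOn F {0}ᶜ)
    (hnorm : ∀ x, x ≠ 0 → ‖F x‖ = 1) (heven : ∀ x, x ≠ 0 → ‖x‖ ≤ 1 → F (-x) = F x)
    (hodd : ∀ x, 2 ≤ ‖x‖ → F (-x) = -F x) : False := by
  have hn : (0 : ℝ) < n + 1 := by positivity
  set R : ℝ := 2 * (n + 1) with hRdef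
  have hR1 : 1 ≤ R := by linarith [n.cast_nonneg (α := ℝ)]
  have hR0 : 0 ≤ R := zero_le_one.trans hR1
  let s : ℕ → 𝔼 → ZMod 2 := fun i x => coordSign i (F x)
  let K : Set 𝔼 := Metric.closedBall 0 R ∩ {x | 1 ≤ (n + 1) * ‖x‖}
  have hK : IsCompact K := (isCompact_closedBall 0 R).inter_right
    (isClosed_le continuous_const (by fun_prop))
  have hK0 : ∀ x ∈ K, x ≠ 0 := by
    rintro x ⟨-, hx⟩ rfl
    norm_num at hx
  have hcapK (σ : SignVector n) : cap 1 R σ.1 ⊆ K := fun x hx =>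
    ⟨hx.2, le_norm_of_mem_cap σ.2 hx⟩
  obtain ⟨δ, hδ, hunif⟩ := Metric.uniformContinuousOn_iff.1
    (hK.uniformContinuousOn_of_continuous (hF.mono hK0)) ((n : ℝ) + 1)⁻¹ (by positivity)
  obtain ⟨N, hN⟩ : ∃ N : ℕ, (1 - ((n + 2 : ℕ) : ℝ)⁻¹) ^ N * (2 * R) < δ := by
    have h1 : ((n + 2 : ℕ) : ℝ)⁻¹ ≤ 1 := inv_le_one_of_one_le₀ (by norm_cast; omega)
    have h2 : 0 < ((n + 2 : ℕ) : ℝ)⁻¹ := by positivity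
    obtain ⟨N, hN⟩ := exists_pow_lt_of_lt_one (show 0 < δ / (2 * R) by positivity)
      (show 1 - ((n + 2 : ℕ) : ℝ)⁻¹ < 1 by linarith)
    exact ⟨N, (lt_div_iff₀ (by positivity)).1 hN⟩
  set z := crossHemi n n + map (fun x => -x) (crossHemi n n)
  have hzmem : z ∈ on fun l => l.length = n + 1 ∧
      ∃ σ : SignVector n, ∀ x ∈ l, x ∈ cap 1 1 σ.1 := by
    refine add_mem (crossHemi_mem_on le_rfl) (map_mem_on ?_ (crossHemi_mem_on le_rfl))
    rintro l ⟨hl, σ, hσ⟩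
    refine ⟨by simpa using hl, ⟨-σ.1, by simp [σ.2]⟩, ?_⟩
    simp only [List.mem_map, forall_exists_index, and_imp, forall_apply_eq_imp_iff₂]
    exact fun x hx => neg_mem_cap (hσ x hx)
  have hW : prism (fun x => R • x) z ∈ on fun l => l.length = n + 2 ∧
      ∃ σ : SignVector n, (∀ x ∈ l, x ∈ cap 1 R σ.1) ∧ ∀ x ∈ l, ∀ y ∈ l, dist x y ≤ 2 * R := by
    refine map_mem_of_on (fun l ⟨hl, σ, hσ⟩ => ?_) hzmem
    rw [prism_single]
    refine on_mono (fun l' ⟨hl', hx'⟩ => ?_) (prismTuple_mem_on _ l)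
    have hcap : ∀ x ∈ l', x ∈ cap 1 R σ.1 := by
      intro x hx
      obtain ⟨y, hy, rfl | rfl⟩ := hx' x hx
      · exact cap_subset_cap le_rfl hR1 _ (hσ x hy)
      · exact cap_subset_cap (by simpa using hR1) (by simp) _ (smul_mem_cap hR0 (hσ y hy))
    refine ⟨by omega, σ, hcap, fun x hx y hy => ?_⟩
    have h1 := (hcap x hx).2
    have h2 := (hcap y hy).2
    rw [mem_closedBall_zero_iff] at h1 h2
    rw [dist_eq_norm]
    linarith [norm_sub_le x y]
  have hzero : extend (cupDelta s 0) ((sd (n + 2))^[N] (prism (fun x => R • x) z)) = 0 := by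
    refine eq_of_on (g := 0) (fun l ⟨hl, σ, hσ, hD⟩ => ?_)
      (sd_iterate_mem_on_dist (fun σ : SignVector n => convex_cap 1 R σ.1) (n + 2) N hW)
    rw [extend_single, LinearMap.zero_apply]
    obtain ⟨x₀, hx₀⟩ := List.exists_mem_of_length_pos (show 0 < l.length by omega)
    obtain ⟨i, hi⟩ := exists_le_abs_coord (hnorm x₀ (hK0 x₀ (hcapK σ (hσ x₀ hx₀))))
    have hi' : Fin.ofNat (n + 1) i.val = i := Fin.ext (Nat.mod_eq_of_lt i.isLt)
    have key : ∀ x ∈ l, s i x = s i x₀ := by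
      intro x hx
      apply coordSign_eq_of_abs_sub_lt
      rw [hi']
      refine lt_of_lt_of_le ?_ hi
      refine lt_of_le_of_lt ?_ (hunif x (hcapK σ (hσ x hx)) x₀ (hcapK σ (hσ x₀ hx₀))
        ((hD x hx x₀ hx₀).trans_lt hN))
      rw [dist_eq_norm]
      exact PiLp.norm_apply_le (F x - F x₀) i
    refine cupDelta_eq_zero (j := i) 0 l (by omega) fun x hx y hy => ?_
    rw [zero_add, key x hx, key y hy]
  have hbd : boundary (prism (fun x => R • x) z) = z + map (fun x => R • x) z := by
    rw [boundary_prism, boundary_hemi_add neg_involutive, map_zero, add_zero]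
  have hsodd : ∀ x, R ≤ (n + 1) * ‖x‖ → ∀ j, s j (-x) = s j x + 1 := by
    intro x hx j
    have hx2 : 2 ≤ ‖x‖ := by
      rw [hRdef, mul_comm] at hx
      exact le_of_mul_le_mul_left hx hn
    have hx0 : x ≠ 0 := by rintro rfl; norm_num at hx2
    have hFx : F x ≠ 0 := norm_ne_zero_iff.1 (by rw [hnorm x hx0]; exact one_ne_zero)
    simp only [s, hodd x hx2, coordSign_neg j hFx]
  have hseven : ∀ x, x ≠ 0 → ‖x‖ ≤ 1 → ∀ j, s j (-x) = s j x := by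
    intro x hx0 hx j
    simp only [s, heven x hx0 hx]
  rw [← extend_alt_boundary, boundary_sd_iterate (n + 1) N (on_mono (fun l h => h.1) hW), hbd,
    sd_iterate_add, map_add, extend_alt_sd_crossHemi_add hseven le_rfl, zero_add,
    extend_alt_sd_smul_crossHemi_add hR0 hsodd le_rfl] at hzero
  exact one_ne_zero hzero

end Sphere

/-- An even continuous self-map of the sphere `S^n` is not homotopic to an odd one. -/
theorem even_not_homotopic_odd (n : ℕ) (hn : 1 ≤ n)
    (f g : C(Metric.sphere (0 : EuclideanSpace ℝ (Fin (n + 1))) 1,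
            Metric.sphere (0 : EuclideanSpace ℝ (Fin (n + 1))) 1))
    (hf : ∀ x, f (-x) = f x)
    (hg : ∀ x, g (-x) = -g x) :
    ¬ f.Homotopic g := by
  rintro ⟨H⟩
  have hunit {x : EuclideanSpace ℝ (Fin (n + 1))} (hx : x ≠ 0) :
      ‖x‖⁻¹ • x ∈ Metric.sphere (0 : EuclideanSpace ℝ (Fin (n + 1))) 1 := by
    simp [norm_smul, hx]
  classical
  let F : EuclideanSpace ℝ (Fin (n + 1)) → EuclideanSpace ℝ (Fin (n + 1)) := fun x =>
    if hx : x ≠ 0 then (H.extend (‖x‖ - 1) ⟨‖x‖⁻¹ • x, hunit hx⟩) else 0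
  have hF {x : EuclideanSpace ℝ (Fin (n + 1))} (hx : x ≠ 0) :
      F x = H.extend (‖x‖ - 1) ⟨‖x‖⁻¹ • x, hunit hx⟩ := dif_pos hx
  have hneg {x : EuclideanSpace ℝ (Fin (n + 1))} (hx : x ≠ 0) :
      (⟨‖-x‖⁻¹ • -x, hunit (neg_ne_zero.2 hx)⟩ :
        Metric.sphere (0 : EuclideanSpace ℝ (Fin (n + 1))) 1) = -⟨‖x‖⁻¹ • x, hunit hx⟩ :=
    Subtype.ext (by simp)
  refine not_even_near_zero_and_odd_at_infinity (F := F) ?_ (fun x hx => ?_)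
    (fun x hx h => ?_) (fun x h => ?_)
  · rw [continuousOn_iff_continuous_domRestrict]
    have e : Set.domRestrict {0}ᶜ F = fun x : ({0}ᶜ : Set (EuclideanSpace ℝ (Fin (n + 1)))) =>
        (H.extend (‖x.1‖ - 1) ⟨‖x.1‖⁻¹ • x.1, hunit x.2⟩).1 := funext fun x => hF x.2
    rw [e]
    have hinv : Continuous fun x : ({0}ᶜ : Set (EuclideanSpace ℝ (Fin (n + 1)))) =>
        ‖x.1‖⁻¹ :=
      (continuous_norm.comp continuous_subtype_val).inv₀ fun x => norm_ne_zero_iff.2 x.2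
    have h₁ : Continuous fun x : ({0}ᶜ : Set (EuclideanSpace ℝ (Fin (n + 1)))) =>
        H.extend (‖x.1‖ - 1) := by fun_prop
    have h₂ : Continuous fun x : ({0}ᶜ : Set (EuclideanSpace ℝ (Fin (n + 1)))) =>
        (⟨‖x.1‖⁻¹ • x.1, hunit x.2⟩ : Metric.sphere (0 : EuclideanSpace ℝ (Fin (n + 1))) 1) :=
      (hinv.smul continuous_subtype_val).subtype_mk _
    exact continuous_subtype_val.comp (h₁.eval h₂)
  · rw [hF hx]
    exact mem_sphere_zero_iff_norm.1 (Subtype.property _)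
  · rw [hF hx, hF (neg_ne_zero.2 hx), hneg hx,
      H.extend_apply_of_le_zero (by rw [norm_neg]; linarith),
      H.extend_apply_of_le_zero (by linarith), hf]
  · have hx : x ≠ 0 := by rintro rfl; norm_num at h
    rw [hF hx, hF (neg_ne_zero.2 hx), hneg hx,
      H.extend_apply_of_one_le (by rw [norm_neg]; linarith),
      H.extend_apply_of_one_le (by linarith), hg]
    rfl
end
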